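/- The set of rational points (x, y) ∈ ℚ × ℚ satisfying y² = −2·11·19·173·(x−50)·(x−9)·(x−3)·(x+13)·(x³+2x²+3x+4) is exactly the six-element set {(50,0), (9,0), (3,0), (−13,0), (25,20247920), (25,−20247920)}. -/

import Mathlib

/-! ### The cubic ring `A[θ]`, `θ³ + 2θ² + 3θ + 4 = 0` -/

@[ext] structure C3 (A : Type) where
  a : A
  b : A
  c : A

namespace C3

variable {A : Type}

instance [DecidableEq A] : DecidableEq (C3 A) := fun x y =>
  if h : x.a = y.a ∧ x.b = y.b ∧ x.c = y.c then isTrue (by ext <;> simp [h])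
  else isFalse (by rintro rfl; simp at h)

section ring
variable [CommRing A]

instance : Zero (C3 A) := ⟨⟨0, 0, 0⟩⟩
instance : One (C3 A) := ⟨⟨1, 0, 0⟩⟩
instance : Add (C3 A) := ⟨fun x y => ⟨x.a + y.a, x.b + y.b, x.c + y.c⟩⟩
instance : Neg (C3 A) := ⟨fun x => ⟨-x.a, -x.b, -x.c⟩⟩
instance : Sub (C3 A) := ⟨fun x y => ⟨x.a - y.a, x.b - y.b, x.c - y.c⟩⟩
instance : Mul (C3 A) := ⟨fun x y =>
  ⟨x.a * y.a - 4 * (x.b * y.c + x.c * y.b) + 8 * (x.c * y.c),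
   x.a * y.b + x.b * y.a - 3 * (x.b * y.c + x.c * y.b) + 2 * (x.c * y.c),
   x.a * y.c + x.b * y.b + x.c * y.a - 2 * (x.b * y.c + x.c * y.b) + x.c * y.c⟩⟩
instance : NatCast (C3 A) := ⟨fun n => ⟨n, 0, 0⟩⟩
instance : IntCast (C3 A) := ⟨fun n => ⟨n, 0, 0⟩⟩

@[simp] lemma zero_a : (0 : C3 A).a = 0 := rfl
@[simp] lemma zero_b : (0 : C3 A).b = 0 := rfl
@[simp] lemma zero_c : (0 : C3 A).c = 0 := rfl
@[simp] lemma one_a : (1 : C3 A).a = 1 := rfl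
@[simp] lemma one_b : (1 : C3 A).b = 0 := rfl
@[simp] lemma one_c : (1 : C3 A).c = 0 := rfl
@[simp] lemma add_a (x y : C3 A) : (x + y).a = x.a + y.a := rfl
@[simp] lemma add_b (x y : C3 A) : (x + y).b = x.b + y.b := rfl
@[simp] lemma add_c (x y : C3 A) : (x + y).c = x.c + y.c := rfl
@[simp] lemma sub_a (x y : C3 A) : (x - y).a = x.a - y.a := rfl
@[simp] lemma sub_b (x y : C3 A) : (x - y).b = x.b - y.b := rfl
@[simp] lemma sub_c (x y : C3 A) : (x - y).c = x.c - y.c := rfl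
@[simp] lemma neg_a (x : C3 A) : (-x).a = -x.a := rfl
@[simp] lemma neg_b (x : C3 A) : (-x).b = -x.b := rfl
@[simp] lemma neg_c (x : C3 A) : (-x).c = -x.c := rfl
@[simp] lemma mul_a (x y : C3 A) : (x * y).a =
  x.a * y.a - 4 * (x.b * y.c + x.c * y.b) + 8 * (x.c * y.c) := rfl
@[simp] lemma mul_b (x y : C3 A) : (x * y).b =
  x.a * y.b + x.b * y.a - 3 * (x.b * y.c + x.c * y.b) + 2 * (x.c * y.c) := rfl
@[simp] lemma mul_c (x y : C3 A) : (x * y).c =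
  x.a * y.c + x.b * y.b + x.c * y.a - 2 * (x.b * y.c + x.c * y.b) + x.c * y.c := rfl
@[simp] lemma natCast_a (n : ℕ) : (n : C3 A).a = n := rfl
@[simp] lemma natCast_b (n : ℕ) : (n : C3 A).b = 0 := rfl
@[simp] lemma natCast_c (n : ℕ) : (n : C3 A).c = 0 := rfl
@[simp] lemma intCast_a (n : ℤ) : (n : C3 A).a = n := rfl
@[simp] lemma intCast_b (n : ℤ) : (n : C3 A).b = 0 := rfl
@[simp] lemma intCast_c (n : ℤ) : (n : C3 A).c = 0 := rfl

instance : CommRing (C3 A) where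
  add_assoc x y z := by ext <;> simp <;> ring
  zero_add x := by ext <;> simp
  add_zero x := by ext <;> simp
  add_comm x y := by ext <;> simp <;> ring
  neg_add_cancel x := by ext <;> simp
  sub_eq_add_neg x y := by ext <;> simp <;> ring
  mul_assoc x y z := by ext <;> simp <;> ring
  one_mul x := by ext <;> simp
  mul_one x := by ext <;> simp
  mul_comm x y := by ext <;> simp <;> ring
  left_distrib x y z := by ext <;> simp <;> ring
  right_distrib x y z := by ext <;> simp <;> ring
  zero_mul x := by ext <;> simp
  mul_zero x := by ext <;> simp
  nsmul := nsmulRec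
  zsmul := zsmulRec
  natCast_zero := by ext <;> simp
  natCast_succ n := by ext <;> simp
  intCast_ofNat n := by ext <;> simp
  intCast_negSucc n := by ext <;> simp

@[simp] lemma ofNat_a (n : ℕ) [n.AtLeastTwo] :
    (OfNat.ofNat n : C3 A).a = OfNat.ofNat n := by
  show ((OfNat.ofNat n : ℕ) : A) = _
  exact Nat.cast_ofNat
@[simp] lemma ofNat_b (n : ℕ) [n.AtLeastTwo] : (OfNat.ofNat n : C3 A).b = 0 := rfl
@[simp] lemma ofNat_c (n : ℕ) [n.AtLeastTwo] : (OfNat.ofNat n : C3 A).c = 0 := rfl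

/-- the adjugate: product of the other conjugates -/
def adj (x : C3 A) : C3 A :=
  ⟨x.a ^ 2 - 2 * x.a * x.b - 2 * x.a * x.c - 2 * x.b * x.c + x.c ^ 2 + 3 * x.b ^ 2,
   -(x.a * x.b) + 2 * x.b ^ 2 - 4 * x.b * x.c + 2 * x.c ^ 2,
   x.b ^ 2 - 2 * x.b * x.c - x.a * x.c + 3 * x.c ^ 2⟩

/-- the norm -/
def nm (x : C3 A) : A :=
  x.a ^ 3 - 2 * x.a ^ 2 * x.b - 2 * x.a ^ 2 * x.c + 6 * x.a * x.b * x.c - 7 * x.a * x.c ^ 2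
    + 3 * x.a * x.b ^ 2 + 8 * x.b ^ 2 * x.c - 12 * x.b * x.c ^ 2 + 16 * x.c ^ 3 - 4 * x.b ^ 3

/-- constants -/
def ofA (r : A) : C3 A := ⟨r, 0, 0⟩

lemma mul_adj (x : C3 A) : x * adj x = ofA (nm x) := by
  ext <;> simp [adj, nm, ofA] <;> ring

lemma nm_mul (x y : C3 A) : nm (x * y) = nm x * nm y := by
  simp [nm]; ring

lemma nm_one : nm (1 : C3 A) = 1 := by simp [nm]
lemma nm_zero : nm (0 : C3 A) = 0 := by simp [nm]
lemma nm_ofA (r : A) : nm (ofA r) = r ^ 3 := by simp [nm, ofA]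

end ring

lemma aniso_aux (n : ℕ) : ∀ x : C3 ℤ, x.a.natAbs + x.b.natAbs + x.c.natAbs ≤ n → nm x = 0 →
    x = 0 := by
  induction n using Nat.strong_induction_on with
  | _ n ih =>
    intro x hx h0
    have key : ∀ a b c : ZMod 3, a ^ 3 - 2 * a ^ 2 * b - 2 * a ^ 2 * c + 6 * a * b * c
        - 7 * a * c ^ 2 + 3 * a * b ^ 2 + 8 * b ^ 2 * c - 12 * b * c ^ 2 + 16 * c ^ 3 - 4 * b ^ 3 = 0
        → a = 0 ∧ b = 0 ∧ c = 0 := by decide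
    have h1 := key x.a x.b x.c (by
      have := congrArg (fun z : ℤ => (z : ZMod 3)) h0
      simp only [nm] at this
      push_cast at this
      exact this)
    obtain ⟨ha, hb, hc⟩ := h1
    rw [ZMod.intCast_zmod_eq_zero_iff_dvd _ 3] at ha hb hc
    obtain ⟨p, hp⟩ := ha
    obtain ⟨q, hq⟩ := hb
    obtain ⟨r, hr⟩ := hc
    push_cast at hp hq hr
    by_cases hz : x.a.natAbs + x.b.natAbs + x.c.natAbs = 0
    · ext <;> simp <;> omega
    have hy : (⟨p, q, r⟩ : C3 ℤ) = 0 := by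
      refine ih (p.natAbs + q.natAbs + r.natAbs) (by omega) ⟨p, q, r⟩ le_rfl ?_
      have : nm x = 27 * nm (⟨p, q, r⟩ : C3 ℤ) := by
        simp only [nm, hp, hq, hr]; ring
      omega
    have e1 := congrArg C3.a hy
    have e2 := congrArg C3.b hy
    have e3 := congrArg C3.c hy
    simp at e1 e2 e3
    ext <;> simp <;> omega

lemma nm_eq_zero {x : C3 ℤ} (h : nm x = 0) : x = 0 := aniso_aux _ x le_rfl h

/-- inclusion -/
def inc : C3 ℤ →+* C3 ℚ where
  toFun x := ⟨x.a, x.b, x.c⟩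
  map_one' := by ext <;> simp
  map_mul' x y := by ext <;> simp
  map_zero' := by ext <;> simp
  map_add' x y := by ext <;> simp

lemma nm_inc (x : C3 ℤ) : nm (inc x) = ((nm x : ℤ) : ℚ) := by simp [nm, inc]

lemma exists_den (x : C3 ℚ) : ∃ (d : ℤ) (y : C3 ℤ), d ≠ 0 ∧ ofA (d : ℚ) * x = inc y := by
  refine ⟨x.a.den * x.b.den * x.c.den, ⟨x.a.num * x.b.den * x.c.den, x.b.num * x.a.den * x.c.den,
    x.c.num * x.a.den * x.b.den⟩, by positivity, ?_⟩
  have ha := Rat.mul_den_eq_num x.a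
  have hb := Rat.mul_den_eq_num x.b
  have hc := Rat.mul_den_eq_num x.c
  ext
  · simp [ofA, inc]; rw [← ha]; ring
  · simp [ofA, inc]; rw [← hb]; ring
  · simp [ofA, inc]; rw [← hc]; ring

lemma nmQ_eq_zero {x : C3 ℚ} (h : nm x = 0) : x = 0 := by
  obtain ⟨d, y, hd, hy⟩ := exists_den x
  have : nm y = 0 := by
    have := congrArg nm hy
    rw [nm_mul, h, mul_zero, nm_inc] at this
    exact_mod_cast this.symm
  have hy0 := nm_eq_zero this
  rw [hy0, map_zero] at hy
  have h1 := congrArg C3.a hy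
  have h2 := congrArg C3.b hy
  have h3 := congrArg C3.c hy
  have hd' : (d : ℚ) ≠ 0 := by exact_mod_cast hd
  simp [ofA, hd] at h1 h2 h3
  ext <;> simpa

noncomputable instance : Field (C3 ℚ) where
  inv x := adj x * ofA (nm x)⁻¹
  exists_pair_ne := ⟨0, 1, fun h => by simpa using congrArg C3.a h⟩
  mul_inv_cancel x hx := by
    have h : nm x ≠ 0 := fun h => hx (nmQ_eq_zero h)
    rw [← mul_assoc, mul_adj]
    ext <;> simp [ofA, h]
  inv_zero := by simp [nm_zero, ofA]; ext <;> simp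
  nnqsmul := _
  qsmul := _

instance : IsDomain (C3 ℤ) := by
  refine @NoZeroDivisors.to_isDomain _ _ ⟨0, 1, fun h => by simpa using congrArg C3.a h⟩ ⟨?_⟩
  intro x y h
  have : nm x * nm y = 0 := by rw [← nm_mul, h, nm_zero]
  rcases mul_eq_zero.1 this with h | h
  · exact Or.inl (nm_eq_zero h)
  · exact Or.inr (nm_eq_zero h)

noncomputable instance : Algebra (C3 ℤ) (C3 ℚ) := inc.toAlgebra

lemma algebraMap_eq : algebraMap (C3 ℤ) (C3 ℚ) = inc := rfl

lemma inc_injective : Function.Injective inc := by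
  intro x y h
  have h1 := congrArg C3.a h
  have h2 := congrArg C3.b h
  have h3 := congrArg C3.c h
  simp [inc] at h1 h2 h3
  ext <;> assumption

instance : FaithfulSMul (C3 ℤ) (C3 ℚ) :=
  (faithfulSMul_iff_algebraMap_injective _ _).2 inc_injective

lemma inc_ofA (d : ℤ) : inc (ofA d) = ofA (d : ℚ) := by ext <;> simp [inc, ofA]

lemma exists_frac (x : C3 ℚ) : ∃ p q : C3 ℤ, q ≠ 0 ∧ x * inc q = inc p := by
  obtain ⟨d, y, hd, hy⟩ := exists_den x
  refine ⟨y, ofA d, fun h => hd (by simpa [ofA] using congrArg C3.a h), ?_⟩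
  rw [← hy, inc_ofA, mul_comm]

instance : IsFractionRing (C3 ℤ) (C3 ℚ) := by
  refine IsFractionRing.of_field _ _ fun z => ?_
  obtain ⟨p, q, hq, h⟩ := exists_frac z
  refine ⟨p, q, ?_⟩
  have : inc q ≠ 0 := by rwa [Ne, map_eq_zero_iff inc inc_injective]
  rw [algebraMap_eq, eq_div_iff this, h]

/-! #### The ring is norm-Euclidean -/

/-- Taylor bound for the norm on the box of half-width one around `(x,y,z)`. -/
def bd (x y z : ℤ) : ℕ :=
  (x ^ 3 - 2 * x ^ 2 * y - 2 * x ^ 2 * z + 6 * x * y * z - 7 * x * z ^ 2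
    + 3 * x * y ^ 2 + 8 * y ^ 2 * z - 12 * y * z ^ 2 + 16 * z ^ 3 - 4 * y ^ 3).natAbs
  + (3 * x ^ 2 - 4 * x * y - 4 * x * z + 6 * y * z - 7 * z ^ 2 + 3 * y ^ 2).natAbs
  + (-2 * x ^ 2 + 6 * x * z + 6 * x * y + 16 * y * z - 12 * z ^ 2 - 12 * y ^ 2).natAbs
  + (-2 * x ^ 2 + 6 * x * y - 14 * x * z + 8 * y ^ 2 - 24 * y * z + 48 * z ^ 2).natAbs
  + (3 * x - 2 * y - 2 * z).natAbs
  + (3 * x + 8 * z - 12 * y).natAbs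
  + (-7 * x - 12 * y + 48 * z).natAbs
  + (-4 * x + 6 * z + 6 * y).natAbs
  + (-4 * x + 6 * y - 14 * z).natAbs
  + (6 * x + 16 * y - 24 * z).natAbs
  + 61

lemma abs_mul_le_of_abs_le_one {u t : ℚ} (h : |t| ≤ 1) : |u * t| ≤ |u| := by
  rw [abs_mul]; exact mul_le_of_le_one_right (abs_nonneg _) h

lemma bd_spec (x y z : ℤ) (u v w : ℚ) (hu : |u| ≤ 1) (hv : |v| ≤ 1) (hw : |w| ≤ 1) :
    |nm (⟨x + u, y + v, z + w⟩ : C3 ℚ)| ≤ bd x y z := by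
  have m : ∀ {s t : ℚ}, |s| ≤ 1 → |t| ≤ 1 → |s * t| ≤ 1 := fun hs ht => by
    rw [abs_mul]; exact mul_le_one₀ hs (abs_nonneg _) ht
  have huu := m hu hu
  have hvv := m hv hv
  have hww := m hw hw
  have huv := m hu hv
  have huw := m hu hw
  have hvw := m hv hw
  have t := fun (c s : ℚ) (h : |s| ≤ 1) => abs_le.1 (abs_mul_le_of_abs_le_one (u := c) h)
  have e0 := abs_le.1 (le_refl |((x : ℚ) ^ 3 - 2 * x ^ 2 * y - 2 * x ^ 2 * z + 6 * x * y * z - 7 * x * z ^ 2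
    + 3 * x * y ^ 2 + 8 * y ^ 2 * z - 12 * y * z ^ 2 + 16 * z ^ 3 - 4 * y ^ 3)|)
  have e1 := t (3 * x ^ 2 - 4 * x * y - 4 * x * z + 6 * y * z - 7 * z ^ 2 + 3 * y ^ 2) u hu
  have e2 := t (-2 * x ^ 2 + 6 * x * z + 6 * x * y + 16 * y * z - 12 * z ^ 2 - 12 * y ^ 2) v hv
  have e3 := t (-2 * x ^ 2 + 6 * x * y - 14 * x * z + 8 * y ^ 2 - 24 * y * z + 48 * z ^ 2) w hw
  have e4 := t (3 * x - 2 * y - 2 * z) (u * u) huu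
  have e5 := t (3 * x + 8 * z - 12 * y) (v * v) hvv
  have e6 := t (-7 * x - 12 * y + 48 * z) (w * w) hww
  have e7 := t (-4 * x + 6 * z + 6 * y) (u * v) huv
  have e8 := t (-4 * x + 6 * y - 14 * z) (u * w) huw
  have e9 := t (6 * x + 16 * y - 24 * z) (v * w) hvw
  have f1 := abs_le.1 (m hu huu)
  have f2 := abs_le.1 (m huu hv)
  have f3 := abs_le.1 (m huu hw)
  have f4 := abs_le.1 (m hu hvw)
  have f5 := abs_le.1 (m hu hww)
  have f6 := abs_le.1 (m hu hvv)
  have f7 := abs_le.1 (m hvv hw)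
  have f8 := abs_le.1 (m hv hww)
  have f9 := abs_le.1 (m hw hww)
  have f10 := abs_le.1 (m hv hvv)
  rw [abs_le]
  simp only [nm, bd, Nat.cast_add, Nat.cast_natAbs, Int.cast_abs]
  push_cast
  constructor <;> linarith

def cand : List (ℤ × ℤ × ℤ) := [(-1, 0, 0), (0, 0, 0), (1, 1, 1), (2, 1, 1), (0, 1, 1), (-1, 1, 0),
  (0, 0, 1), (0, 1, 0), (1, 0, 1), (-2, 0, 0), (0, -1, 0), (1, 2, 1), (2, 0, 1), (-2, 0, -1),
  (1, 1, 0), (-1, -1, 0), (1, 0, 0)]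

/-- covering check: box of centre `(p,q,r)/2^d` and half-width `1/2^d` -/
def cov : ℕ → ℕ → ℤ → ℤ → ℤ → Bool
  | 0, _, _, _, _ => false
  | f + 1, d, p, q, r =>
    (cand.any fun g => Nat.blt (bd (p - 2 ^ d * g.1) (q - 2 ^ d * g.2.1) (r - 2 ^ d * g.2.2)) (8 ^ d))
    || (cov f (d + 1) (2 * p - 1) (2 * q - 1) (2 * r - 1)
      && cov f (d + 1) (2 * p - 1) (2 * q - 1) (2 * r + 1)
      && cov f (d + 1) (2 * p - 1) (2 * q + 1) (2 * r - 1)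
      && cov f (d + 1) (2 * p - 1) (2 * q + 1) (2 * r + 1)
      && cov f (d + 1) (2 * p + 1) (2 * q - 1) (2 * r - 1)
      && cov f (d + 1) (2 * p + 1) (2 * q - 1) (2 * r + 1)
      && cov f (d + 1) (2 * p + 1) (2 * q + 1) (2 * r - 1)
      && cov f (d + 1) (2 * p + 1) (2 * q + 1) (2 * r + 1))

lemma cov_true : cov 5 1 1 1 1 = true := by decide +kernel

lemma half_split (d : ℕ) (p : ℤ) (x : ℚ) (h : |2 ^ d * x - p| ≤ 1) :
    |2 ^ (d + 1) * x - (2 * p - 1 : ℤ)| ≤ 1 ∨ |2 ^ (d + 1) * x - (2 * p + 1 : ℤ)| ≤ 1 := by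
  rw [abs_le] at h
  push_cast
  rw [abs_le, abs_le, pow_succ]
  rcases le_total (2 ^ d * x) p with h' | h'
  · left; constructor <;> linarith
  · right; constructor <;> linarith

lemma cov_spec : ∀ (f d : ℕ) (p q r : ℤ), cov f d p q r = true → ∀ x y z : ℚ,
    |2 ^ d * x - p| ≤ 1 → |2 ^ d * y - q| ≤ 1 → |2 ^ d * z - r| ≤ 1 →
    ∃ g : C3 ℤ, |nm ((⟨x, y, z⟩ : C3 ℚ) - inc g)| < 1 := by
  intro f
  induction f with
  | zero => intro d p q r h; simp [cov] at h
  | succ f ih =>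
    intro d p q r h x y z hx hy hz
    rw [cov, Bool.or_eq_true] at h
    rcases h with h | h
    · rw [List.any_eq_true] at h
      obtain ⟨g, -, hg⟩ := h
      refine ⟨⟨g.1, g.2.1, g.2.2⟩, ?_⟩
      have hg' := Nat.blt_eq.mp hg
      have := bd_spec (p - 2 ^ d * g.1) (q - 2 ^ d * g.2.1) (r - 2 ^ d * g.2.2) _ _ _ hx hy hz
      have e : (⟨((p - 2 ^ d * g.1 : ℤ) : ℚ) + (2 ^ d * x - p), ((q - 2 ^ d * g.2.1 : ℤ) : ℚ) + (2 ^ d * y - q),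
          ((r - 2 ^ d * g.2.2 : ℤ) : ℚ) + (2 ^ d * z - r)⟩ : C3 ℚ) =
          ofA (2 ^ d) * ((⟨x, y, z⟩ : C3 ℚ) - inc ⟨g.1, g.2.1, g.2.2⟩) := by
        ext <;> simp [ofA, inc] <;> ring
      rw [e, nm_mul, nm_ofA, abs_mul] at this
      have h8 : |((2 : ℚ) ^ d) ^ 3| = 8 ^ d := by
        rw [abs_of_nonneg (by positivity), ← pow_mul, mul_comm, pow_mul]; norm_num
      rw [h8] at this
      have hlt : (bd (p - 2 ^ d * g.1) (q - 2 ^ d * g.2.1) (r - 2 ^ d * g.2.2) : ℚ) < 8 ^ d := by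
        exact_mod_cast hg'
      have := lt_of_le_of_lt this hlt
      by_contra hcon
      push Not at hcon
      nlinarith [show (0 : ℚ) < 8 ^ d by positivity]
    · simp only [Bool.and_eq_true] at h
      obtain ⟨⟨⟨⟨⟨⟨⟨h1, h2⟩, h3⟩, h4⟩, h5⟩, h6⟩, h7⟩, h8⟩ := h
      rcases half_split d p x hx with hx | hx <;> rcases half_split d q y hy with hy | hy <;>
        rcases half_split d r z hz with hz | hz
      · exact ih _ _ _ _ h1 _ _ _ hx hy hz
      · exact ih _ _ _ _ h2 _ _ _ hx hy hz
      · exact ih _ _ _ _ h3 _ _ _ hx hy hz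
      · exact ih _ _ _ _ h4 _ _ _ hx hy hz
      · exact ih _ _ _ _ h5 _ _ _ hx hy hz
      · exact ih _ _ _ _ h6 _ _ _ hx hy hz
      · exact ih _ _ _ _ h7 _ _ _ hx hy hz
      · exact ih _ _ _ _ h8 _ _ _ hx hy hz

lemma exists_near (x : C3 ℚ) : ∃ g : C3 ℤ, |nm (x - inc g)| < 1 := by
  have hf : ∀ t : ℚ, |2 ^ 1 * Int.fract t - (1 : ℤ)| ≤ 1 := fun t => by
    rw [abs_le]; push_cast
    constructor <;> linarith [Int.fract_nonneg t, Int.fract_lt_one t]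
  obtain ⟨g, hg⟩ := cov_spec 5 1 1 1 1 cov_true _ _ _ (hf x.a) (hf x.b) (hf x.c)
  refine ⟨g + ⟨⌊x.a⌋, ⌊x.b⌋, ⌊x.c⌋⟩, ?_⟩
  convert hg using 3
  ext
  · simp [inc]; linarith [Int.self_sub_floor x.a]
  · simp [inc]; linarith [Int.self_sub_floor x.b]
  · simp [inc]; linarith [Int.self_sub_floor x.c]

lemma exists_rem (x y : C3 ℤ) (hy : y ≠ 0) : ∃ g : C3 ℤ, (nm (x - g * y)).natAbs < (nm y).natAbs := by
  have hy' : inc y ≠ 0 := by rwa [Ne, map_eq_zero_iff inc inc_injective]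
  obtain ⟨g, hg⟩ := exists_near (inc x / inc y)
  refine ⟨g, ?_⟩
  have e : inc (x - g * y) = (inc x / inc y - inc g) * inc y := by
    rw [map_sub, map_mul, sub_mul, div_mul_cancel₀ _ hy']
  have h := congrArg nm e
  rw [nm_mul, nm_inc, nm_inc] at h
  have hn : nm y ≠ 0 := fun h => hy (nm_eq_zero h)
  have hpos : (0 : ℚ) < |((nm y : ℤ) : ℚ)| := by rw [abs_pos]; exact_mod_cast hn
  have : |((nm (x - g * y) : ℤ) : ℚ)| < |((nm y : ℤ) : ℚ)| := by
    rw [h, abs_mul]; nlinarith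
  have h2 : |nm (x - g * y)| < |nm y| := by exact_mod_cast this
  zify; exact h2

instance : IsPrincipalIdealRing (C3 ℤ) := by
  constructor
  intro I
  by_cases hI : I = ⊥
  · rw [hI]; infer_instance
  obtain ⟨z, hz, hz0⟩ := Submodule.exists_mem_ne_zero_of_ne_bot hI
  have hex : ∃ n, ∃ x ∈ I, x ≠ 0 ∧ (nm x).natAbs = n := ⟨_, z, hz, hz0, rfl⟩
  classical
  obtain ⟨y, hy, hy0, hyn⟩ := Nat.find_spec hex
  refine ⟨y, le_antisymm (fun x hx => ?_) ?_⟩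
  · obtain ⟨g, hg⟩ := exists_rem x y hy0
    have hmem : x - g * y ∈ I := I.sub_mem hx (I.mul_mem_left _ hy)
    have h0 : x - g * y = 0 := by
      by_contra hne
      have := Nat.find_min' hex ⟨_, hmem, hne, rfl⟩
      omega
    rw [Submodule.mem_span_singleton]
    exact ⟨g, by rw [smul_eq_mul]; linear_combination -h0⟩
  · rw [Submodule.span_le]; simpa using hy

end C3

namespace C3

lemma exists_root : ∃ t : ℝ, -1.6507 ≤ t ∧ t ≤ -1.6506 ∧ t ^ 3 + 2 * t ^ 2 + 3 * t + 4 = 0 := by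
  have hc : ContinuousOn (fun t : ℝ => t ^ 3 + 2 * t ^ 2 + 3 * t + 4) (Set.Icc (-1.6507) (-1.6506)) := by
    fun_prop
  have := intermediate_value_Icc (by norm_num) hc
  obtain ⟨t, ht, h⟩ := this (show (0 : ℝ) ∈ _ by constructor <;> norm_num)
  exact ⟨t, ht.1, ht.2, h⟩

/-- real embedding -/
noncomputable def sg (t : ℝ) (x : C3 ℤ) : ℝ := x.a + x.b * t + x.c * t ^ 2

lemma sg_mul {t : ℝ} (h : t ^ 3 + 2 * t ^ 2 + 3 * t + 4 = 0) (x y : C3 ℤ) :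
    sg t (x * y) = sg t x * sg t y := by
  simp only [sg, mul_a, mul_b, mul_c]
  push_cast
  linear_combination (-(x.c * y.c * t : ℝ) - (x.b * y.c + x.c * y.b) + 2 * x.c * y.c) * h

lemma sg_adj {t : ℝ} (h : t ^ 3 + 2 * t ^ 2 + 3 * t + 4 = 0) (x : C3 ℤ) :
    sg t (adj x) = (x.a - x.b * (2 + t) / 2 + x.c * ((2 + t) ^ 2 / 2 - (t ^ 2 + 2 * t + 3))) ^ 2
      + (x.b - x.c * (2 + t)) ^ 2 * ((t ^ 2 + 2 * t + 3) - (2 + t) ^ 2 / 4) := by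
  simp only [sg, adj]
  push_cast
  linear_combination (-(x.c ^ 2 * (t + 2) : ℝ) + x.b * x.c) * h

lemma ub_c {t A B s : ℝ} {c : ℤ} (h1 : -1.6507 ≤ t) (h2 : t ≤ -1.6506)
    (hA3 : -1 ≤ A) (hA4 : A ≤ 1) (hB3 : -0.65 ≤ B) (hB4 : B ≤ 0.65) (hs1 : 1 ≤ s) (hs2 : s ≤ 13.6)
    (hc : c * (3 * t ^ 2 + 4 * t + 3) = s - A - B * (t + (2 + t) / 2)) : -1 < c ∧ c < 4 := by
  have hf1 : 4.5 ≤ 3 * t ^ 2 + 4 * t + 3 := by nlinarith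
  obtain ⟨hb1, hb2⟩ : -1 ≤ B * (t + (2 + t) / 2) ∧ B * (t + (2 + t) / 2) ≤ 1 := by
    constructor <;> nlinarith
  constructor
  · by_contra hcon
    have : (c : ℝ) ≤ -1 := by exact_mod_cast (not_lt.1 hcon)
    nlinarith
  · by_contra hcon
    have : (4 : ℝ) ≤ c := by exact_mod_cast (not_lt.1 hcon)
    nlinarith

lemma ub_b {t B : ℝ} {b c : ℤ} (h1 : -1.6507 ≤ t) (h2 : t ≤ -1.6506)
    (hB3 : -0.65 ≤ B) (hB4 : B ≤ 0.65) (c0 : -1 < c) (c1 : c < 4)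
    (bb : (b : ℝ) = B + c * (2 + t)) : -1 < b ∧ b < 2 := by
  have hc0 : (0 : ℝ) ≤ c := by exact_mod_cast (by omega : 0 ≤ c)
  have hc1 : (c : ℝ) ≤ 3 := by exact_mod_cast (by omega : c ≤ 3)
  constructor
  · have : (-1 : ℝ) < b := by nlinarith
    exact_mod_cast this
  · have : (b : ℝ) < 2 := by nlinarith
    exact_mod_cast this

lemma ub_a {t A : ℝ} {a b c : ℤ} (h1 : -1.6507 ≤ t) (h2 : t ≤ -1.6506)
    (hA3 : -1 ≤ A) (hA4 : A ≤ 1) (c0 : -1 < c) (c1 : c < 4) (b0 : -1 < b) (b1 : b < 2)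
    (aa : (a : ℝ) = A + b * (2 + t) / 2 - c * ((2 + t) ^ 2 / 2 - (t ^ 2 + 2 * t + 3))) :
    -2 < a ∧ a < 10 := by
  have hc0 : (0 : ℝ) ≤ c := by exact_mod_cast (by omega : 0 ≤ c)
  have hc1 : (c : ℝ) ≤ 3 := by exact_mod_cast (by omega : c ≤ 3)
  have hb0 : (0 : ℝ) ≤ b := by exact_mod_cast (by omega : 0 ≤ b)
  have hb1 : (b : ℝ) ≤ 1 := by exact_mod_cast (by omega : b ≤ 1)
  have ht2 : (2 + t) ^ 2 / 2 - (t ^ 2 + 2 * t + 3) ≤ -2.3 := by nlinarith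
  have ht3 : -2.4 ≤ (2 + t) ^ 2 / 2 - (t ^ 2 + 2 * t + 3) := by nlinarith
  generalize (2 + t) ^ 2 / 2 - (t ^ 2 + 2 * t + 3) = w at *
  constructor
  · have : (-2 : ℝ) < a := by nlinarith
    exact_mod_cast this
  · have : (a : ℝ) < 10 := by nlinarith
    exact_mod_cast this

lemma ub_AB {A B D q s n : ℝ} (hD : 2.39 ≤ D) (hq : q = A ^ 2 + B ^ 2 * D) (hs : 1 ≤ s)
    (hn : n ≤ 1) (hp : s * q = n) : (-1 ≤ A ∧ A ≤ 1) ∧ -0.65 ≤ B ∧ B ≤ 0.65 := by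
  have hB0 : B ^ 2 * 2.39 ≤ B ^ 2 * D := mul_le_mul_of_nonneg_left hD (sq_nonneg B)
  have hB1 := sq_nonneg B
  have hA1 := sq_nonneg A
  have hQ0 : 0 ≤ q := by linarith
  have hQ1 : q ≤ 1 := by nlinarith
  have hA2 : A ^ 2 ≤ 1 := by linarith
  have hB2 : B ^ 2 ≤ 0.65 ^ 2 := by norm_num; linarith
  exact ⟨abs_le.1 ((sq_le_one_iff_abs_le_one _).1 hA2), abs_le_of_sq_le_sq' hB2 (by norm_num)⟩

lemma ub_key : ∀ a ∈ Finset.Ioo (-2 : ℤ) 10, ∀ b ∈ Finset.Ioo (-1 : ℤ) 2, ∀ c ∈ Finset.Ioo (-1 : ℤ) 4,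
      (nm (⟨a, b, c⟩ : C3 ℤ) = 1 ∨ nm (⟨a, b, c⟩ : C3 ℤ) = -1) →
      (a = 1 ∧ b = 0 ∧ c = 0) ∨ (a = 7 ∧ b = 1 ∧ c = 3) ∨ (a = -1 ∧ b = 0 ∧ c = 0)
       ∨ (a = -1 ∧ b = 1 ∧ c = 1) := by
    decide +kernel

lemma unit_bounds {t : ℝ} (h1 : -1.6507 ≤ t) (h2 : t ≤ -1.6506)
    (h : t ^ 3 + 2 * t ^ 2 + 3 * t + 4 = 0) (x : C3 ℤ) (hx : nm x = 1 ∨ nm x = -1)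
    (hs1 : 1 ≤ sg t x) (hs2 : sg t x ≤ 13.6) :
    x = 1 ∨ x = ⟨7, 1, 3⟩ := by
  have hprod : sg t x * sg t (adj x) = ((nm x : ℤ) : ℝ) := by
    rw [← sg_mul h, mul_adj]; simp [sg, ofA]
  have hn : ((nm x : ℤ) : ℝ) ≤ 1 := by rcases hx with h | h <;> rw [h] <;> norm_num
  have hD : 2.2 ≤ (t ^ 2 + 2 * t + 3) - (2 + t) ^ 2 / 4 := by nlinarith
  have hD : 2.39 ≤ (t ^ 2 + 2 * t + 3) - (2 + t) ^ 2 / 4 := by nlinarith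
  obtain ⟨⟨hA3, hA4⟩, hB3, hB4⟩ := ub_AB hD (sg_adj h x) hs1 hn hprod
  obtain ⟨a, b, c⟩ := x
  obtain ⟨c0, c1⟩ := ub_c (c := c) h1 h2 hA3 hA4 hB3 hB4 hs1 hs2 (by simp only [sg]; ring)
  obtain ⟨b0, b1⟩ := ub_b (b := b) h1 h2 hB3 hB4 c0 c1 (by simp only; ring)
  obtain ⟨a0, a1⟩ := ub_a (a := a) h1 h2 hA3 hA4 c0 c1 b0 b1 (by simp only; ring)
  rcases ub_key a (by simp; omega) b (by simp; omega) c (by simp; omega) hx with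
    ⟨rfl, rfl, rfl⟩ | ⟨rfl, rfl, rfl⟩ | ⟨rfl, rfl, rfl⟩ | ⟨rfl, rfl, rfl⟩
  · left; rfl
  · right; rfl
  · norm_num [sg] at hs1
  · norm_num [sg] at hs1; nlinarith

/-- the fundamental unit -/
def eps : (C3 ℤ)ˣ where
  val := ⟨1, -1, -1⟩
  inv := ⟨-7, -1, -3⟩
  val_inv := by decide
  inv_val := by decide

lemma nm_unit (u : (C3 ℤ)ˣ) : nm (u : C3 ℤ) = 1 ∨ nm (u : C3 ℤ) = -1 := by
  have : nm (u : C3 ℤ) * nm ((u⁻¹ : (C3 ℤ)ˣ) : C3 ℤ) = 1 := by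
    rw [← nm_mul, Units.mul_inv, nm_one]
  exact Int.isUnit_iff.1 (IsUnit.of_mul_eq_one _ this)

/-- units of the ring -/
theorem units_eq (u : (C3 ℤ)ˣ) : ∃ n : ℤ, u = eps ^ n ∨ u = -eps ^ n := by
  obtain ⟨t, h1, h2, h⟩ := exists_root
  let f : (C3 ℤ) →* ℝ :=
    { toFun := sg t
      map_one' := by simp [sg]
      map_mul' := sg_mul h }
  have fz : ∀ (v : (C3 ℤ)ˣ) (n : ℤ), sg t ((v ^ n : (C3 ℤ)ˣ) : C3 ℤ) = (sg t v) ^ n := by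
    intro v n
    have h3 := map_zpow (Units.map f) v n
    have h4 := congrArg Units.val h3
    rw [Units.val_zpow_eq_zpow_val] at h4
    exact h4
  have hne : ∀ v : (C3 ℤ)ˣ, sg t v ≠ 0 := fun v => (Units.map f v).ne_zero
  have he' : sg t ((eps⁻¹ : (C3 ℤ)ˣ) : C3 ℤ) = -7 - t - 3 * t ^ 2 := by
    show sg t (⟨-7, -1, -3⟩ : C3 ℤ) = _
    simp [sg]; ring
  obtain ⟨y, hy⟩ : ∃ y : ℝ, y = -sg t ((eps⁻¹ : (C3 ℤ)ˣ) : C3 ℤ) := ⟨_, rfl⟩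
  have hy1 : 1 < y := by rw [hy, he']; nlinarith
  have hy2 : y ≤ 13.6 := by rw [hy, he']; nlinarith
  have hpos : 0 < |sg t u| := abs_pos.2 (hne u)
  obtain ⟨n, hn1, hn2⟩ := exists_mem_Ico_zpow hpos hy1
  have hyp : 0 < y ^ n := by positivity
  have hval : |sg t ((u * eps ^ n : (C3 ℤ)ˣ) : C3 ℤ)| * y ^ n = |sg t u| := by
    have e1 : y ^ n = |sg t (((eps⁻¹) ^ n : (C3 ℤ)ˣ) : C3 ℤ)| := by
      rw [fz, abs_zpow, hy, abs_of_neg (by linarith)]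
    rw [e1, ← abs_mul, ← sg_mul h, ← Units.val_mul]
    congr 3
    simp
  have key : ∀ w : (C3 ℤ)ˣ, |sg t w| = |sg t ((u * eps ^ n : (C3 ℤ)ˣ) : C3 ℤ)| → 0 < sg t w →
      w = 1 ∨ w = - eps⁻¹ := by
    intro w hw hw0
    rw [← hw, abs_of_pos hw0] at hval
    rw [zpow_add_one₀ (by linarith)] at hn2
    have k1 : 1 ≤ sg t w := by
      by_contra hcon; push Not at hcon; nlinarith
    have k2 : sg t w ≤ 13.6 := by
      by_contra hcon; push Not at hcon; nlinarith
    rcases unit_bounds h1 h2 h w (nm_unit w) k1 k2 with k | k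
    · left; exact Units.ext k
    · right; exact Units.ext (k.trans (by decide))
  have hneg : ∀ v : C3 ℤ, sg t (-v) = - sg t v := by intro v; simp [sg]; ring
  rcases lt_or_gt_of_ne (hne (u * eps ^ n)) with k | k
  · rcases key (-(u * eps ^ n)) (by rw [Units.val_neg, hneg, abs_neg]) (by rw [Units.val_neg, hneg]; linarith) with r | r
    · refine ⟨-n, Or.inr ?_⟩
      rw [zpow_neg, ← neg_mul, ] at *
      rw [← neg_inj, neg_neg, eq_inv_iff_mul_eq_one]; exact r
    · refine ⟨-n - 1, Or.inl ?_⟩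
      rw [neg_inj] at r
      rw [sub_eq_add_neg, add_comm, zpow_add, zpow_neg_one, ← r]; simp
  · rcases key (u * eps ^ n) rfl k with r | r
    · refine ⟨-n, Or.inl ?_⟩
      rw [zpow_neg, eq_inv_iff_mul_eq_one]; exact r
    · refine ⟨-n - 1, Or.inr ?_⟩
      rw [← neg_inj, neg_neg] at r
      rw [sub_eq_add_neg, add_comm, zpow_add, zpow_neg_one, ← r]; simp

end C3

set_option linter.unusedSectionVars false
namespace KZB

/-- parity bit -/
def bp (k : ℤ) : ℕ := if k % 2 = 0 then 0 else 1

lemma bp_add (a b : ℤ) : bp (a + b) = bp a ^^^ bp b := by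
  unfold bp
  rcases Int.emod_two_eq_zero_or_one a with h | h <;> rcases Int.emod_two_eq_zero_or_one b with h' | h' <;>
    simp [h, h', Int.add_emod]

/-- A discrete place together with a square class code. -/
structure Place (F : Type) [Field F] where
  v : F → ℤ
  cd : F → ℕ
  t : ℤ
  t_pos : 1 ≤ t
  v_mul : ∀ x y, x ≠ 0 → y ≠ 0 → v (x * y) = v x + v y
  v_add : ∀ x y, x ≠ 0 → y ≠ 0 → x + y ≠ 0 → min (v x) (v y) ≤ v (x + y)
  cd_mul : ∀ x y, x ≠ 0 → y ≠ 0 → cd (x * y) = cd x ^^^ cd y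
  cd_v : ∀ x, x ≠ 0 → cd x % 2 = bp (v x)
  cd_lt : ∀ x, cd x < 16
  cont : ∀ x y, x ≠ 0 → y ≠ 0 → x - y ≠ 0 → v y + t ≤ v (x - y) → cd x = cd y

namespace Place
variable {F : Type} [Field F] (P : Place F)

/-- valuation at least `n` -/
def ge (x : F) (n : ℤ) : Prop := x = 0 ∨ n ≤ P.v x

lemma v_one : P.v 1 = 0 := by
  have := P.v_mul 1 1 one_ne_zero one_ne_zero
  simp at this; exact this

lemma v_neg_one : P.v (-1) = 0 := by
  have := P.v_mul (-1) (-1) (by simp) (by simp)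
  rw [neg_mul_neg, one_mul, P.v_one] at this; omega

lemma v_neg (x : F) : P.v (-x) = P.v x := by
  by_cases hx : x = 0
  · simp [hx]
  · have := P.v_mul (-1) x (by simp) hx
    rw [P.v_neg_one] at this; simpa using this

lemma v_inv (x : F) (hx : x ≠ 0) : P.v x⁻¹ = - P.v x := by
  have := P.v_mul x x⁻¹ hx (inv_ne_zero hx)
  rw [mul_inv_cancel₀ hx, P.v_one] at this; omega

lemma v_div (x y : F) (hx : x ≠ 0) (hy : y ≠ 0) : P.v (x / y) = P.v x - P.v y := by
  rw [div_eq_mul_inv, P.v_mul _ _ hx (inv_ne_zero hy), P.v_inv _ hy]; ring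

lemma v_pow (x : F) (hx : x ≠ 0) (n : ℕ) : P.v (x ^ n) = n * P.v x := by
  induction n with
  | zero => simp [P.v_one]
  | succ k ih => rw [pow_succ, P.v_mul _ _ (pow_ne_zero _ hx) hx, ih]; push_cast; ring

lemma v_sub_comm (x y : F) : P.v (x - y) = P.v (y - x) := by
  rw [← P.v_neg, neg_sub]

variable {P}

lemma ge_mono {x : F} {m n : ℤ} (h : P.ge x n) (hm : m ≤ n) : P.ge x m := by
  rcases h with h | h
  · exact Or.inl h
  · exact Or.inr (hm.trans h)

lemma ge_zero (n : ℤ) : P.ge 0 n := Or.inl rfl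

lemma ge_self (x : F) : P.ge x (P.v x) := Or.inr le_rfl

lemma ge_neg {x : F} {n : ℤ} (h : P.ge x n) : P.ge (-x) n := by
  rcases h with h | h
  · left; simp [h]
  · right; rwa [P.v_neg]

lemma ge_add {x y : F} {n : ℤ} (hx : P.ge x n) (hy : P.ge y n) : P.ge (x + y) n := by
  by_cases h : x + y = 0
  · exact Or.inl h
  rcases hx with rfl | hx
  · simpa using hy
  by_cases hx0 : x = 0
  · subst hx0; simpa using hy
  rcases hy with rfl | hy
  · right; simpa using hx
  by_cases hy0 : y = 0
  · subst hy0; right; simpa using hx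
  right
  exact (le_min hx hy).trans (P.v_add x y hx0 hy0 h)

lemma ge_sub {x y : F} {n : ℤ} (hx : P.ge x n) (hy : P.ge y n) : P.ge (x - y) n := by
  rw [sub_eq_add_neg]; exact ge_add hx (ge_neg hy)

lemma ge_mul {x y : F} {m n : ℤ} (hx : P.ge x m) (hy : P.ge y n) : P.ge (x * y) (m + n) := by
  by_cases hx0 : x = 0
  · left; simp [hx0]
  by_cases hy0 : y = 0
  · left; simp [hy0]
  right
  rw [P.v_mul x y hx0 hy0]
  rcases hx with h | h
  · exact absurd h hx0
  rcases hy with h' | h'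
  · exact absurd h' hy0
  omega

lemma v_of_ge {x : F} {n : ℤ} (h : P.ge x n) (hx : x ≠ 0) : n ≤ P.v x := h.resolve_left hx

/-- dominant term -/
lemma v_add_eq {x y : F} (hx : x ≠ 0) (hy : P.ge y (P.v x + 1)) : x + y ≠ 0 ∧ P.v (x + y) = P.v x := by
  have h0 : x + y ≠ 0 := by
    intro h
    have hyx : y = -x := by linear_combination h
    rw [hyx] at hy
    have := v_of_ge hy (neg_ne_zero.2 hx)
    rw [P.v_neg] at this; omega
  refine ⟨h0, le_antisymm ?_ ?_⟩
  · by_contra hcon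
    push Not at hcon
    have h1 : P.ge (x + y) (P.v x + 1) := Or.inr (by omega)
    have h2 := ge_sub h1 hy
    rw [add_sub_cancel_right] at h2
    have := v_of_ge h2 hx
    omega
  · exact v_of_ge (ge_add (ge_self x) (ge_mono hy (by omega))) h0

lemma v_eq_of_close {x y : F} (hy : y ≠ 0) (h : P.ge (x - y) (P.v y + 1)) : x ≠ 0 ∧ P.v x = P.v y := by
  have := v_add_eq hy h
  rwa [add_sub_cancel] at this

lemma cd_close {x y : F} (hy : y ≠ 0) (h : P.ge (x - y) (P.v y + P.t)) :
    x ≠ 0 ∧ P.cd x = P.cd y := by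
  have h1 := v_eq_of_close hy (ge_mono h (by have := P.t_pos; omega))
  refine ⟨h1.1, ?_⟩
  by_cases hxy : x - y = 0
  · rw [sub_eq_zero.1 hxy]
  · exact P.cont x y h1.1 hy hxy (v_of_ge h hxy)

lemma cd_one : P.cd 1 = 0 := by
  have := P.cd_mul 1 1 one_ne_zero one_ne_zero
  simpa using this

lemma cd_sq {x : F} (hx : x ≠ 0) : P.cd (x ^ 2) = 0 := by
  rw [pow_two, P.cd_mul _ _ hx hx, Nat.xor_self]

lemma cd_mul_sq {x y : F} (hx : x ≠ 0) (hy : y ≠ 0) : P.cd (x * y ^ 2) = P.cd x := by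
  rw [P.cd_mul _ _ hx (pow_ne_zero _ hy), cd_sq hy, Nat.xor_zero]

lemma even_of_cd {x : F} (hx : x ≠ 0) (h : P.cd x % 2 = 0) : P.v x % 2 = 0 := by
  have := P.cd_v x hx
  rw [h] at this; unfold bp at this; split at this <;> omega

lemma cd_of_even {x : F} (hx : x ≠ 0) (h : P.v x % 2 = 0) : P.cd x % 2 = 0 := by
  rw [P.cd_v x hx]; simp [bp, h]

end Place

/-! ### Construction of places -/
section mk
variable {R F : Type} [CommRing R] [IsDomain R] [Field F] [Algebra R F] [IsFractionRing R F]

/-- `x = π ^ k * a / b` -/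
def PRep (π : R) (x : F) (k : ℤ) (a b : R) : Prop :=
  ¬ π ∣ a ∧ ¬ π ∣ b ∧ x * algebraMap R F b = (algebraMap R F π) ^ k * algebraMap R F a

variable {π : R}

lemma am_ne {a : R} (h : a ≠ 0) : algebraMap R F a ≠ 0 := by
  simpa using h

lemma ne_of_nd {a : R} (h : ¬ π ∣ a) : a ≠ 0 := by rintro rfl; exact h (dvd_zero _)

lemma exists_rep [IsPrincipalIdealRing R] (hπ : Prime π) (x : F) (hx : x ≠ 0) :
    ∃ (k : ℤ) (a b : R), PRep π x k a b := by
  obtain ⟨p, q, hq, rfl⟩ := IsFractionRing.div_surjective (A := R) x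
  have hq0 : q ≠ 0 := nonZeroDivisors.ne_zero hq
  have hp0 : p ≠ 0 := by rintro rfl; simp at hx
  obtain ⟨m, a, ha, rfl⟩ := WfDvdMonoid.max_power_factor hp0 hπ.irreducible
  obtain ⟨n, b, hb, rfl⟩ := WfDvdMonoid.max_power_factor hq0 hπ.irreducible
  refine ⟨(m : ℤ) - n, a, b, ha, hb, ?_⟩
  have h1 : algebraMap R F π ≠ 0 := am_ne hπ.ne_zero
  have h2 : algebraMap R F b ≠ 0 := am_ne (ne_of_nd hb)
  rw [zpow_sub₀ h1]
  simp only [map_mul, map_pow, zpow_natCast]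
  field_simp

lemma rep_unique_le (hπ : Prime π) {x : F} {k k' : ℤ} {a b a' b' : R} (h : PRep π x k a b) (h' : PRep π x k' a' b') :
    k' ≤ k := by
  by_contra hlt
  push Not at hlt
  obtain ⟨n, hn⟩ : ∃ n : ℕ, k' = k + (n + 1) := ⟨(k' - k - 1).toNat, by omega⟩
  have h1 : algebraMap R F π ≠ 0 := am_ne hπ.ne_zero
  have e : algebraMap R F (a * b') = algebraMap R F (π ^ (n + 1) * (a' * b)) := by
    have hk : (algebraMap R F π) ^ k ≠ 0 := zpow_ne_zero _ h1
    apply mul_left_cancel₀ hk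
    have e1 := h.2.2
    have e2 := h'.2.2
    rw [hn, zpow_add₀ h1] at e2
    have e3 : (algebraMap R F π) ^ ((n : ℤ) + 1) = (algebraMap R F π) ^ (n + 1) := by
      exact_mod_cast zpow_natCast (algebraMap R F π) (n + 1)
    rw [e3] at e2
    simp only [map_mul, map_pow]
    linear_combination (algebraMap R F b') * (-e1) + algebraMap R F b * e2
  have e' := IsFractionRing.injective R F e
  have : π ∣ a * b' := by rw [e', pow_succ]; exact ⟨π ^ n * (a' * b), by ring⟩
  rcases hπ.dvd_or_dvd this with h3 | h3
  · exact h.1 h3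
  · exact h'.2.1 h3

lemma rep_k (hπ : Prime π) {x : F} {k k' : ℤ} {a b a' b' : R} (h : PRep π x k a b) (h' : PRep π x k' a' b') :
    k = k' := le_antisymm (rep_unique_le hπ h' h) (rep_unique_le hπ h h')

/-- unit characters -/
structure UC (π : R) (t : ℕ) where
  uc : R → ℕ
  t_pos : 1 ≤ t
  prime : Prime π
  mul : ∀ a b, ¬ π ∣ a → ¬ π ∣ b → uc (a * b) = uc a ^^^ uc b
  cong : ∀ a b, ¬ π ∣ a → π ^ t ∣ b - a → uc b = uc a
  even : ∀ a, uc a % 2 = 0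
  lt : ∀ a, uc a < 16

lemma rep_cross (hπ : Prime π) {x : F} {k : ℤ} {a b a' b' : R} (h : PRep π x k a b) (h' : PRep π x k a' b') :
    a * b' = a' * b := by
  apply IsFractionRing.injective R F
  have h1 : algebraMap R F π ≠ 0 := am_ne hπ.ne_zero
  have hk : (algebraMap R F π) ^ k ≠ 0 := zpow_ne_zero _ h1
  apply mul_left_cancel₀ hk
  simp only [map_mul]
  linear_combination (algebraMap R F b') * (-h.2.2) + algebraMap R F b * h'.2.2

lemma xor_cancel {a b c d : ℕ} (h : a ^^^ d = c ^^^ b) : a ^^^ b = c ^^^ d := by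
  have : a = c ^^^ b ^^^ d := by rw [← h, Nat.xor_assoc, Nat.xor_self, Nat.xor_zero]
  rw [this, Nat.xor_assoc, Nat.xor_assoc, Nat.xor_comm d b, ← Nat.xor_assoc b, Nat.xor_self, Nat.zero_xor]

lemma rep_uc {t : ℕ} (U : UC π t) {x : F} {k : ℤ} {a b a' b' : R} (h : PRep π x k a b) (h' : PRep π x k a' b') :
    U.uc a ^^^ U.uc b = U.uc a' ^^^ U.uc b' := by
  have e := congrArg U.uc (rep_cross U.prime h h')
  rw [U.mul _ _ h.1 h'.2.1, U.mul _ _ h'.1 h.2.1] at e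
  exact xor_cancel e

open Classical in
/-- valuation -/
noncomputable def vv (π : R) (x : F) : ℤ := if h : ∃ (k : ℤ) (a b : R), PRep π x k a b then h.choose else 0

open Classical in
/-- code -/
noncomputable def cc {t : ℕ} (U : UC π t) (x : F) : ℕ :=
  if h : ∃ (k : ℤ) (a b : R), PRep π x k a b then
    bp h.choose ^^^ (U.uc h.choose_spec.choose ^^^ U.uc h.choose_spec.choose_spec.choose) else 0

lemma vv_rep (hπ : Prime π) {x : F} {k : ℤ} {a b : R} (h : PRep π x k a b) : vv π x = k := by
  have he : ∃ (k : ℤ) (a b : R), PRep π x k a b := ⟨k, a, b, h⟩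
  unfold vv
  rw [dif_pos he]
  exact rep_k hπ he.choose_spec.choose_spec.choose_spec h

lemma cc_rep {t : ℕ} (U : UC π t) {x : F} {k : ℤ} {a b : R} (h : PRep π x k a b) :
    cc U x = bp k ^^^ (U.uc a ^^^ U.uc b) := by
  have he : ∃ (k : ℤ) (a b : R), PRep π x k a b := ⟨k, a, b, h⟩
  unfold cc
  rw [dif_pos he]
  have hh := he.choose_spec.choose_spec.choose_spec
  have hk := rep_k U.prime hh h
  rw [rep_uc U (hk ▸ hh) h, hk]

lemma rep_mul (hπ : Prime π) {x y : F} {k l : ℤ} {a b c d : R} (h : PRep π x k a b) (h' : PRep π y l c d) :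
    PRep π (x * y) (k + l) (a * c) (b * d) := by
  have h1 : algebraMap R F π ≠ 0 := am_ne hπ.ne_zero
  refine ⟨fun hd => (hπ.dvd_or_dvd hd).elim h.1 h'.1, fun hd => (hπ.dvd_or_dvd hd).elim h.2.1 h'.2.1, ?_⟩
  rw [zpow_add₀ h1, map_mul, map_mul]
  linear_combination (y * algebraMap R F d) * h.2.2 + (algebraMap R F π) ^ k * algebraMap R F a * h'.2.2

/-- addition with a common power -/
lemma vv_add_le [IsPrincipalIdealRing R] (hπ : Prime π) {x y : F} {k l : ℤ} {a b c d : R} (h : PRep π x k a b)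
    (h' : PRep π y l c d) (hkl : k ≤ l) (hxy : x + y ≠ 0) : k ≤ vv π (x + y) := by
  have h1 : algebraMap R F π ≠ 0 := am_ne hπ.ne_zero
  obtain ⟨n, rfl⟩ : ∃ n : ℕ, l = k + n := ⟨(l - k).toNat, by omega⟩
  have e : (x + y) * algebraMap R F (b * d) = (algebraMap R F π) ^ k * algebraMap R F (a * d + π ^ n * (b * c)) := by
    have e2 := h'.2.2
    rw [zpow_add₀ h1, zpow_natCast] at e2
    simp only [map_mul, map_add, map_pow]
    linear_combination (algebraMap R F d) * h.2.2 + algebraMap R F b * e2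
  have hbd : algebraMap R F (b * d) ≠ 0 := am_ne (mul_ne_zero (ne_of_nd h.2.1) (ne_of_nd h'.2.1))
  have hz : a * d + π ^ n * (b * c) ≠ 0 := by
    intro hz
    rw [hz, map_zero, mul_zero] at e
    exact (mul_ne_zero hxy hbd) e
  obtain ⟨m, z, hz1, hz2⟩ := WfDvdMonoid.max_power_factor hz hπ.irreducible
  have : PRep π (x + y) (k + m) z (b * d) := by
    refine ⟨hz1, fun hd => (hπ.dvd_or_dvd hd).elim h.2.1 h'.2.1, ?_⟩
    rw [e, hz2, zpow_add₀ h1, zpow_natCast, map_mul, map_pow]; ring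
  rw [vv_rep hπ this]; omega

lemma rep_of_close {t : ℕ} (U : UC π t) {y z : F} {k l : ℤ} {a b c d : R} (h : PRep π y k a b)
    (h' : PRep π z l c d) (hkl : k + t ≤ l) :
    ∃ a', PRep π (y + z) k a' (b * d) ∧ π ^ t ∣ a' - a * d := by
  have hπ := U.prime
  have h1 : algebraMap R F π ≠ 0 := am_ne hπ.ne_zero
  obtain ⟨n, rfl⟩ : ∃ n : ℕ, l = k + (t + n : ℕ) := ⟨(l - k - t).toNat, by push_cast; omega⟩
  refine ⟨a * d + π ^ (t + n) * (b * c), ⟨?_, fun hd => (hπ.dvd_or_dvd hd).elim h.2.1 h'.2.1, ?_⟩, ?_⟩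
  · intro hd
    have : π ∣ π ^ (t + n) * (b * c) := Dvd.dvd.mul_right (dvd_pow_self _ (by have := U.t_pos; omega)) _
    have h3 := (dvd_add_left this).1 hd
    exact (hπ.dvd_or_dvd h3).elim h.1 h'.2.1
  · have e2 := h'.2.2
    rw [zpow_add₀ h1, zpow_natCast] at e2
    simp only [map_mul, map_add, map_pow] at *
    linear_combination (algebraMap R F d) * h.2.2 + algebraMap R F b * e2
  · exact ⟨π ^ n * (b * c), by ring⟩

lemma xor4 (a b c d : ℕ) : a ^^^ b ^^^ (c ^^^ d) = (a ^^^ c) ^^^ (b ^^^ d) := by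
  rw [Nat.xor_assoc, Nat.xor_assoc, ← Nat.xor_assoc b, Nat.xor_comm b c, Nat.xor_assoc]

/-- the place of a prime element -/
noncomputable def mkPlace [IsPrincipalIdealRing R] (F : Type) [Field F] [Algebra R F] [IsFractionRing R F]
    {t : ℕ} (U : UC π t) : Place F where
  v := vv π
  cd := cc U
  t := t
  t_pos := by exact_mod_cast U.t_pos
  v_mul x y hx hy := by
    obtain ⟨k, a, b, h⟩ := exists_rep U.prime x hx
    obtain ⟨l, c, d, h'⟩ := exists_rep U.prime y hy
    rw [vv_rep U.prime h, vv_rep U.prime h', vv_rep U.prime (rep_mul U.prime h h')]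
  v_add x y hx hy hxy := by
    obtain ⟨k, a, b, h⟩ := exists_rep U.prime x hx
    obtain ⟨l, c, d, h'⟩ := exists_rep U.prime y hy
    rw [vv_rep U.prime h, vv_rep U.prime h']
    rcases le_total k l with hkl | hkl
    · rw [min_eq_left hkl]; exact vv_add_le U.prime h h' hkl hxy
    · rw [min_eq_right hkl, add_comm]; exact vv_add_le U.prime h' h hkl (by rwa [add_comm])
  cd_mul x y hx hy := by
    obtain ⟨k, a, b, h⟩ := exists_rep U.prime x hx
    obtain ⟨l, c, d, h'⟩ := exists_rep U.prime y hy
    rw [cc_rep U h, cc_rep U h', cc_rep U (rep_mul U.prime h h'), U.mul _ _ h.1 h'.1, U.mul _ _ h.2.1 h'.2.1,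
      bp_add, xor4 (U.uc a), xor4 (bp k)]
  cd_v x hx := by
    obtain ⟨k, a, b, h⟩ := exists_rep U.prime x hx
    rw [cc_rep U h, vv_rep U.prime h]
    have h1 := U.even a
    have h2 := U.even b
    have h3 : bp k = 0 ∨ bp k = 1 := by unfold bp; split <;> simp
    have := Nat.xor_mod_two_pow (a := bp k) (b := U.uc a ^^^ U.uc b) (n := 1)
    have h5 := Nat.xor_mod_two_pow (a := U.uc a) (b := U.uc b) (n := 1)
    simp only [pow_one, h1, h2, Nat.xor_self] at this h5
    rw [this, h5]
    rcases h3 with h3 | h3 <;> rw [h3] <;> rfl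
  cd_lt x := by
    unfold cc
    split
    · have h3 : ∀ k, bp k < 2 ^ 4 := by intro k; unfold bp; split <;> simp
      exact Nat.xor_lt_two_pow (n := 4) (h3 _) (Nat.xor_lt_two_pow (n := 4) (U.lt _) (U.lt _))
    · simp
  cont x y hx hy hxy h := by
    obtain ⟨k, a, b, hk⟩ := exists_rep U.prime y hy
    obtain ⟨l, c, d, hl⟩ := exists_rep U.prime (x - y) hxy
    rw [vv_rep U.prime hk, vv_rep U.prime hl] at h
    obtain ⟨a', h1, h2⟩ := rep_of_close U hk hl h
    rw [add_sub_cancel] at h1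
    rw [cc_rep U h1, cc_rep U hk]
    have hnd : ¬ π ∣ a * d := fun hd => (U.prime.dvd_or_dvd hd).elim hk.1 hl.2.1
    rw [U.cong _ _ hnd h2, U.mul _ _ hk.1 hl.2.1, U.mul _ _ hk.2.1 hl.2.1, xor4 (U.uc a), Nat.xor_self, Nat.xor_zero]

/-- exact division -/
structure DV (π : R) where
  dv : R → Option R
  some_spec : ∀ a b, dv a = some b → a = π * b
  none_spec : ∀ a, dv a = none → ¬ π ∣ a

/-- remove all factors -/
def strip (dv : R → Option R) : ℕ → R → Option (ℕ × R)
  | 0, _ => none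
  | n + 1, a => match dv a with
    | none => some (0, a)
    | some b => match strip dv n b with
      | none => none
      | some (k, u) => some (k + 1, u)

lemma strip_spec (D : DV π) : ∀ (n : ℕ) (a : R) (k : ℕ) (u : R), strip D.dv n a = some (k, u) →
    ¬ π ∣ u ∧ a = π ^ k * u := by
  intro n
  induction n with
  | zero => intro a k u h; simp [strip] at h
  | succ n ih =>
    intro a k u h
    rw [strip] at h
    split at h
    · rename_i h0
      simp only [Option.some.injEq, Prod.mk.injEq] at h
      obtain ⟨rfl, rfl⟩ := h
      exact ⟨D.none_spec _ h0, by simp⟩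
    · rename_i b h0
      split at h
      · simp at h
      · rename_i k' u' h1
        simp only [Option.some.injEq, Prod.mk.injEq] at h
        obtain ⟨rfl, rfl⟩ := h
        obtain ⟨h2, h3⟩ := ih _ _ _ h1
        exact ⟨h2, by rw [D.some_spec _ _ h0, h3]; ring⟩

/-- valuation and code of ring elements (computable) -/
def vcR (dv : R → Option R) (uc : R → ℕ) (a : R) : Option (ℕ × ℕ) :=
  match strip dv 64 a with
  | none => none
  | some (k, u) => some (k, (k % 2) ^^^ uc u)

lemma vcR_spec [IsPrincipalIdealRing R] {t : ℕ} (U : UC π t) (D : DV π) (hone : U.uc 1 = 0) {a : R} {k c : ℕ}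
    (h : vcR D.dv U.uc a = some (k, c)) :
    algebraMap R F a ≠ 0 ∧ (mkPlace F U).v (algebraMap R F a) = k ∧ (mkPlace F U).cd (algebraMap R F a) = c := by
  unfold vcR at h
  split at h
  · simp at h
  · rename_i k' u h1
    simp only [Option.some.injEq, Prod.mk.injEq] at h
    obtain ⟨rfl, rfl⟩ := h
    obtain ⟨h2, h3⟩ := strip_spec D _ _ _ _ h1
    have hp1 : ¬ π ∣ (1 : R) := fun hd => U.prime.not_isUnit (isUnit_of_dvd_one hd)
    have hr : PRep π (algebraMap R F a) (k' : ℤ) u 1 := ⟨h2, hp1, by rw [h3]; simp⟩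
    refine ⟨am_ne ?_, vv_rep U.prime hr, ?_⟩
    · rw [h3]; exact mul_ne_zero (pow_ne_zero _ U.prime.ne_zero) (ne_of_nd h2)
    · show cc U _ = _
      rw [cc_rep U hr, hone, Nat.xor_zero]
      congr 1
      unfold bp
      split <;> omega

lemma UC.one {t : ℕ} (U : UC π t) : U.uc 1 = 0 := by
  have hp1 : ¬ π ∣ (1 : R) := fun hd => U.prime.not_isUnit (isUnit_of_dvd_one hd)
  have := U.mul 1 1 hp1 hp1
  simpa using this

/-- the trivial character -/
def UC.triv (hπ : Prime π) : UC π 1 where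
  uc _ := 0
  t_pos := le_rfl
  prime := hπ
  mul := by simp
  cong := by simp
  even := by simp
  lt := by simp

lemma v_algebraMap_nonneg [IsPrincipalIdealRing R] {t : ℕ} (U : UC π t) {a : R} (ha : a ≠ 0) :
    0 ≤ (mkPlace F U).v (algebraMap R F a) := by
  obtain ⟨m, z, hz1, hz2⟩ := WfDvdMonoid.max_power_factor ha U.prime.irreducible
  have hp1 : ¬ π ∣ (1 : R) := fun hd => U.prime.not_isUnit (isUnit_of_dvd_one hd)
  have hr : PRep π (algebraMap R F a) (m : ℤ) z 1 := ⟨hz1, hp1, by rw [hz2]; simp⟩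
  have : (mkPlace F U).v (algebraMap R F a) = m := vv_rep U.prime hr
  omega

lemma v_algebraMap_pos [IsPrincipalIdealRing R] {t : ℕ} (U : UC π t) {a : R} (ha : a ≠ 0) :
    1 ≤ (mkPlace F U).v (algebraMap R F a) ↔ π ∣ a := by
  obtain ⟨m, z, hz1, hz2⟩ := WfDvdMonoid.max_power_factor ha U.prime.irreducible
  have hp1 : ¬ π ∣ (1 : R) := fun hd => U.prime.not_isUnit (isUnit_of_dvd_one hd)
  have hr : PRep π (algebraMap R F a) (m : ℤ) z 1 := ⟨hz1, hp1, by rw [hz2]; simp⟩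
  have : (mkPlace F U).v (algebraMap R F a) = m := vv_rep U.prime hr
  rw [this]
  constructor
  · intro h; rw [hz2]; exact Dvd.dvd.mul_right (dvd_pow_self _ (by omega)) _
  · intro h
    by_contra hm
    have : m = 0 := by omega
    subst this
    apply hz1; rw [hz2] at h; simpa using h

end mk
end KZB

set_option linter.unusedSectionVars false
set_option linter.unusedVariables false
set_option linter.unusedSimpArgs false
namespace KZB

/-- Legendre symbol code -/
def chi (p : ℕ) (z : ℤ) : ℕ := if ((z % p).toNat ^ (p / 2)) % p = 1 then 0 else 2

lemma chi_eq (p : ℕ) [hp : Fact p.Prime] (z : ℤ) :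
    chi p z = if (z : ZMod p) ^ (p / 2) = 1 then 0 else 2 := by
  unfold chi
  have hpp := hp.out
  have h1 : ((((z % p).toNat : ℕ) : ZMod p)) = (z : ZMod p) := by
    have : (((z % p).toNat : ℕ) : ℤ) = z % p := Int.toNat_of_nonneg (Int.emod_nonneg _ (by exact_mod_cast hpp.ne_zero))
    have h2 := congrArg (Int.cast : ℤ → ZMod p) this
    rw [Int.cast_natCast] at h2
    rw [h2]; simp
  have h3 : (((z % p).toNat ^ (p / 2)) % p = 1) ↔ (z : ZMod p) ^ (p / 2) = 1 := by
    rw [← h1, ← Nat.cast_pow]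
    have : (1 : ZMod p) = ((1 : ℕ) : ZMod p) := by simp
    rw [this, ZMod.natCast_eq_natCast_iff', Nat.mod_eq_of_lt hpp.one_lt]
  simp [h3]

lemma chi_mul (p : ℕ) [hp : Fact p.Prime] (hp2 : p ≠ 2) {z w : ℤ} (hz : ¬ (p : ℤ) ∣ z) (hw : ¬ (p : ℤ) ∣ w) :
    chi p (z * w) = chi p z ^^^ chi p w := by
  rw [chi_eq, chi_eq, chi_eq]
  push_cast
  rw [mul_pow]
  have hz' : (z : ZMod p) ≠ 0 := by rwa [Ne, ZMod.intCast_zmod_eq_zero_iff_dvd]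
  have hw' : (w : ZMod p) ≠ 0 := by rwa [Ne, ZMod.intCast_zmod_eq_zero_iff_dvd]
  have : Fact (2 < p) := ⟨lt_of_le_of_ne hp.out.two_le (Ne.symm hp2)⟩
  have hne : (-1 : ZMod p) ≠ 1 := ZMod.neg_one_ne_one
  rcases ZMod.pow_div_two_eq_neg_one_or_one p hz' with h | h <;>
  rcases ZMod.pow_div_two_eq_neg_one_or_one p hw' with h' | h' <;> simp [h, h', hne]

lemma chi_cong (p : ℕ) [hp : Fact p.Prime] {z w : ℤ} (h : (p : ℤ) ∣ z - w) : chi p z = chi p w := by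
  have : z % p = w % p := (Int.emod_emod_of_dvd _ dvd_rfl).symm.trans
    ((Int.emod_emod_of_dvd _ dvd_rfl).trans (Int.ModEq.symm ((Int.modEq_iff_dvd).2 h)))
  unfold chi
  rw [this]

/-- construction of an odd place -/
def oddUC {R : Type} [CommRing R] [IsDomain R] {π : R} (p : ℕ) (hp : p.Prime) (hp2 : p ≠ 2) (hπ : π ≠ 0)
    (m : R → ℤ) (m0 : m 0 = 0) (m1 : m 1 = 1)
    (hm : ∀ a b, (p : ℤ) ∣ m (a * b) - m a * m b) (hc : ∀ a b, π ∣ b - a → (p : ℤ) ∣ m b - m a)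
    (h0 : ∀ u, (p : ℤ) ∣ m u → π ∣ u) : UC π 1 :=
  have hd : ∀ u, π ∣ u → (p : ℤ) ∣ m u := fun u hu => by
    have := hc 0 u (by simpa using hu)
    simpa [m0] using this
  { uc := fun u => chi p (m u)
    t_pos := le_rfl
    prime := by
      refine ⟨hπ, fun hu => ?_, fun a b hab => ?_⟩
      · have := hd 1 (hu.dvd)
        rw [m1] at this
        have h2 := Int.le_of_dvd one_pos this
        have := hp.two_le
        omega
      · have h1 := hd _ hab
        have h2 : (p : ℤ) ∣ m a * m b := by
          have := dvd_sub h1 (hm a b)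
          simpa using this
        exact (Int.Prime.dvd_mul' hp h2).imp (h0 a) (h0 b)
    mul := fun a b ha hb => by
      have : Fact p.Prime := ⟨hp⟩
      rw [chi_cong p (hm a b), chi_mul p hp2 (fun h => ha (h0 _ h)) (fun h => hb (h0 _ h))]
    cong := fun a b _ hab => by
      have : Fact p.Prime := ⟨hp⟩
      exact chi_cong p (hc a b (by simpa using hab))
    even := fun a => by unfold chi; split <;> rfl
    lt := fun a => by unfold chi; split <;> simp }

/-- integers: division -/
def dvZ (p : ℤ) (x : ℤ) : Option ℤ := if x % p = 0 then some (x / p) else none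

/-- integers: division -/
def DVZ (p : ℤ) : DV p where
  dv := dvZ p
  some_spec a b h := by
    unfold dvZ at h
    split at h
    · rename_i h0
      simp at h; rw [← h, Int.mul_ediv_cancel' (Int.dvd_of_emod_eq_zero h0)]
    · simp at h
  none_spec a h := by
    unfold dvZ at h
    split at h
    · simp at h
    · rename_i h0
      exact fun hd => h0 (Int.emod_eq_zero_of_dvd hd)

/-- cubic ring: division -/
def dvK (π : C3 ℤ) (x : C3 ℤ) : Option (C3 ℤ) :=
  let y := x * C3.adj π
  let n := C3.nm π
  if y.a % n = 0 ∧ y.b % n = 0 ∧ y.c % n = 0 then some ⟨y.a / n, y.b / n, y.c / n⟩ else none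

/-- cubic ring: division -/
def DVK (π : C3 ℤ) (hπ : π ≠ 0) : DV π where
  dv := dvK π
  some_spec a b h := by
    simp only [dvK] at h
    split at h
    · rename_i h0
      obtain ⟨h1, h2, h3⟩ := h0
      simp only [Option.some.injEq] at h
      have hadj : C3.adj π ≠ 0 := by
        intro h4
        have := C3.mul_adj π
        rw [h4, mul_zero] at this
        exact hπ (C3.nm_eq_zero (congrArg C3.a this).symm)
      apply mul_right_cancel₀ hadj
      rw [mul_right_comm, C3.mul_adj, ← h]
      ext
      · simp only [C3.ofA, C3.mul_a]
        have := Int.mul_ediv_cancel' (Int.dvd_of_emod_eq_zero h1)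
        simp only [C3.mul_a] at this
        linear_combination (-1 : ℤ) * this
      · simp only [C3.ofA, C3.mul_b]
        have := Int.mul_ediv_cancel' (Int.dvd_of_emod_eq_zero h2)
        simp only [C3.mul_b] at this
        linear_combination (-1 : ℤ) * this
      · simp only [C3.ofA, C3.mul_c]
        have := Int.mul_ediv_cancel' (Int.dvd_of_emod_eq_zero h3)
        simp only [C3.mul_c] at this
        linear_combination (-1 : ℤ) * this
    · simp at h
  none_spec a h := by
    simp only [dvK] at h
    split at h
    · simp at h
    · rename_i h0
      rintro ⟨b, rfl⟩
      apply h0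
      rw [mul_right_comm, C3.mul_adj]
      refine ⟨?_, ?_, ?_⟩ <;> simp [C3.ofA]

lemma dvd_of_dvK {π x : C3 ℤ} (hπ : π ≠ 0) (h : (dvK π x).isSome = true) : π ∣ x := by
  obtain ⟨b, hb⟩ := Option.isSome_iff_exists.1 h
  exact ⟨b, (DVK π hπ).some_spec x b hb⟩

/-- odd place of ℤ -/
def ucZ (p : ℕ) (hp : p.Prime) (hp2 : p ≠ 2) : UC (p : ℤ) 1 :=
  oddUC p hp hp2 (by exact_mod_cast hp.ne_zero) id rfl rfl (by simp) (by simp) (by simp)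

/-- residue map for degree one primes -/
def m1 (r : ℤ) (x : C3 ℤ) : ℤ := x.a + x.b * r + x.c * r ^ 2

/-- check -/
def ok1 (p : ℕ) (r : ℤ) (π : C3 ℤ) : Bool :=
  (r ^ 3 + 2 * r ^ 2 + 3 * r + 4) % p == 0 && (m1 r π) % p == 0 && (dvK π ⟨p, 0, 0⟩).isSome
    && (dvK π ⟨-r, 1, 0⟩).isSome && !(π == 0)

lemma m1_mul {p : ℕ} {r : ℤ} (h : (r ^ 3 + 2 * r ^ 2 + 3 * r + 4) % p = 0) (a b : C3 ℤ) :
    (p : ℤ) ∣ m1 r (a * b) - m1 r a * m1 r b := by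
  obtain ⟨k, hk⟩ := Int.dvd_of_emod_eq_zero h
  refine ⟨k * (-(a.c * b.c * r) - (a.b * b.c + a.c * b.b) + 2 * a.c * b.c), ?_⟩
  simp only [m1, C3.mul_a, C3.mul_b, C3.mul_c]
  linear_combination (-(a.c * b.c * r) - (a.b * b.c + a.c * b.b) + 2 * a.c * b.c) * hk

/-- degree one prime -/
def ucK1 (p : ℕ) (r : ℤ) (π : C3 ℤ) (hp : p.Prime) (hp2 : p ≠ 2) (h : ok1 p r π = true) : UC π 1 :=
  have h' : ((r ^ 3 + 2 * r ^ 2 + 3 * r + 4) % p = 0 ∧ (m1 r π) % p = 0 ∧ (dvK π ⟨p, 0, 0⟩).isSome = true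
    ∧ (dvK π ⟨-r, 1, 0⟩).isSome = true ∧ π ≠ 0) := by
      simpa [ok1, and_assoc] using h
  oddUC p hp hp2 h'.2.2.2.2 (m1 r) (by simp [m1]) (by simp [m1]) (m1_mul h'.1)
    (by
      rintro a b ⟨q, hq⟩
      have e : m1 r b - m1 r a = m1 r (b - a) := by simp [m1]; ring
      rw [e, hq]
      have h1 := m1_mul h'.1 π q
      have h2 : (p : ℤ) ∣ m1 r π * m1 r q := Dvd.dvd.mul_right (Int.dvd_of_emod_eq_zero h'.2.1) _
      have := dvd_add h1 h2
      simpa using this)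
    (by
      rintro u ⟨k, hk⟩
      have e : u = (⟨p, 0, 0⟩ : C3 ℤ) * ⟨k, 0, 0⟩ + ⟨-r, 1, 0⟩ * ⟨u.b + u.c * r, u.c, 0⟩ := by
        ext
        · simp; simp only [m1] at hk; linear_combination hk
        · simp; ring
        · simp
      rw [e]
      exact dvd_add (Dvd.dvd.mul_right (dvd_of_dvK h'.2.2.2.2 h'.2.2.1) _)
        (Dvd.dvd.mul_right (dvd_of_dvK h'.2.2.2.2 h'.2.2.2.1) _))

/-- residue map for degree two primes -/
def m2a (h : ℤ) (x : C3 ℤ) : ℤ := x.a - x.c * h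
/-- residue map for degree two primes -/
def m2b (e : ℤ) (x : C3 ℤ) : ℤ := x.b - x.c * e
/-- residue norm for degree two primes -/
def m2 (e h : ℤ) (x : C3 ℤ) : ℤ := (m2a h x) ^ 2 - m2a h x * m2b e x * e + (m2b e x) ^ 2 * h

/-- check -/
def ok2 (p : ℕ) (e h : ℤ) (π : C3 ℤ) : Bool :=
  (h + e * (2 - e) - 3) % p == 0 && (h * (2 - e) - 4) % p == 0 && m2a h π % p == 0 && m2b e π % p == 0
   && (dvK π ⟨p, 0, 0⟩).isSome && (dvK π ⟨h, e, 1⟩).isSome && !(π == 0) && chi p (e ^ 2 - 4 * h) == 2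
   && !((e ^ 2 - 4 * h) % p == 0)

lemma m2a_mul {p : ℕ} {e h : ℤ} (h1 : (h + e * (2 - e) - 3) % p = 0) (h2 : (h * (2 - e) - 4) % p = 0)
    (x y : C3 ℤ) : ∃ k, m2a h (x * y) = m2a h x * m2a h y - m2b e x * m2b e y * h + p * k := by
  obtain ⟨k1, hk1⟩ := Int.dvd_of_emod_eq_zero h1
  obtain ⟨k2, hk2⟩ := Int.dvd_of_emod_eq_zero h2
  refine ⟨(x.b * y.c + x.c * y.b) * k2 + x.c * y.c * (-k1 * h - k2 * 2), ?_⟩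
  simp only [m2a, m2b, C3.mul_a, C3.mul_b, C3.mul_c]
  linear_combination (-x.c * y.c * h) * hk1 + ((x.b * y.c + x.c * y.b) - x.c * y.c * 2) * hk2

lemma m2b_mul {p : ℕ} {e h : ℤ} (h1 : (h + e * (2 - e) - 3) % p = 0) (h2 : (h * (2 - e) - 4) % p = 0)
    (x y : C3 ℤ) : ∃ k, m2b e (x * y) = m2a h x * m2b e y + m2b e x * m2a h y - m2b e x * m2b e y * e + p * k := by
  obtain ⟨k1, hk1⟩ := Int.dvd_of_emod_eq_zero h1
  obtain ⟨k2, hk2⟩ := Int.dvd_of_emod_eq_zero h2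
  refine ⟨(x.b * y.c + x.c * y.b) * k1 + x.c * y.c * (k2 - 2 * k1 - e * k1), ?_⟩
  simp only [m2a, m2b, C3.mul_a, C3.mul_b, C3.mul_c]
  linear_combination ((x.b * y.c + x.c * y.b) - (2 + e) * x.c * y.c) * hk1 + x.c * y.c * hk2

lemma m2_mul {p : ℕ} {e h : ℤ} (h1 : (h + e * (2 - e) - 3) % p = 0) (h2 : (h * (2 - e) - 4) % p = 0)
    (x y : C3 ℤ) : (p : ℤ) ∣ m2 e h (x * y) - m2 e h x * m2 e h y := by
  obtain ⟨k, hk⟩ := m2a_mul h1 h2 x y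
  obtain ⟨l, hl⟩ := m2b_mul h1 h2 x y
  unfold m2
  rw [hk, hl]
  generalize m2a h x = a
  generalize m2a h y = b
  generalize m2b e x = c
  generalize m2b e y = d
  refine ⟨k * (2 * (a * b - c * d * h) + p * k) - (a * b - c * d * h) * l * e
    - k * (a * d + c * b - c * d * e) * e - p * k * l * e + l * (2 * (a * d + c * b - c * d * e) + p * l) * h, ?_⟩
  ring

lemma m2_zero {p : ℕ} (hp : p.Prime) (hp2 : p ≠ 2) {e h : ℤ} (hc : chi p (e ^ 2 - 4 * h) = 2)
    (hd : ¬ (e ^ 2 - 4 * h) % p = 0) {a b : ℤ}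
    (hab : (p : ℤ) ∣ a ^ 2 - a * b * e + b ^ 2 * h) : (p : ℤ) ∣ a ∧ (p : ℤ) ∣ b := by
  have : Fact p.Prime := ⟨hp⟩
  have hb : (p : ℤ) ∣ b := by
    by_contra hb
    have hb' : (b : ZMod p) ≠ 0 := by rwa [Ne, ZMod.intCast_zmod_eq_zero_iff_dvd]
    rw [← ZMod.intCast_zmod_eq_zero_iff_dvd] at hab
    push_cast at hab
    rw [chi_eq] at hc
    push_cast at hc
    have hsq : ((e : ZMod p) ^ 2 - 4 * h) = ((2 * a - b * e) / b) ^ 2 := by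
      field_simp
      linear_combination (-4 : ZMod p) * hab
    by_cases h0 : ((e : ZMod p) ^ 2 - 4 * h) = 0
    · apply hd
      apply Int.emod_eq_zero_of_dvd
      rw [← ZMod.intCast_zmod_eq_zero_iff_dvd]
      push_cast
      exact h0
    rw [if_pos] at hc
    · simp at hc
    · exact (ZMod.euler_criterion p h0).1 ⟨(2 * a - b * e) / b, by rw [hsq, pow_two]⟩
  refine ⟨?_, hb⟩
  have h3 : (p : ℤ) ∣ a ^ 2 := by
    obtain ⟨k, rfl⟩ := hb
    have : (p : ℤ) ∣ a * (p * k) * e - (p * k) ^ 2 * h := ⟨a * k * e - p * k ^ 2 * h, by ring⟩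
    have := dvd_add hab this
    ring_nf at this ⊢
    exact this
  exact Int.Prime.dvd_pow' hp h3

/-- degree two prime -/
def ucK2 (p : ℕ) (e h : ℤ) (π : C3 ℤ) (hp : p.Prime) (hp2 : p ≠ 2) (hk : ok2 p e h π = true) : UC π 1 :=
  have h' : (h + e * (2 - e) - 3) % p = 0 ∧ (h * (2 - e) - 4) % p = 0 ∧ m2a h π % p = 0 ∧ m2b e π % p = 0
   ∧ (dvK π ⟨p, 0, 0⟩).isSome = true ∧ (dvK π ⟨h, e, 1⟩).isSome = true ∧ π ≠ 0 ∧ chi p (e ^ 2 - 4 * h) = 2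
    ∧ ¬ ((e ^ 2 - 4 * h) % p = 0) := by
      simp only [ok2, Bool.and_eq_true, beq_iff_eq, Bool.not_eq_true', beq_eq_false_iff_ne] at hk
      tauto
  oddUC p hp hp2 h'.2.2.2.2.2.2.1 (m2 e h) (by simp [m2, m2a, m2b]) (by simp [m2, m2a, m2b]) (m2_mul h'.1 h'.2.1)
    (by
      rintro a b ⟨q, hq⟩
      obtain ⟨k, hk⟩ := m2a_mul h'.1 h'.2.1 π q
      obtain ⟨l, hl⟩ := m2b_mul h'.1 h'.2.1 π q
      obtain ⟨u, hu⟩ := Int.dvd_of_emod_eq_zero h'.2.2.1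
      obtain ⟨w, hw⟩ := Int.dvd_of_emod_eq_zero h'.2.2.2.1
      rw [← hq] at hk hl
      have e1 : m2a h b = m2a h a + p * (u * m2a h q - w * m2b e q * h + k) := by
        have : m2a h (b - a) = m2a h b - m2a h a := by simp [m2a]; ring
        rw [this, hu, hw] at hk
        linear_combination hk
      have e2 : m2b e b = m2b e a + p * (u * m2b e q + w * m2a h q - w * m2b e q * e + l) := by
        have : m2b e (b - a) = m2b e b - m2b e a := by simp [m2b]; ring
        rw [this, hu, hw] at hl
        linear_combination hl
      unfold m2
      rw [e1, e2]
      generalize (u * m2a h q - w * m2b e q * h + k) = X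
      generalize (u * m2b e q + w * m2a h q - w * m2b e q * e + l) = Y
      exact ⟨X * (2 * m2a h a + p * X) - (X * m2b e a + m2a h a * Y + p * X * Y) * e
        + Y * (2 * m2b e a + p * Y) * h, by ring⟩)
    (by
      intro u hu
      obtain ⟨⟨k, hk⟩, ⟨l, hl⟩⟩ := m2_zero hp hp2 h'.2.2.2.2.2.2.2.1 h'.2.2.2.2.2.2.2.2 hu
      have e : u = (⟨p, 0, 0⟩ : C3 ℤ) * ⟨k, l, 0⟩ + ⟨h, e, 1⟩ * ⟨u.c, 0, 0⟩ := by
        simp only [m2a, m2b] at hk hl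
        ext
        · simp; linear_combination hk
        · simp; linear_combination hl
        · simp
      rw [e]
      exact dvd_add (Dvd.dvd.mul_right (dvd_of_dvK h'.2.2.2.2.2.2.1 h'.2.2.2.2.1) _)
        (Dvd.dvd.mul_right (dvd_of_dvK h'.2.2.2.2.2.2.1 h'.2.2.2.2.2.1) _))

/-- inertness check on projective points -/
def ok3 (p : ℕ) : Bool :=
  ((List.range p).all fun b => (List.range p).all fun c => !(C3.nm (⟨1, b, c⟩ : C3 ℤ) % p == 0))
  && ((List.range p).all fun c => !(C3.nm (⟨0, 1, c⟩ : C3 ℤ) % p == 0)) && !(C3.nm (⟨0, 0, 1⟩ : C3 ℤ) % p == 0)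

lemma nm_cong {p : ℕ} {x y : C3 ℤ} (ha : (p : ℤ) ∣ x.a - y.a) (hb : (p : ℤ) ∣ x.b - y.b)
    (hc : (p : ℤ) ∣ x.c - y.c) : (p : ℤ) ∣ C3.nm x - C3.nm y := by
  rw [← ZMod.intCast_zmod_eq_zero_iff_dvd] at *
  push_cast at ha hb hc
  have ha := sub_eq_zero.1 ha
  have hb := sub_eq_zero.1 hb
  have hc := sub_eq_zero.1 hc
  simp only [C3.nm]
  push_cast
  rw [ha, hb, hc, sub_self]

lemma exists_inv_mod {p : ℕ} (hp : p.Prime) {a : ℤ} (h : ¬ (p : ℤ) ∣ a) : ∃ i : ℤ, (p : ℤ) ∣ i * a - 1 := by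
  have : IsCoprime a (p : ℤ) := by
    rw [Int.isCoprime_iff_gcd_eq_one, Int.gcd_comm]
    exact (Nat.Prime.coprime_iff_not_dvd hp).2 (fun h' => h (Int.natCast_dvd.2 h'))
  obtain ⟨u, w, hu⟩ := this
  exact ⟨u, -w, by linear_combination hu⟩

lemma exists_res {p : ℕ} (hp : p.Prime) (a : ℤ) : ∃ r : ℕ, r < p ∧ (p : ℤ) ∣ a - r := by
  have h0 : (p : ℤ) ≠ 0 := by exact_mod_cast hp.ne_zero
  have hp' : (0 : ℤ) < p := by exact_mod_cast hp.pos
  refine ⟨(a % p).toNat, ?_, ?_⟩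
  · have := Int.emod_lt_of_pos a hp'
    have := Int.emod_nonneg a h0
    omega
  · rw [Int.toNat_of_nonneg (Int.emod_nonneg a h0)]
    exact Int.dvd_self_sub_emod

lemma nm3_zero {p : ℕ} (hp : p.Prime) (h : ok3 p = true) {u : C3 ℤ} (hu : (p : ℤ) ∣ C3.nm u) :
    (p : ℤ) ∣ u.a ∧ (p : ℤ) ∣ u.b ∧ (p : ℤ) ∣ u.c := by
  simp only [ok3, Bool.and_eq_true, List.all_eq_true, List.mem_range, Bool.not_eq_true', beq_eq_false_iff_ne] at h
  obtain ⟨⟨h1, h2⟩, h3⟩ := h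
  have key : ∀ i : ℤ, ∀ y : C3 ℤ, (p : ℤ) ∣ i * u.a - y.a → (p : ℤ) ∣ i * u.b - y.b → (p : ℤ) ∣ i * u.c - y.c →
      C3.nm y % p = 0 := by
    intro i y ha hb hc
    have e : C3.nm (C3.ofA i * u) = i ^ 3 * C3.nm u := by rw [C3.nm_mul, C3.nm_ofA]
    have := nm_cong (x := C3.ofA i * u) (y := y) (by simpa [C3.ofA] using ha) (by simpa [C3.ofA] using hb)
      (by simpa [C3.ofA] using hc)
    rw [e] at this
    apply Int.emod_eq_zero_of_dvd
    have h5 := dvd_sub (Dvd.dvd.mul_left hu (i ^ 3)) this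
    simpa using h5
  have ha : (p : ℤ) ∣ u.a := by
    by_contra hn
    obtain ⟨i, hi⟩ := exists_inv_mod hp hn
    obtain ⟨r, hr, hr'⟩ := exists_res hp (i * u.b)
    obtain ⟨s, hs, hs'⟩ := exists_res hp (i * u.c)
    exact h1 r hr s hs (key i ⟨1, r, s⟩ hi hr' hs')
  have hb : (p : ℤ) ∣ u.b := by
    by_contra hn
    obtain ⟨i, hi⟩ := exists_inv_mod hp hn
    obtain ⟨s, hs, hs'⟩ := exists_res hp (i * u.c)
    exact h2 s hs (key i ⟨0, 1, s⟩ (by simpa using Dvd.dvd.mul_left ha i) hi hs')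
  refine ⟨ha, hb, ?_⟩
  by_contra hn
  obtain ⟨i, hi⟩ := exists_inv_mod hp hn
  exact h3 (key i ⟨0, 0, 1⟩ (by simpa using Dvd.dvd.mul_left ha i) (by simpa using Dvd.dvd.mul_left hb i) hi)

/-- inert prime -/
def ucK3 (p : ℕ) (hp : p.Prime) (hp2 : p ≠ 2) (h : ok3 p = true) : UC (⟨p, 0, 0⟩ : C3 ℤ) 1 :=
  oddUC p hp hp2 (by intro h0; have := congrArg C3.a h0; simp at this; exact hp.ne_zero this) C3.nm C3.nm_zero C3.nm_one
    (by intro a b; rw [C3.nm_mul]; simp)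
    (by
      rintro a b ⟨q, hq⟩
      apply nm_cong
      · rw [← C3.sub_a, hq]; exact ⟨q.a, by simp⟩
      · rw [← C3.sub_b, hq]; exact ⟨q.b, by simp⟩
      · rw [← C3.sub_c, hq]; exact ⟨q.c, by simp⟩)
    (by
      intro u hu
      obtain ⟨⟨x, hx⟩, ⟨y, hy⟩, ⟨z, hz⟩⟩ := nm3_zero hp h hu
      exact ⟨⟨x, y, z⟩, by ext <;> simp [*]⟩)

/-! ### places above 2 -/

/-- characters mod 8 -/
def u8 (z : ℤ) : ℕ := if z % 8 = 3 then 6 else if z % 8 = 5 then 4 else if z % 8 = 7 then 2 else 0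

lemma u8_mul {a b : ℤ} (ha : ¬ (2 : ℤ) ∣ a) (hb : ¬ (2 : ℤ) ∣ b) : u8 (a * b) = u8 a ^^^ u8 b := by
  have h1 : a % 8 = 1 ∨ a % 8 = 3 ∨ a % 8 = 5 ∨ a % 8 = 7 := by omega
  have h2 : b % 8 = 1 ∨ b % 8 = 3 ∨ b % 8 = 5 ∨ b % 8 = 7 := by omega
  unfold u8
  rw [Int.mul_emod]
  rcases h1 with h1 | h1 | h1 | h1 <;> rcases h2 with h2 | h2 | h2 | h2 <;> rw [h1, h2] <;> rfl

lemma u8_cong {a b : ℤ} (h : (8 : ℤ) ∣ b - a) : u8 b = u8 a := by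
  have : b % 8 = a % 8 := by omega
  unfold u8; rw [this]

lemma u8_even (a : ℤ) : u8 a % 2 = 0 := by unfold u8; split_ifs <;> rfl
lemma u8_lt (a : ℤ) : u8 a < 16 := by unfold u8; split_ifs <;> simp

/-- the place 2 of ℚ -/
def ucZ2 : UC (2 : ℤ) 3 where
  uc := u8
  t_pos := by norm_num
  prime := Int.prime_two
  mul a b ha hb := u8_mul ha hb
  cong a b _ h := u8_cong (by simpa using h)
  even := u8_even
  lt := u8_lt

/-- unramified prime over 2 -/
def pi1 : C3 ℤ := ⟨2, 0, 1⟩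
/-- ramified prime over 2 -/
def pi2 : C3 ℤ := ⟨1, 1, 0⟩

lemma pi1_dvd (u : C3 ℤ) : pi1 ∣ u ↔ (2 : ℤ) ∣ m1 4 u := by
  constructor
  · rintro ⟨q, rfl⟩
    have := m1_mul (p := 8) (r := 4) (by norm_num) pi1 q
    have h2 : m1 4 pi1 = 18 := by norm_num [m1, pi1]
    rw [h2] at this
    omega
  · rintro ⟨k, hk⟩
    have hne : pi1 ≠ 0 := by decide
    have e : u = (⟨2, 0, 0⟩ : C3 ℤ) * ⟨k, 0, 0⟩ + ⟨-4, 1, 0⟩ * ⟨u.b + u.c * 4, u.c, 0⟩ := by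
      ext
      · simp; simp only [m1] at hk; linear_combination hk
      · simp; ring
      · simp
    rw [e]
    exact dvd_add (Dvd.dvd.mul_right (dvd_of_dvK hne (by decide)) _) (Dvd.dvd.mul_right (dvd_of_dvK hne (by decide)) _)

/-- the unramified place over 2 -/
def ucK2a : UC pi1 3 where
  uc u := u8 (m1 4 u)
  t_pos := by norm_num
  prime := by
    refine ⟨by decide, fun h => ?_, fun a b h => ?_⟩
    · have := (pi1_dvd 1).1 h.dvd
      revert this; decide
    · rw [pi1_dvd] at *
      rw [pi1_dvd]
      have := m1_mul (p := 8) (r := 4) (by norm_num) a b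
      have h3 : (2 : ℤ) ∣ m1 4 a * m1 4 b := by omega
      exact Int.Prime.dvd_mul' Nat.prime_two h3
  mul a b ha hb := by
    rw [pi1_dvd] at ha hb
    rw [u8_cong (by exact_mod_cast m1_mul (p := 8) (r := 4) (by norm_num) a b), u8_mul ha hb]
  cong a b _ h := by
    apply u8_cong
    obtain ⟨q, hq⟩ := h
    have e : m1 4 b - m1 4 a = m1 4 (b - a) := by simp [m1]; ring
    rw [e, hq]
    have := m1_mul (p := 8) (r := 4) (by norm_num) (pi1 ^ 3) q
    have h2 : m1 4 (pi1 ^ 3) % 8 = 0 := by decide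
    obtain ⟨k, hk⟩ := Int.dvd_of_emod_eq_zero h2
    rw [hk, mul_assoc] at this
    omega
  even _ := u8_even _
  lt _ := u8_lt _

/-- residue map at the ramified prime -/
def mM (u : C3 ℤ) : ℤ := u.a - u.b + 3 * u.c
/-- residue map at the ramified prime -/
def mN (u : C3 ℤ) : ℤ := u.b - 2 * u.c

lemma mM_mul (x y : C3 ℤ) : mM (x * y) = mM x * mM y + 2 * (mN x * mN y) - 8 * (x.c * y.c) := by
  simp [mM, mN]; ring
lemma mN_mul (x y : C3 ℤ) : mN (x * y) = mM x * mN y + mN x * mM y - 4 * (x.b * y.c + x.c * y.b) + 12 * (x.c * y.c) := by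
  simp [mM, mN]; ring

/-- table of characters at the ramified prime -/
def tq (m n : ℤ) : ℕ := if (m = 1 ∧ n = 1) ∨ (m = 7 ∧ n = 1) then 2 else if (m = 5 ∧ n = 2) ∨ (m = 7 ∧ n = 0) then 4 else if (m = 1 ∧ n = 3) ∨ (m = 7 ∧ n = 3) then 6 else if (m = 5 ∧ n = 0) ∨ (m = 7 ∧ n = 2) then 8 else if (m = 3 ∧ n = 1) ∨ (m = 5 ∧ n = 1) then 10 else if (m = 1 ∧ n = 2) ∨ (m = 3 ∧ n = 0) then 12 else if (m = 3 ∧ n = 3) ∨ (m = 5 ∧ n = 3) then 14 else 0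

/-- characters -/
def u16 (u : C3 ℤ) : ℕ := tq (mM u % 8) (mN u % 4)

lemma tq_even (m n : ℤ) : tq m n % 2 = 0 := by unfold tq; split_ifs <;> rfl
lemma tq_lt (m n : ℤ) : tq m n < 16 := by unfold tq; split_ifs <;> simp

lemma tq_mul : ∀ m ∈ [1, 3, 5, 7], ∀ n ∈ [0, 1, 2, 3], ∀ m' ∈ [1, 3, 5, 7], ∀ n' ∈ [0, 1, 2, 3],
    tq ((m * m' + 2 * (n * n')) % 8) ((m * n' + n * m') % 4) = tq m n ^^^ tq m' n' := by decide +kernel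

lemma pi2_dvd (u : C3 ℤ) : pi2 ∣ u ↔ (2 : ℤ) ∣ mM u := by
  constructor
  · rintro ⟨q, rfl⟩
    rw [mM_mul]
    have h2 : mM pi2 = 0 := by decide
    rw [h2]; omega
  · rintro ⟨k, hk⟩
    have hne : pi2 ≠ 0 := by decide
    have e : u = (⟨2, 0, 0⟩ : C3 ℤ) * ⟨k - u.c, 0, 0⟩ + ⟨1, 1, 0⟩ * ⟨u.b - u.c, u.c, 0⟩ := by
      ext
      · simp; simp only [mM] at hk; linear_combination hk
      · simp
      · simp
    rw [e]
    exact dvd_add (Dvd.dvd.mul_right (dvd_of_dvK hne (by decide)) _) (Dvd.dvd.mul_right (dvd_of_dvK hne (by decide)) _)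

lemma u16_mul {a b : C3 ℤ} (ha : ¬ pi2 ∣ a) (hb : ¬ pi2 ∣ b) : u16 (a * b) = u16 a ^^^ u16 b := by
  rw [pi2_dvd] at ha hb
  have h1 : mM a % 8 ∈ ([1, 3, 5, 7] : List ℤ) := by simp; omega
  have h2 : mN a % 4 ∈ ([0, 1, 2, 3] : List ℤ) := by simp; omega
  have h3 : mM b % 8 ∈ ([1, 3, 5, 7] : List ℤ) := by simp; omega
  have h4 : mN b % 4 ∈ ([0, 1, 2, 3] : List ℤ) := by simp; omega
  unfold u16
  rw [← tq_mul _ h1 _ h2 _ h3 _ h4, mM_mul, mN_mul]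
  have e1 := Int.mul_ediv_add_emod (mM a) 8
  have e2 := Int.mul_ediv_add_emod (mN a) 4
  have e3 := Int.mul_ediv_add_emod (mM b) 8
  have e4 := Int.mul_ediv_add_emod (mN b) 4
  generalize mM a % 8 = m at *
  generalize mN a % 4 = n at *
  generalize mM b % 8 = m' at *
  generalize mN b % 4 = n' at *
  rw [← e1, ← e2, ← e3, ← e4]
  generalize mM a / 8 = i
  generalize mN a / 4 = j
  generalize mM b / 8 = k
  generalize mN b / 4 = l
  congr 1
  · apply Int.emod_emod_of_dvd _ (dvd_refl (8 : ℤ)) |>.symm.trans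
    apply (Int.emod_emod_of_dvd _ (dvd_refl (8 : ℤ))).trans
    apply Int.ModEq.symm
    rw [Int.modEq_iff_dvd]
    exact ⟨8 * i * k + i * m' + k * m + (4 * j * l + j * n' + l * n) - a.c * b.c, by ring⟩
  · apply Int.ModEq.symm
    rw [Int.modEq_iff_dvd]
    exact ⟨8 * i * l + 2 * i * n' + m * l + (8 * j * k + j * m' + 2 * n * k) - (a.b * b.c + a.c * b.b) + 3 * (a.c * b.c), by ring⟩

/-- the ramified place over 2 -/
def ucK2b : UC pi2 5 where
  uc := u16
  t_pos := by norm_num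
  prime := by
    refine ⟨by decide, fun h => ?_, fun a b h => ?_⟩
    · have := (pi2_dvd 1).1 h.dvd
      revert this; decide
    · rw [pi2_dvd] at *
      rw [pi2_dvd]
      rw [mM_mul] at h
      have h3 : (2 : ℤ) ∣ mM a * mM b := by omega
      exact Int.Prime.dvd_mul' Nat.prime_two h3
  mul a b ha hb := u16_mul ha hb
  cong a b _ h := by
    obtain ⟨q, hq⟩ := h
    have e1 : mM b - mM a = mM (b - a) := by simp [mM]; ring
    have e2 : mN b - mN a = mN (b - a) := by simp [mN]; ring
    rw [hq, mM_mul] at e1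
    rw [hq, mN_mul] at e2
    have p1 : mM (pi2 ^ 5) % 8 = 0 := by decide
    have p2 : mN (pi2 ^ 5) % 4 = 0 := by decide
    obtain ⟨k1, h1⟩ := Int.dvd_of_emod_eq_zero p1
    obtain ⟨k2, h2⟩ := Int.dvd_of_emod_eq_zero p2
    rw [h1, h2] at e1
    rw [h1, h2] at e2
    have f1 : (8 : ℤ) ∣ mM b - mM a := by
      rw [e1]; exact ⟨k1 * mM q + k2 * mN q - (pi2 ^ 5).c * q.c, by ring⟩
    have f2 : (4 : ℤ) ∣ mN b - mN a := by
      rw [e2]; exact ⟨2 * k1 * mN q + k2 * mM q - ((pi2 ^ 5).b * q.c + (pi2 ^ 5).c * q.b) + 3 * ((pi2 ^ 5).c * q.c), by ring⟩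
    have g1 : mM b % 8 = mM a % 8 := by omega
    have g2 : mN b % 4 = mN a % 4 := by omega
    unfold u16; rw [g1, g2]
  even _ := tq_even _ _
  lt _ := tq_lt _ _

/-! ### digits -/
section digits
variable {R F : Type} [CommRing R] [IsDomain R] [IsPrincipalIdealRing R] [Field F] [Algebra R F] [IsFractionRing R F]
variable {π : R}

lemma v_pi {t : ℕ} (U : UC π t) : (mkPlace F U).v (algebraMap R F π) = 1 := by
  have hp1 : ¬ π ∣ (1 : R) := fun hd => U.prime.not_isUnit (isUnit_of_dvd_one hd)
  exact vv_rep U.prime (k := 1) (a := 1) (b := 1) ⟨hp1, hp1, by simp⟩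

lemma ge_algebraMap {t : ℕ} (U : UC π t) (a : R) : (mkPlace F U).ge (algebraMap R F a) 0 := by
  by_cases ha : a = 0
  · left; simp [ha]
  · right; exact v_algebraMap_nonneg U ha

lemma digit0 {t : ℕ} (U : UC π t) (hd : ∀ a b : R, ¬ π ∣ a → ¬ π ∣ b → π ∣ a - b) {x : F}
    (hx : (mkPlace F U).ge x 0) : (mkPlace F U).ge x 1 ∨ (mkPlace F U).ge (x - 1) 1 := by
  rcases hx with rfl | hx
  · left; exact Place.ge_zero _
  by_cases h0 : x = 0
  · left; left; exact h0
  by_cases h1 : 1 ≤ (mkPlace F U).v x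
  · left; right; exact h1
  right
  obtain ⟨k, a, b, h⟩ := exists_rep (F := F) U.prime x h0
  have hk : (mkPlace F U).v x = k := vv_rep U.prime h
  have hk0 : k = 0 := by omega
  subst hk0
  by_cases hx1 : x - 1 = 0
  · left; exact hx1
  right
  have hb : algebraMap R F b ≠ 0 := am_ne (ne_of_nd h.2.1)
  have e : algebraMap R F (a - b) = (x - 1) * algebraMap R F b := by
    have := h.2.2
    rw [zpow_zero, one_mul] at this
    rw [map_sub, ← this]; ring
  have hab : a - b ≠ 0 := by
    intro h0; rw [h0, map_zero] at e
    exact (mul_ne_zero hx1 hb) e.symm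
  have h2 := (v_algebraMap_pos (F := F) U hab).2 (hd a b h.1 h.2.1)
  rw [e, (mkPlace F U).v_mul _ _ hx1 hb] at h2
  have h3 : ¬ 1 ≤ (mkPlace F U).v (algebraMap R F b) := fun h4 =>
    h.2.1 ((v_algebraMap_pos (F := F) U (ne_of_nd h.2.1)).1 h4)
  omega

lemma digit {t : ℕ} (U : UC π t) (hd : ∀ a b : R, ¬ π ∣ a → ¬ π ∣ b → π ∣ a - b) {x : F} {x0 : R} {n : ℕ}
    (hx : (mkPlace F U).ge (x - algebraMap R F x0) n) :
    (mkPlace F U).ge (x - algebraMap R F x0) (n + 1 : ℕ) ∨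
    (mkPlace F U).ge (x - algebraMap R F (x0 + π ^ n)) (n + 1 : ℕ) := by
  have hp : algebraMap R F π ≠ 0 := am_ne U.prime.ne_zero
  have hpn : (algebraMap R F π) ^ n ≠ 0 := pow_ne_zero _ hp
  have hv : (mkPlace F U).v ((algebraMap R F π) ^ n) = n := by
    rw [Place.v_pow _ _ hp, v_pi]; simp
  have hv' : (mkPlace F U).v (((algebraMap R F π) ^ n)⁻¹) = -n := by rw [Place.v_inv _ _ hpn, hv]
  have h1 : (mkPlace F U).ge ((x - algebraMap R F x0) * ((algebraMap R F π) ^ n)⁻¹) 0 := by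
    have := Place.ge_mul hx (Place.ge_self (P := mkPlace F U) (((algebraMap R F π) ^ n)⁻¹))
    rw [hv'] at this; simpa using this
  have hs : (mkPlace F U).ge ((algebraMap R F π) ^ n) n := by rw [← hv]; exact Place.ge_self _
  rcases digit0 U hd h1 with h | h
  · left
    have := Place.ge_mul h hs
    rw [inv_mul_cancel_right₀ hpn] at this
    push_cast; rwa [add_comm]
  · right
    have := Place.ge_mul h hs
    rw [sub_mul, inv_mul_cancel_right₀ hpn, one_mul] at this
    rw [sub_sub] at this
    rw [map_add, map_pow, Nat.cast_add, Nat.cast_one, add_comm (n : ℤ)]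
    exact this
end digits

lemma digitsZ2 (a b : ℤ) (ha : ¬ (2 : ℤ) ∣ a) (hb : ¬ (2 : ℤ) ∣ b) : (2 : ℤ) ∣ a - b := by omega
lemma digitsK2a (a b : C3 ℤ) (ha : ¬ pi1 ∣ a) (hb : ¬ pi1 ∣ b) : pi1 ∣ a - b := by
  rw [pi1_dvd] at *
  have e : m1 4 (a - b) = m1 4 a - m1 4 b := by simp [m1]; ring
  omega
lemma digitsK2b (a b : C3 ℤ) (ha : ¬ pi2 ∣ a) (hb : ¬ pi2 ∣ b) : pi2 ∣ a - b := by
  rw [pi2_dvd] at *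
  have e : mM (a - b) = mM a - mM b := by simp [mM]; ring
  omega

end KZB

set_option linter.unusedSectionVars false
set_option linter.unusedVariables false
set_option linter.unusedSimpArgs false
namespace KZB

/-! ### linear algebra over the field with two elements -/

/-- parity of four bits -/
def p4 (n : ℕ) : Bool := (n.testBit 0 ^^ n.testBit 1) ^^ (n.testBit 2 ^^ n.testBit 3)

lemma p4_and_xor (m a b : ℕ) : p4 (m &&& (a ^^^ b)) = (p4 (m &&& a) ^^ p4 (m &&& b)) := by
  simp only [p4, Nat.testBit_and, Nat.testBit_xor]
  cases m.testBit 0 <;> cases m.testBit 1 <;> cases m.testBit 2 <;> cases m.testBit 3 <;>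
  cases a.testBit 0 <;> cases a.testBit 1 <;> cases a.testBit 2 <;> cases a.testBit 3 <;>
  cases b.testBit 0 <;> cases b.testBit 1 <;> cases b.testBit 2 <;> cases b.testBit 3 <;> rfl

/-- linear functional on pairs of codes -/
def lin (μ a b : ℕ) : Bool := p4 (μ % 16 &&& a) ^^ p4 (μ / 16 &&& b)

lemma lin_xor (μ a b c d : ℕ) : lin μ (a ^^^ c) (b ^^^ d) = (lin μ a b ^^ lin μ c d) := by
  simp only [lin, p4_and_xor]
  cases p4 (μ % 16 &&& a) <;> cases p4 (μ % 16 &&& c) <;> cases p4 (μ / 16 &&& b) <;>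
    cases p4 (μ / 16 &&& d) <;> rfl

/-- dot product -/
def dot : ℕ → ℕ → (ℕ → Bool) → Bool
  | 0, _, _ => false
  | n + 1, r, X => (r.testBit n && X n) ^^ dot n r X

lemma dot_xor (n r s : ℕ) (X : ℕ → Bool) : dot n (r ^^^ s) X = (dot n r X ^^ dot n s X) := by
  induction n with
  | zero => rfl
  | succ n ih =>
    simp only [dot, ih, Nat.testBit_xor]
    cases r.testBit n <;> cases s.testBit n <;> cases X n <;> cases dot n r X <;> cases dot n s X <;> rfl

lemma dot_zero (n : ℕ) (X : ℕ → Bool) : dot n 0 X = false := by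
  induction n with
  | zero => rfl
  | succ n ih => simp [dot, ih]

lemma dot_two_pow (n j : ℕ) (X : ℕ → Bool) : dot n (2 ^ j) X = (decide (j < n) && X j) := by
  induction n with
  | zero => simp [dot]
  | succ n ih =>
    simp only [dot, ih, Nat.testBit_two_pow]
    by_cases h : j = n
    · subst h; simp
    · have : (j < n + 1) ↔ j < n := by omega
      simp [h, this]

/-- xor of a selection of rows -/
def xorsel : List ℕ → ℕ → ℕ
  | [], _ => 0
  | r :: l, c => (if c % 2 = 1 then r else 0) ^^^ xorsel l (c / 2)

lemma dot_xorsel (n : ℕ) (X : ℕ → Bool) (l : List ℕ) (h : ∀ r ∈ l, dot n r X = false) (c : ℕ) :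
    dot n (xorsel l c) X = false := by
  induction l generalizing c with
  | nil => exact dot_zero _ _
  | cons r l ih =>
    rw [xorsel, dot_xor, ih (fun r hr => h r (List.mem_cons_of_mem _ hr))]
    split
    · rw [h r List.mem_cons_self]; rfl
    · rw [dot_zero]; rfl

/-- certificate check -/
def certOK (rows : List ℕ) (Xs j0 : ℕ) : ℕ → List ℕ → Bool
  | _, [] => true
  | j, c :: l => (xorsel rows c == (2 ^ j ^^^ (if Xs.testBit j then 2 ^ j0 else 0))) && certOK rows Xs j0 (j + 1) l

lemma certOK_spec {n : ℕ} {X : ℕ → Bool} {rows : List ℕ} (hr : ∀ r ∈ rows, dot n r X = false) {Xs j0 : ℕ}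
    (hj : j0 < n) : ∀ (cs : List ℕ) (j : ℕ), certOK rows Xs j0 j cs = true → j + cs.length ≤ n →
      ∀ i, j ≤ i → i < j + cs.length → X i = (Xs.testBit i && X j0) := by
  intro cs
  induction cs with
  | nil => intro j _ _ i h1 h2; simp at h2; omega
  | cons c l ih =>
    intro j h hn i h1 h2
    simp only [certOK, Bool.and_eq_true, beq_iff_eq] at h
    simp only [List.length_cons] at hn h2
    by_cases hij : i = j
    · subst hij
      have := dot_xorsel n X rows hr c
      rw [h.1, dot_xor, dot_two_pow] at this
      have hin : i < n := by omega
      simp only [hin, decide_true, Bool.true_and] at this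
      cases hX : Xs.testBit i
      · simp [hX, dot_zero] at this; simpa using this
      · simp [hX, dot_two_pow, hj] at this; simpa using this
    · exact ih (j + 1) h.2 (by omega) i (by omega) (by omega)

/-! ### products of generators -/
section gens
variable {R : Type} [CommRing R] [IsDomain R]

/-- product of selected generators; generator `j` of the list has index `i + j` -/
def gp : List R → ℕ → (ℕ → Bool) → R
  | [], _, _ => 1
  | g :: G, i, X => (if X i then g else 1) * gp G (i + 1) X

lemma gp_ne_zero {G : List R} (hG : ∀ g ∈ G, g ≠ 0) (i : ℕ) (X : ℕ → Bool) : gp G i X ≠ 0 := by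
  induction G generalizing i with
  | nil => exact one_ne_zero
  | cons g G ih =>
    rw [gp]
    refine mul_ne_zero ?_ (ih (fun g hg => hG g (List.mem_cons_of_mem _ hg)) _)
    split
    · exact hG g List.mem_cons_self
    · exact one_ne_zero

lemma gp_congr {G : List R} {i j : ℕ} {X Y : ℕ → Bool} (h : ∀ k < G.length, X (i + k) = Y (j + k)) :
    gp G i X = gp G j Y := by
  induction G generalizing i j with
  | nil => rfl
  | cons g G ih =>
    have h0 := h 0 (by simp)
    simp only [add_zero] at h0
    rw [gp, gp, h0, ih (i := i + 1) (j := j + 1)]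
    intro k hk
    have := h (k + 1) (by simpa using hk)
    rwa [show i + 1 + k = i + (k + 1) by ring, show j + 1 + k = j + (k + 1) by ring]

lemma gp_append (G H : List R) (i : ℕ) (X : ℕ → Bool) : gp (G ++ H) i X = gp G i X * gp H (i + G.length) X := by
  induction G generalizing i with
  | nil => simp [gp]
  | cons g G ih =>
    simp only [List.cons_append, gp, ih, List.length_cons, mul_assoc]
    rw [show i + 1 + G.length = i + (G.length + 1) by ring]

lemma gp_false (G : List R) (i : ℕ) (X : ℕ → Bool) (h : ∀ k, X k = false) : gp G i X = 1 := by
  induction G generalizing i with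
  | nil => rfl
  | cons g G ih => simp [gp, h, ih]

/-- multiply by a generator -/
lemma gp_toggle {G : List R} (hG : ∀ g ∈ G, g ≠ 0) {g : R} (hg : g ∈ G) (i : ℕ) (X : ℕ → Bool) :
    ∃ (Y : ℕ → Bool) (β : R), β ≠ 0 ∧ gp G i X * g = gp G i Y * β ^ 2 := by
  induction G generalizing i with
  | nil => simp at hg
  | cons a G ih =>
    by_cases hga : g = a
    · subst hga
      have hg0 := hG g List.mem_cons_self
      have hc : gp G (i + 1) X = gp G (i + 1) (Function.update X i (!X i)) := by
        apply gp_congr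
        intro k _
        rw [Function.update_of_ne (by omega)]
      refine ⟨Function.update X i (!X i), if X i then g else 1, by split <;> simp [hg0], ?_⟩
      rw [gp, gp, ← hc, Function.update_self]
      cases X i
      · simp; ring
      · simp; ring
    · have hg' : g ∈ G := by
        rcases List.mem_cons.1 hg with h | h
        · exact absurd h hga
        · exact h
      obtain ⟨Y, β, hβ, e⟩ := ih (fun g hg => hG g (List.mem_cons_of_mem _ hg)) hg' (i + 1)
      refine ⟨Function.update Y i (X i), β, hβ, ?_⟩
      have hc : gp G (i + 1) Y = gp G (i + 1) (Function.update Y i (X i)) := by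
        apply gp_congr
        intro k _
        rw [Function.update_of_ne (by omega)]
      rw [gp, gp, ← hc, Function.update_self, mul_assoc, e, mul_assoc]

end gens

/-! ### S-units modulo squares -/
section sunit
variable {R F : Type} [CommRing R] [IsDomain R] [IsPrincipalIdealRing R] [Field F] [Algebra R F] [IsFractionRing R F]

lemma v_triv_zero {q g : R} (hq : Prime q) (h : ¬ q ∣ g) :
    (mkPlace F (UC.triv hq)).v (algebraMap R F g) = 0 := by
  have h1 := (v_algebraMap_pos (F := F) (UC.triv hq) (ne_of_nd h))
  have h2 := v_algebraMap_nonneg (F := F) (UC.triv hq) (ne_of_nd h)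
  have : ¬ 1 ≤ (mkPlace F (UC.triv hq)).v (algebraMap R F g) := fun h3 => h (h1.1 h3)
  omega

lemma sunit_R (F : Type) [Field F] [Algebra R F] [IsFractionRing R F] {S : List R} (hS : ∀ g ∈ S, Prime g) (i : ℕ) (x : R) (hx : x ≠ 0)
    (h : ∀ (q : R) (hq : Prime q), (∀ g ∈ S, ¬ q ∣ g) → (mkPlace F (UC.triv hq)).v (algebraMap R F x) % 2 = 0) :
    ∃ (u : Rˣ) (X : ℕ → Bool) (β : R), β ≠ 0 ∧ x = u * gp S i X * β ^ 2 := by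
  have hS0 : ∀ g ∈ S, g ≠ 0 := fun g hg => (hS g hg).ne_zero
  have hwf : WellFounded (DvdNotUnit (α := R)) := wellFounded_dvdNotUnit
  induction x using hwf.induction with
  | _ x ih =>
  by_cases hu : IsUnit x
  · exact ⟨hu.unit, fun _ => false, 1, one_ne_zero, by rw [gp_false _ _ _ (fun _ => rfl)]; simp⟩
  obtain ⟨q, hqi, hqx⟩ := WfDvdMonoid.exists_irreducible_factor hu hx
  have hq : Prime q := hqi.prime
  by_cases hqS : ∀ g ∈ S, ¬ q ∣ g
  · have h1 := h q hq hqS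
    have h2 := (v_algebraMap_pos (F := F) (UC.triv hq) hx).2 hqx
    obtain ⟨y, rfl⟩ := hqx
    have hy : y ≠ 0 := right_ne_zero_of_mul hx
    have hq' : algebraMap R F q ≠ 0 := am_ne hq.ne_zero
    have hy' : algebraMap R F y ≠ 0 := am_ne hy
    rw [map_mul, (mkPlace F (UC.triv hq)).v_mul _ _ hq' hy', v_pi] at h1 h2
    have h3 : 1 ≤ (mkPlace F (UC.triv hq)).v (algebraMap R F y) := by
      have := v_algebraMap_nonneg (F := F) (UC.triv hq) hy
      omega
    obtain ⟨z, rfl⟩ := (v_algebraMap_pos (F := F) (UC.triv hq) hy).1 h3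
    have hz : z ≠ 0 := right_ne_zero_of_mul hy
    have hz' : algebraMap R F z ≠ 0 := am_ne hz
    obtain ⟨u, X, β, hβ, e⟩ := ih z ⟨hz, q * q, fun hh => hq.not_isUnit (isUnit_of_mul_isUnit_left hh), by ring⟩ hz (by
      intro r hr hrS
      have := h r hr hrS
      rw [map_mul, map_mul, (mkPlace F (UC.triv hr)).v_mul _ _ hq' (mul_ne_zero hq' hz'),
        (mkPlace F (UC.triv hr)).v_mul _ _ hq' hz'] at this
      omega)
    exact ⟨u, X, q * β, mul_ne_zero hq.ne_zero hβ, by rw [e]; ring⟩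
  · push Not at hqS
    obtain ⟨g, hg, hqg⟩ := hqS
    have hgx : g ∣ x := (hqi.associated_of_dvd (hS g hg).irreducible hqg).symm.dvd.trans hqx
    obtain ⟨y, rfl⟩ := hgx
    have hy : y ≠ 0 := right_ne_zero_of_mul hx
    have hy' : algebraMap R F y ≠ 0 := am_ne hy
    have hg0 := hS0 g hg
    obtain ⟨u, X, β, hβ, e⟩ := ih y ⟨hy, g, (hS g hg).not_isUnit, by ring⟩ hy (by
      intro r hr hrS
      have := h r hr hrS
      rw [map_mul, (mkPlace F (UC.triv hr)).v_mul _ _ (am_ne hg0) hy', v_triv_zero hr (hrS g hg)] at this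
      omega)
    obtain ⟨Y, γ, hγ, e2⟩ := gp_toggle hS0 hg i X
    refine ⟨u, Y, γ * β, mul_ne_zero hγ hβ, ?_⟩
    rw [e]
    linear_combination (↑u * β ^ 2) * e2

/-- units are generated modulo squares -/
def UnitGen (U : List R) : Prop := ∀ u : Rˣ, ∃ (X : ℕ → Bool) (β : R), β ≠ 0 ∧ (u : R) = gp U 0 X * β ^ 2

lemma sunit_F {U S : List R} (hU : UnitGen U) (hS : ∀ g ∈ S, Prime g) (w : F) (hw : w ≠ 0)
    (h : ∀ (q : R) (hq : Prime q), (∀ g ∈ S, ¬ q ∣ g) → (mkPlace F (UC.triv hq)).v w % 2 = 0) (i : ℕ) :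
    ∃ (X : ℕ → Bool) (β : F), β ≠ 0 ∧ w = algebraMap R F (gp (U ++ S) i X) * β ^ 2 := by
  obtain ⟨a, b, hb, rfl⟩ := IsFractionRing.div_surjective (A := R) w
  have hb0 : b ≠ 0 := nonZeroDivisors.ne_zero hb
  have ha0 : a ≠ 0 := by rintro rfl; simp at hw
  have ha' : algebraMap R F a ≠ 0 := am_ne ha0
  have hb' : algebraMap R F b ≠ 0 := am_ne hb0
  obtain ⟨u, X, β, hβ, e⟩ := sunit_R F hS U.length (a * b) (mul_ne_zero ha0 hb0) (by
    intro q hq hqS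
    have := h q hq hqS
    rw [Place.v_div _ _ _ ha' hb'] at this
    rw [map_mul, (mkPlace F (UC.triv hq)).v_mul _ _ ha' hb']
    omega)
  obtain ⟨Y, γ, hγ, e2⟩ := hU u
  refine ⟨fun k => if k - i < U.length then Y (k - i) else X (k - i),
    algebraMap R F (γ * β) / algebraMap R F b, div_ne_zero (am_ne (mul_ne_zero hγ hβ)) hb', ?_⟩
  have e3 : gp (U ++ S) i (fun k => if k - i < U.length then Y (k - i) else X (k - i)) = gp U 0 Y * gp S U.length X := by
    rw [gp_append]
    congr 1
    · apply gp_congr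
      intro k hk
      simp [hk]
    · apply gp_congr
      intro k hk
      rw [if_neg (by omega)]
      congr 1; omega
  rw [e3, div_pow, ← map_pow, ← map_pow]
  rw [div_eq_iff hb', eq_comm, mul_div_assoc', div_mul_eq_mul_div, div_eq_iff (by simpa using hb0), ← map_mul, ← map_mul, ← map_mul]
  congr 1
  rw [e2] at e
  linear_combination (-b) * e

end sunit
end KZB

set_option linter.unusedSectionVars false
set_option linter.unusedVariables false
set_option linter.unusedSimpArgs false
namespace KZB

section loc
variable {F : Type} [Field F] {P : Place F}

lemma cd_par {x : F} (hx : x ≠ 0) : ((P.cd x : ℕ) : ℤ) % 2 = P.v x % 2 := by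
  have := P.cd_v x hx
  unfold bp at this
  split at this <;> omega

lemma xor_par (a b : ℕ) : (a ^^^ b) % 2 = (a + b) % 2 := Nat.xor_mod_two_eq

lemma xor3_par {a b c : ℕ} (h : a ^^^ b ^^^ c = 0) : (a + b + c) % 2 = 0 := by
  have h1 := xor_par (a ^^^ b) c
  have h2 := xor_par a b
  rw [h] at h1; omega

lemma xor3_eq {a b c : ℕ} (h : a ^^^ b ^^^ c = 0) : c = a ^^^ b := by
  have := Nat.xor_eq_zero_iff.1 h
  exact this.symm

lemma cdc (ht : P.t = 1) {x y : F} (hy : y ≠ 0) (h : P.ge (x - y) (P.v y + 1)) : P.cd x = P.cd y :=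
  (Place.cd_close hy (by rwa [ht])).2

lemma odd_cases (ht : P.t = 1) {a b c : F} {m k : ℤ} (ha : a ≠ 0) (hb : b ≠ 0) (hc : c ≠ 0) (hab : a - b ≠ 0)
    (hca : c - a ≠ 0) (hcb : c - b ≠ 0) (vab : P.v (a - b) = m + k) (vca : P.v (c - a) = m) (vcb : P.v (c - b) = m)
    (hk : 0 ≤ k) (hx : P.cd a ^^^ P.cd b ^^^ P.cd c = 0) :
    (P.cd a = 0 ∧ P.cd b = 0 ∧ P.cd c = 0) ∨ (P.cd a = P.cd (a - c) ∧ P.cd b = P.cd (b - c)) ∨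
    (P.cd c = P.cd (c - b) ∧ P.cd a = P.cd (a - b)) ∨ (P.cd c = P.cd (c - a) ∧ P.cd b = P.cd (b - a)) ∨
    (P.v c = m ∧ ((P.v a = m + k ∧ P.v b = m + k ∧ 1 ≤ k ∧ P.cd c = P.cd (c - a)) ∨
      (1 ≤ k ∧ P.cd a = P.cd b ∧ P.cd c = 0 ∧ P.cd c = P.cd (c - a)) ∨
      (P.v a = m ∧ P.v b = m ∧ (k = 0 ∨ (P.cd c = 0 ∧ P.cd a = P.cd b))))) := by
  have gab : P.ge (a - b) (m + k) := Or.inr vab.ge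
  have gba : P.ge (b - a) (m + k) := by rw [← neg_sub]; exact Place.ge_neg gab
  have gca : P.ge (c - a) m := Or.inr vca.ge
  have gcb : P.ge (c - b) m := Or.inr vcb.ge
  have gac : P.ge (a - c) m := by rw [← neg_sub]; exact Place.ge_neg gca
  have gbc : P.ge (b - c) m := by rw [← neg_sub]; exact Place.ge_neg gcb
  have hac : a - c ≠ 0 := by rw [← neg_sub]; exact neg_ne_zero.2 hca
  have hbc : b - c ≠ 0 := by rw [← neg_sub]; exact neg_ne_zero.2 hcb
  have hba : b - a ≠ 0 := by rw [← neg_sub]; exact neg_ne_zero.2 hab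
  have vac : P.v (a - c) = m := by rw [P.v_sub_comm]; exact vca
  have vbc : P.v (b - c) = m := by rw [P.v_sub_comm]; exact vcb
  have vba : P.v (b - a) = m + k := by rw [P.v_sub_comm]; exact vab
  rcases lt_trichotomy (P.v c) m with h | h | h
  · left
    have h1 := cdc (P := P) ht hc (Place.ge_mono gac (by omega))
    have h2 := cdc (P := P) ht hc (Place.ge_mono gbc (by omega))
    rw [h1, h2] at hx
    simp at hx
    exact ⟨h1.trans hx, h2.trans hx, hx⟩
  · right; right
    have gc : P.ge c m := Or.inr h.ge
    have va : m ≤ P.v a := Place.v_of_ge (by simpa using Place.ge_add gac gc) ha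
    have vb : m ≤ P.v b := Place.v_of_ge (by simpa using Place.ge_add gbc gc) hb
    have eqab : P.cd a = P.cd b → P.cd c = 0 := by
      intro e; rw [e] at hx; simpa using hx
    have big : m + 1 ≤ P.v a → P.cd c = P.cd (c - a) := fun hh =>
      cdc (P := P) ht hca (by rw [vca]; simpa using Place.ge_mono (Place.ge_self (P := P) a) hh)
    rcases lt_trichotomy (P.v a) (m + k) with h1 | h1 | h1
    · right; right
      refine ⟨h, ?_⟩
      have e : P.cd b = P.cd a := cdc (P := P) ht ha (Place.ge_mono gba (by omega))
      by_cases h2 : m + 1 ≤ P.v a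
      · right; left
        exact ⟨by omega, e.symm, eqab e.symm, big h2⟩
      · right; right
        have h3 : P.v a = m := by omega
        refine ⟨h3, ?_, Or.inr ⟨eqab e.symm, e.symm⟩⟩
        have := (Place.v_eq_of_close (P := P) ha (x := b) (Place.ge_mono gba (by omega))).2
        omega
    · have vb' : m + k ≤ P.v b := Place.v_of_ge (by simpa using Place.ge_add gba (Place.ge_mono (Place.ge_self (P := P) a) h1.ge)) hb
      rcases lt_or_eq_of_le vb' with h2 | h2
      · left
        have gb : P.ge b (m + k + 1) := Or.inr (by omega)
        exact ⟨cdc (P := P) ht hcb (by simpa [vcb] using Place.ge_mono gb (by omega)),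
          cdc (P := P) ht hab (by simpa [vab] using gb)⟩
      · right; right
        refine ⟨h, ?_⟩
        by_cases hk0 : k = 0
        · right; right; exact ⟨by omega, by omega, Or.inl hk0⟩
        · left; exact ⟨h1, h2.symm, by omega, big (by omega)⟩
    · right; left
      have ga : P.ge a (m + k + 1) := Or.inr (by omega)
      exact ⟨big (by omega), cdc (P := P) ht hba (by simpa [vba] using ga)⟩
  · right; left
    have gc : P.ge c (m + 1) := Or.inr (by omega)
    exact ⟨cdc (P := P) ht hac (by simpa [vac] using gc), cdc (P := P) ht hbc (by simpa [vbc] using gc)⟩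

/-- unramified case -/
lemma odd_L0 (ht : P.t = 1) {a b c : F} {m : ℤ} (ha : a ≠ 0) (hb : b ≠ 0) (hc : c ≠ 0) (hab : a - b ≠ 0)
    (hca : c - a ≠ 0) (hcb : c - b ≠ 0) (vab : P.v (a - b) = m) (vca : P.v (c - a) = m) (vcb : P.v (c - b) = m)
    (hm : m % 2 = 0) (hx : P.cd a ^^^ P.cd b ^^^ P.cd c = 0) :
    P.v a % 2 = 0 ∧ P.v b % 2 = 0 ∧ P.v c % 2 = 0 := by
  have hac : a - c ≠ 0 := by rw [← neg_sub]; exact neg_ne_zero.2 hca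
  have hbc : b - c ≠ 0 := by rw [← neg_sub]; exact neg_ne_zero.2 hcb
  have hba : b - a ≠ 0 := by rw [← neg_sub]; exact neg_ne_zero.2 hab
  have pa := cd_par (P := P) ha
  have pb := cd_par (P := P) hb
  have pc := cd_par (P := P) hc
  have pab := cd_par (P := P) hab
  have pba := cd_par (P := P) hba
  have pac := cd_par (P := P) hac
  have pca := cd_par (P := P) hca
  have pbc := cd_par (P := P) hbc
  have pcb := cd_par (P := P) hcb
  rw [P.v_sub_comm] at pac pbc pba
  have px := xor3_par hx
  have hcases := odd_cases ht ha hb hc hab hca hcb (by rw [vab, add_zero]) vca vcb le_rfl hx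
  rw [vab] at pab pba
  rw [vca] at pca pac
  rw [vcb] at pcb pbc
  generalize P.cd a = ca at *
  generalize P.cd b = cb at *
  generalize P.cd c = cc at *
  generalize P.cd (a - b) = cab at *
  generalize P.cd (b - a) = cba at *
  generalize P.cd (a - c) = cac at *
  generalize P.cd (c - a) = cca at *
  generalize P.cd (b - c) = cbc at *
  generalize P.cd (c - b) = ccb at *
  generalize P.v a = va at *
  generalize P.v b = vb at *
  generalize P.v c = vc at *
  clear vab vca vcb
  clear ha hb hc hab hca hcb ht
  clear hac hbc hba
  rcases hcases with
    ⟨h1, h2, h3⟩ | ⟨h1, h2⟩ | ⟨h1, h2⟩ | ⟨h1, h2⟩ | ⟨h0, ⟨h1, h2, h3, h4⟩ | ⟨h4, h1, h2, h3⟩ | ⟨h1, h2, h3⟩⟩ <;>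
    omega

/-- allowed codes, even case -/
def okL1 (β k ca cc : ℕ) : Bool := cc % 2 == 0 && ((cc == 0 && (ca % 2 == 0 || β == 0)) || (cc == β && ca % 2 == k % 2))

/-- even case -/
lemma odd_L1 (ht : P.t = 1) {a b c : F} {m k : ℕ} (ha : a ≠ 0) (hb : b ≠ 0) (hc : c ≠ 0) (hab : a - b ≠ 0)
    (hca : c - a ≠ 0) (hcb : c - b ≠ 0) (vab : P.v (a - b) = m + k) (vca : P.v (c - a) = m) (vcb : P.v (c - b) = m)
    (hm : m % 2 = 0) (hk : 1 ≤ k) (hx : P.cd a ^^^ P.cd b ^^^ P.cd c = 0) :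
    okL1 (P.cd (c - a)) k (P.cd a) (P.cd c) = true := by
  have hac : a - c ≠ 0 := by rw [← neg_sub]; exact neg_ne_zero.2 hca
  have hbc : b - c ≠ 0 := by rw [← neg_sub]; exact neg_ne_zero.2 hcb
  have hba : b - a ≠ 0 := by rw [← neg_sub]; exact neg_ne_zero.2 hab
  have pa := cd_par (P := P) ha
  have pb := cd_par (P := P) hb
  have pc := cd_par (P := P) hc
  have pab := cd_par (P := P) hab
  have pba := cd_par (P := P) hba
  have pac := cd_par (P := P) hac
  have pca := cd_par (P := P) hca
  have pbc := cd_par (P := P) hbc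
  have pcb := cd_par (P := P) hcb
  rw [P.v_sub_comm] at pac pbc pba
  have px := xor3_par hx
  have e1 : P.cd (c - b) = P.cd (c - a) := cdc ht hca (by rw [vca]; right; rw [sub_sub_sub_cancel_left, vab]; omega)
  have e2 : P.cd (b - c) = P.cd (a - c) := cdc ht hac (by
    rw [P.v_sub_comm, vca]; right; rw [sub_sub_sub_cancel_right, P.v_sub_comm, vab]; omega)
  simp only [okL1, Bool.and_eq_true, Bool.or_eq_true, beq_iff_eq]
  have hcases := odd_cases ht ha hb hc hab hca hcb vab vca vcb (by omega) hx
  rw [vab] at pab pba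
  rw [vca] at pca pac
  rw [vcb] at pcb pbc
  generalize P.cd a = ca at *
  generalize P.cd b = cb at *
  generalize P.cd c = cc at *
  generalize P.cd (a - b) = cab at *
  generalize P.cd (b - a) = cba at *
  generalize P.cd (a - c) = cac at *
  generalize P.cd (c - a) = cca at *
  generalize P.cd (b - c) = cbc at *
  generalize P.cd (c - b) = ccb at *
  generalize P.v a = va at *
  generalize P.v b = vb at *
  generalize P.v c = vc at *
  clear vab vca vcb
  clear ha hb hc hab hca hcb ht
  clear hac hbc hba
  rcases hcases with
    ⟨h1, h2, h3⟩ | ⟨h1, h2⟩ | ⟨h1, h2⟩ | ⟨h1, h2⟩ | ⟨h0, ⟨h1, h2, h3, h4⟩ | ⟨h4, h1, h2, h3⟩ | ⟨h1, h2, h3⟩⟩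
  · refine ⟨by omega, Or.inl ⟨h3, Or.inl (by omega)⟩⟩
  · have : cc = 0 := by rw [h1, h2, e2] at hx; simpa using hx
    refine ⟨by omega, Or.inl ⟨this, Or.inl ?_⟩⟩
    clear hx pa pb pc pab pba pca pbc pcb px; omega
  · refine ⟨?_, Or.inr ⟨by omega, ?_⟩⟩
    · clear hx pa pb pc pab pba pbc pac pca px; omega
    · clear hx pa pb pc pba pbc pac pca px; omega
  · have q1 : cc % 2 = 0 := by clear hx pa pb pc pab pba pbc pac pcb px; omega
    refine ⟨q1, Or.inr ⟨h1, ?_⟩⟩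
    clear hx pa pb pc pab pbc pac pca pcb; omega
  · have q1 : cc % 2 = 0 := by clear hx pa pb pc pab pba pbc pac pcb px; omega
    refine ⟨q1, Or.inr ⟨h4, ?_⟩⟩
    clear hx pb pc pab pba pbc pac pca pcb px; omega
  · refine ⟨by clear hx pa pb pc pab pba pbc pac pca pcb px; omega, Or.inl ⟨h2, Or.inr (by clear hx pa pb pc pab pba pbc pac pca pcb px; omega)⟩⟩
  · have q2 : cc = 0 := by clear hx pa pb pc pab pba pbc pac pca pcb px; omega
    refine ⟨by omega, Or.inl ⟨q2, Or.inl ?_⟩⟩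
    clear hx pb pc pab pba pbc pac pca pcb px; omega

/-- allowed codes, odd case -/
def okL2 (dab dba dac dca dbc dcb ca cb cc : ℕ) : Bool :=
  (ca == 0 && cb == 0) || (ca == dac && cb == dbc) || (cb == dba && cc == dca) || (ca == dab && cc == dcb)

/-- odd case -/
lemma odd_L2 (ht : P.t = 1) {a b c : F} {m k : ℕ} (ha : a ≠ 0) (hb : b ≠ 0) (hc : c ≠ 0) (hab : a - b ≠ 0)
    (hca : c - a ≠ 0) (hcb : c - b ≠ 0) (vab : P.v (a - b) = m + k) (vca : P.v (c - a) = m) (vcb : P.v (c - b) = m)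
    (hm : m % 2 = 1) (hx : P.cd a ^^^ P.cd b ^^^ P.cd c = 0) :
    okL2 (P.cd (a - b)) (P.cd (b - a)) (P.cd (a - c)) (P.cd (c - a)) (P.cd (b - c)) (P.cd (c - b))
      (P.cd a) (P.cd b) (P.cd c) = true := by
  have pa := cd_par (P := P) ha
  have pb := cd_par (P := P) hb
  have pc := cd_par (P := P) hc
  have px := xor3_par hx
  simp only [okL2, Bool.and_eq_true, Bool.or_eq_true, beq_iff_eq]
  have hcases := odd_cases ht ha hb hc hab hca hcb vab vca vcb (by omega) hx
  generalize P.cd a = ca at *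
  generalize P.cd b = cb at *
  generalize P.cd c = cc at *
  generalize P.cd (a - b) = cab at *
  generalize P.cd (b - a) = cba at *
  generalize P.cd (a - c) = cac at *
  generalize P.cd (c - a) = cca at *
  generalize P.cd (b - c) = cbc at *
  generalize P.cd (c - b) = ccb at *
  generalize P.v a = va at *
  generalize P.v b = vb at *
  generalize P.v c = vc at *
  clear vab vca vcb
  clear ha hb hc hab hca hcb ht
  rcases hcases with
    ⟨h1, h2, h3⟩ | ⟨h1, h2⟩ | ⟨h1, h2⟩ | ⟨h1, h2⟩ | ⟨h0, ⟨h1, h2, h3, h4⟩ | ⟨h4, h1, h2, h3⟩ | ⟨h1, h2, h3⟩⟩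
  · simp [h1, h2]
  · simp [h1, h2]
  · simp [h1, h2]
  · simp [h1, h2]
  all_goals omega

end loc
end KZB

set_option linter.unusedSectionVars false
set_option linter.unusedVariables false
set_option linter.unusedSimpArgs false
namespace KZB

/-- computable place data -/
structure Loc (R : Type) [CommRing R] [IsDomain R] where
  pi : R
  t : ℕ
  U : UC pi t
  D : DV pi

section sel
variable {R F : Type} [CommRing R] [IsDomain R] [IsPrincipalIdealRing R] [Field F] [Algebra R F] [IsFractionRing R F]

namespace Loc
variable (L : Loc R)

/-- valuation and code -/
def vc (a : R) : Option (ℕ × ℕ) := vcR L.D.dv L.U.uc a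

/-- code -/
def c (a : R) : ℕ := match L.vc a with
  | none => 0
  | some (_, c) => c

/-- the place -/
noncomputable def P (F : Type) [Field F] [Algebra R F] [IsFractionRing R F] : Place F := mkPlace F L.U

lemma vc_spec {a : R} {k c : ℕ} (h : L.vc a = some (k, c)) :
    algebraMap R F a ≠ 0 ∧ (L.P F).v (algebraMap R F a) = k ∧ (L.P F).cd (algebraMap R F a) = c :=
  vcR_spec L.U L.D L.U.one h

lemma c_spec {a : R} (h : (L.vc a).isSome = true) :
    algebraMap R F a ≠ 0 ∧ (L.P F).cd (algebraMap R F a) = L.c a := by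
  obtain ⟨⟨k, c⟩, h⟩ := Option.isSome_iff_exists.1 h
  have h' := L.vc_spec (F := F) h
  refine ⟨h'.1, ?_⟩
  rw [h'.2.2, Loc.c, h]

lemma P_t : (L.P F).t = L.t := rfl

end Loc

/-- points on the curve, up to the square root of the product -/
structure Tw (A B w1 w2 w3 : F) : Prop where
  h1 : w1 ≠ 0
  h2 : w2 ≠ 0
  h3 : w3 ≠ 0
  hA : w1 - w2 = A
  hB : w1 - w3 = B
  sq : ∃ y, y ^ 2 = w1 * w2 * w3

lemma Tw.cd {A B w1 w2 w3 : F} (h : Tw A B w1 w2 w3) (P : Place F) : P.cd w1 ^^^ P.cd w2 ^^^ P.cd w3 = 0 := by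
  obtain ⟨y, hy⟩ := h.sq
  have hy0 : y ≠ 0 := by
    rintro rfl
    have := mul_ne_zero (mul_ne_zero h.h1 h.h2) h.h3
    rw [← hy] at this; simp at this
  rw [← P.cd_mul _ _ h.h1 h.h2, ← P.cd_mul _ _ (mul_ne_zero h.h1 h.h2) h.h3, ← hy, Place.cd_sq hy0]

/-- one arrangement -/
def okO (cab cba cac cca cbc ccb m k ca cb cc : ℕ) : Bool :=
  if m % 2 = 1 then okL2 cab cba cac cca cbc ccb ca cb cc else if 1 ≤ k then okL1 cca k ca cc else true

lemma okO_spec {P : Place F} (ht : P.t = 1) {a b c : F} {m k : ℕ} (ha : a ≠ 0) (hb : b ≠ 0) (hc : c ≠ 0) (hab : a - b ≠ 0)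
    (hca : c - a ≠ 0) (hcb : c - b ≠ 0) (vab : P.v (a - b) = m + k) (vca : P.v (c - a) = m) (vcb : P.v (c - b) = m)
    (hx : P.cd a ^^^ P.cd b ^^^ P.cd c = 0) :
    okO (P.cd (a - b)) (P.cd (b - a)) (P.cd (a - c)) (P.cd (c - a)) (P.cd (b - c)) (P.cd (c - b)) m k
      (P.cd a) (P.cd b) (P.cd c) = true := by
  unfold okO
  split
  · exact odd_L2 ht ha hb hc hab hca hcb vab vca vcb (by assumption) hx
  · split
    · exact odd_L1 ht ha hb hc hab hca hcb vab vca vcb (by omega) (by assumption) hx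
    · rfl

/-- local conditions at odd primes -/
def okOdd (vA cA vB cB vD cD cm c1 c2 : ℕ) : Bool :=
  if vB = vD ∧ vB ≤ vA then
    okO cA (cm ^^^ cA) cB (cm ^^^ cB) cD (cm ^^^ cD) vB (vA - vB) c1 c2 (c1 ^^^ c2)
  else if vA = vD ∧ vA ≤ vB then
    okO cB (cm ^^^ cB) cA (cm ^^^ cA) (cm ^^^ cD) cD vA (vB - vA) c1 (c1 ^^^ c2) c2
  else if vA = vB ∧ vA ≤ vD then
    okO cD (cm ^^^ cD) (cm ^^^ cA) cA (cm ^^^ cB) cB vA (vD - vA) c2 (c1 ^^^ c2) c1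
  else true

lemma cd_neg (P : Place F) {x : F} (hx : x ≠ 0) : P.cd (-x) = P.cd (-1) ^^^ P.cd x := by
  rw [← P.cd_mul _ _ (by simp) hx]; simp

lemma xor3_swap {a b c : ℕ} (h : a ^^^ b ^^^ c = 0) : a ^^^ c ^^^ b = 0 := by
  rw [Nat.xor_assoc, Nat.xor_comm c, ← Nat.xor_assoc, h]
lemma xor3_rot {a b c : ℕ} (h : a ^^^ b ^^^ c = 0) : b ^^^ c ^^^ a = 0 := by
  rw [Nat.xor_comm, ← Nat.xor_assoc, h]

/-- row validity check at an odd prime -/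
def rowOdd (L : Loc R) (A B : R) (μs : List ℕ) : Bool :=
  L.t == 1 && match L.vc A, L.vc B, L.vc (B - A), L.vc (-1) with
  | some (vA, cA), some (vB, cB), some (vD, cD), some (_, cm) =>
    (List.range 16).all fun c1 => (List.range 16).all fun c2 =>
      !(okOdd vA cA vB cB vD cD cm c1 c2) || μs.all fun μ => !(lin μ c1 c2)
  | _, _, _, _ => false

/-- the rows hold for all points -/
def RowFact (F : Type) [Field F] [Algebra R F] [IsFractionRing R F] (L : Loc R) (A B : R) (μs : List ℕ) : Prop :=
  ∀ w1 w2 w3 : F, Tw (algebraMap R F A) (algebraMap R F B) w1 w2 w3 →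
    ∀ μ ∈ μs, lin μ ((L.P F).cd w1) ((L.P F).cd w2) = false

lemma rowOdd_spec {L : Loc R} {A B : R} {μs : List ℕ} (h : rowOdd L A B μs = true) : RowFact F L A B μs := by
  intro w1 w2 w3 T μ hμ
  unfold rowOdd at h
  rw [Bool.and_eq_true] at h
  obtain ⟨ht, h⟩ := h
  have ht' : (L.P F).t = 1 := by
    have : L.t = 1 := by simpa using ht
    show ((L.t : ℕ) : ℤ) = 1
    rw [this]; rfl
  split at h
  swap
  · simp at h
  rename_i vA cA vB cB vD cD vm cm hA hB hD hm
  obtain ⟨a0, av, ac⟩ := L.vc_spec (F := F) hA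
  obtain ⟨b0, bv, bc⟩ := L.vc_spec (F := F) hB
  obtain ⟨d0, dv, dc⟩ := L.vc_spec (F := F) hD
  obtain ⟨m0, mv, mc⟩ := L.vc_spec (F := F) hm
  simp only [List.all_eq_true, List.mem_range] at h
  have key := h _ ((L.P F).cd_lt w1) _ ((L.P F).cd_lt w2)
  suffices hh : okOdd vA cA vB cB vD cD cm ((L.P F).cd w1) ((L.P F).cd w2) = true by
    rw [hh] at key
    simp at key
    exact key μ hμ
  have hx := T.cd (L.P F)
  have e3 := xor3_eq hx
  have eA := T.hA
  have eB := T.hB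
  have eD : w2 - w3 = algebraMap R F (B - A) := by rw [map_sub, ← eA, ← eB]; ring
  have eA' : w2 - w1 = - algebraMap R F A := by rw [← eA]; ring
  have eB' : w3 - w1 = - algebraMap R F B := by rw [← eB]; ring
  have eD' : w3 - w2 = - algebraMap R F (B - A) := by rw [← eD]; ring
  rw [map_neg, map_one] at mc
  have nA := cd_neg (L.P F) a0
  have nB := cd_neg (L.P F) b0
  have nD := cd_neg (L.P F) d0
  rw [mc, ac] at nA
  rw [mc, bc] at nB
  rw [mc, dc] at nD
  have vA' := (L.P F).v_neg (algebraMap R F A)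
  have vB' := (L.P F).v_neg (algebraMap R F B)
  have vD' := (L.P F).v_neg (algebraMap R F (B - A))
  unfold okOdd
  split_ifs with c1 c2 c3
  · have := okO_spec (P := L.P F) ht' (a := w1) (b := w2) (c := w3) (m := vB) (k := vA - vB) T.h1 T.h2 T.h3
      (by rwa [eA]) (by rw [eB']; exact neg_ne_zero.2 b0) (by rw [eD']; exact neg_ne_zero.2 d0)
      (by rw [eA, av]; omega) (by rw [eB', vB', bv]) (by rw [eD', vD', dv, c1.1]) hx
    rwa [eA, eA', eB, eB', eD, eD', ac, bc, dc, nA, nB, nD, e3] at this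
  · have := okO_spec (P := L.P F) ht' (a := w1) (b := w3) (c := w2) (m := vA) (k := vB - vA) T.h1 T.h3 T.h2
      (by rwa [eB]) (by rw [eA']; exact neg_ne_zero.2 a0) (by rwa [eD])
      (by rw [eB, bv]; omega) (by rw [eA', vA', av]) (by rw [eD, dv, c2.1]) (xor3_swap hx)
    rwa [eA, eA', eB, eB', eD, eD', ac, bc, dc, nA, nB, nD, e3] at this
  · have := okO_spec (P := L.P F) ht' (a := w2) (b := w3) (c := w1) (m := vA) (k := vD - vA) T.h2 T.h3 T.h1
      (by rwa [eD]) (by rwa [eA]) (by rwa [eB])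
      (by rw [eD, dv]; omega) (by rw [eA, av]) (by rw [eB, bv, c3.1]) (xor3_rot hx)
    rwa [eA, eA', eB, eB', eD, eD', ac, bc, dc, nA, nB, nD, e3] at this
  · rfl

/-! ### masks -/

/-- row mask -/
def mk (f : ℕ → Bool) (L : Loc R) : List R → ℕ → ℕ
  | [], _ => 0
  | g :: G, i => (if f (L.c g) then 2 ^ i else 0) ^^^ mk f L G (i + 1)

lemma dot_mk {L : Loc R} {f : ℕ → Bool} (f0 : f 0 = false) (hf : ∀ a b, f (a ^^^ b) = (f a ^^ f b)) {G : List R}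
    (hG : ∀ g ∈ G, (L.vc g).isSome = true) {n : ℕ} (X : ℕ → Bool) (i : ℕ) (hi : i + G.length ≤ n) :
    dot n (mk f L G i) X = f ((L.P F).cd (algebraMap R F (gp G i X))) := by
  induction G generalizing i with
  | nil => simp [mk, gp, dot_zero, Place.cd_one, f0]
  | cons g G ih =>
    simp only [List.length_cons] at hi
    have hg0 : ∀ g ∈ G, g ≠ 0 := by
      intro g hg h0
      have := (L.c_spec (F := F) (hG g (List.mem_cons_of_mem _ hg))).1
      rw [h0] at this; simp at this
    have h1 := L.c_spec (F := F) (hG g List.mem_cons_self)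
    have h2 := am_ne (F := F) (gp_ne_zero hg0 (i + 1) X)
    rw [mk, gp, dot_xor, ih (fun g hg => hG g (List.mem_cons_of_mem _ hg)) (i + 1) (by omega), map_mul]
    have hi' : i < n := by omega
    cases hX : X i
    · simp only [Bool.false_eq_true, if_false, map_one, one_mul]
      split <;> simp [dot_two_pow, hX, dot_zero]
    · simp only [if_true]
      rw [(L.P F).cd_mul _ _ h1.1 h2, hf, h1.2]
      congr 1
      split <;> simp_all [dot_two_pow, dot_zero]

lemma lin0 (μ : ℕ) : lin μ 0 0 = false := by simp [lin, p4]

/-- full row mask -/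
def mask (L : Loc R) (G : List R) (μ : ℕ) : ℕ :=
  mk (fun c => lin μ c 0) L G 0 ^^^ mk (fun c => lin μ 0 c) L G G.length

lemma dot_mask {L : Loc R} (μ : ℕ) {G : List R} (hG : ∀ g ∈ G, (L.vc g).isSome = true) (X : ℕ → Bool) {w1 w2 b1 b2 : F}
    (hb1 : b1 ≠ 0) (hb2 : b2 ≠ 0) (h1 : w1 = algebraMap R F (gp G 0 X) * b1 ^ 2)
    (h2 : w2 = algebraMap R F (gp G G.length X) * b2 ^ 2) :
    dot (2 * G.length) (mask L G μ) X = lin μ ((L.P F).cd w1) ((L.P F).cd w2) := by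
  have hg0 : ∀ g ∈ G, g ≠ 0 := by
    intro g hg h0
    have := (L.c_spec (F := F) (hG g hg)).1
    rw [h0] at this; simp at this
  rw [h1, h2, Place.cd_mul_sq (am_ne (gp_ne_zero hg0 _ _)) hb1, Place.cd_mul_sq (am_ne (gp_ne_zero hg0 _ _)) hb2,
    mask, dot_xor, dot_mk (F := F) (f := fun c => lin μ c 0) (lin0 μ) (by intro a b; simpa using lin_xor μ a 0 b 0) hG X 0 (by omega),
    dot_mk (F := F) (f := fun c => lin μ 0 c) (lin0 μ) (by intro a b; simpa using lin_xor μ 0 a 0 b) hG X _ (by omega), ← lin_xor]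
  simp

/-! ### primes outside -/

/-- remove the factors -/
def stripAll : List (Loc R) → R → Option R
  | [], a => some a
  | L :: l, a => match strip L.D.dv 64 a with
    | none => none
    | some (_, u) => stripAll l u

lemma stripAll_spec {q : R} (hq : Prime q) : ∀ (l : List (Loc R)) (a u : R), stripAll l a = some u → q ∣ a →
    q ∣ u ∨ ∃ L ∈ l, q ∣ L.pi := by
  intro l
  induction l with
  | nil => intro a u h hd; simp [stripAll] at h; left; rwa [← h]
  | cons L l ih =>
    intro a u h hd
    rw [stripAll] at h
    split at h
    · simp at h
    · rename_i k v hs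
      obtain ⟨h1, h2⟩ := strip_spec L.D _ _ _ _ hs
      rw [h2] at hd
      rcases hq.dvd_or_dvd hd with h3 | h3
      · right; exact ⟨L, List.mem_cons_self, hq.dvd_of_dvd_pow h3⟩
      · rcases ih v u h h3 with h4 | ⟨L', hL', h4⟩
        · exact Or.inl h4
        · exact Or.inr ⟨L', List.mem_cons_of_mem _ hL', h4⟩

lemma outside {q A B : R} (hq : Prime q) {w1 w2 w3 : F} (T : Tw (algebraMap R F A) (algebraMap R F B) w1 w2 w3)
    (hA : ¬ q ∣ A) (hB : ¬ q ∣ B) (hD : ¬ q ∣ B - A) :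
    (mkPlace F (UC.triv hq)).v w1 % 2 = 0 ∧ (mkPlace F (UC.triv hq)).v w2 % 2 = 0 := by
  have eA := T.hA
  have eB := T.hB
  have eD' : w3 - w2 = - algebraMap R F (B - A) := by rw [map_sub, ← eA, ← eB]; ring
  have eB' : w3 - w1 = - algebraMap R F B := by rw [← eB]; ring
  have h := odd_L0 (P := mkPlace F (UC.triv hq)) (a := w1) (b := w2) (c := w3) (m := 0) rfl T.h1 T.h2 T.h3
    (by rw [eA]; exact am_ne (ne_of_nd hA)) (by rw [eB']; exact neg_ne_zero.2 (am_ne (ne_of_nd hB)))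
    (by rw [eD']; exact neg_ne_zero.2 (am_ne (ne_of_nd hD)))
    (by rw [eA]; exact v_triv_zero hq hA) (by rw [eB', Place.v_neg]; exact v_triv_zero hq hB)
    (by rw [eD', Place.v_neg]; exact v_triv_zero hq hD) rfl (T.cd _)
  exact ⟨h.1, h.2.1⟩

/-- square classes of points -/
lemma sel_exists {A B : R} {Us : List R} (hU : UnitGen Us) {Ls : List (Loc R)} {u1 : R}
    (hs : stripAll Ls (A * B * (B - A)) = some u1) (hu : IsUnit u1) {w1 w2 w3 : F}
    (T : Tw (algebraMap R F A) (algebraMap R F B) w1 w2 w3) :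
    ∃ (X : ℕ → Bool) (b1 b2 : F), b1 ≠ 0 ∧ b2 ≠ 0 ∧ w1 = algebraMap R F (gp (Us ++ Ls.map Loc.pi) 0 X) * b1 ^ 2 ∧
      w2 = algebraMap R F (gp (Us ++ Ls.map Loc.pi) (Us ++ Ls.map Loc.pi).length X) * b2 ^ 2 := by
  have hS : ∀ g ∈ Ls.map Loc.pi, Prime g := by
    intro g hg
    obtain ⟨L, _, rfl⟩ := List.mem_map.1 hg
    exact L.U.prime
  have hout : ∀ (q : R) (hq : Prime q), (∀ g ∈ Ls.map Loc.pi, ¬ q ∣ g) →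
      (mkPlace F (UC.triv hq)).v w1 % 2 = 0 ∧ (mkPlace F (UC.triv hq)).v w2 % 2 = 0 := by
    intro q hq hg
    have hn : ¬ q ∣ A * B * (B - A) := by
      intro hd
      rcases stripAll_spec hq _ _ _ hs hd with h | ⟨L, hL, h⟩
      · exact hq.not_isUnit (isUnit_of_dvd_unit h hu)
      · exact hg _ (List.mem_map_of_mem hL) h
    exact outside hq T (fun h => hn ((h.mul_right _).mul_right _)) (fun h => hn ((h.mul_left _).mul_right _))
      (fun h => hn (h.mul_left _))
  obtain ⟨X, b1, hb1, e1⟩ := sunit_F hU hS w1 T.h1 (fun q hq hg => (hout q hq hg).1) 0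
  obtain ⟨Y, b2, hb2, e2⟩ := sunit_F hU hS w2 T.h2 (fun q hq hg => (hout q hq hg).2) (Us ++ Ls.map Loc.pi).length
  refine ⟨fun k => if k < (Us ++ Ls.map Loc.pi).length then X k else Y k, b1, b2, hb1, hb2, ?_, ?_⟩
  · rw [e1]; congr 2
    apply gp_congr
    intro k hk
    simp only [zero_add]; rw [if_pos hk]
  · rw [e2]; congr 2
    apply gp_congr
    intro k hk
    rw [if_neg (by omega)]

end sel
end KZB

set_option linter.unusedSectionVars false
set_option linter.unusedVariables false
set_option linter.unusedSimpArgs false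
namespace KZB
section tree
variable {R F : Type} [CommRing R] [IsDomain R] [IsPrincipalIdealRing R] [Field F] [Algebra R F] [IsFractionRing R F]

lemma strip_none {π : R} (D : DV π) : ∀ (n : ℕ) (a : R), strip D.dv n a = none → π ^ n ∣ a := by
  intro n
  induction n with
  | zero => intro a _; simp
  | succ n ih =>
    intro a h
    rw [strip] at h
    split at h
    · simp at h
    · rename_i b h0
      split at h
      · rename_i h1
        rw [D.some_spec _ _ h0, pow_succ, mul_comm]
        exact mul_dvd_mul_left _ (ih _ h1)
      · simp at h

lemma strip_lt {π : R} (D : DV π) : ∀ (n : ℕ) (a : R) (k : ℕ) (u : R), strip D.dv n a = some (k, u) → k < n := by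
  intro n
  induction n with
  | zero => intro a k u h; simp [strip] at h
  | succ n ih =>
    intro a k u h
    rw [strip] at h
    split at h
    · simp only [Option.some.injEq, Prod.mk.injEq] at h; omega
    · split at h
      · simp at h
      · rename_i k' u' h1
        simp only [Option.some.injEq, Prod.mk.injEq] at h
        have := ih _ _ _ h1
        omega

lemma strip_vc (F : Type) [Field F] [Algebra R F] [IsFractionRing R F] {L : Loc R} {n : ℕ} {a : R} {k : ℕ} {u : R} (h : strip L.D.dv n a = some (k, u)) :
    algebraMap R F a ≠ 0 ∧ (L.P F).v (algebraMap R F a) = k ∧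
      (L.P F).cd (algebraMap R F a) = (k % 2) ^^^ L.U.uc u := by
  obtain ⟨h2, h3⟩ := strip_spec L.D _ _ _ _ h
  have hp1 : ¬ L.pi ∣ (1 : R) := fun hd => L.U.prime.not_isUnit (isUnit_of_dvd_one hd)
  have hr : PRep L.pi (algebraMap R F a) (k : ℤ) u 1 := ⟨h2, hp1, by rw [h3]; simp⟩
  refine ⟨am_ne ?_, vv_rep L.U.prime hr, ?_⟩
  · rw [h3]; exact mul_ne_zero (pow_ne_zero _ L.U.prime.ne_zero) (ne_of_nd h2)
  · show cc L.U _ = _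
    rw [cc_rep L.U hr, L.U.one, Nat.xor_zero]
    congr 1
    unfold bp
    split <;> omega

/-- two residue classes -/
def Loc.Dig (L : Loc R) : Prop := ∀ a b : R, ¬ L.pi ∣ a → ¬ L.pi ∣ b → L.pi ∣ a - b

/-- binary tree of balls -/
def tree (π : R) (leaf : R → ℕ → Bool) : ℕ → R → R → ℕ → Bool
  | 0, _, _, _ => false
  | f + 1, x, pn, n => leaf x n || (tree π leaf f x (pn * π) (n + 1) && tree π leaf f (x + pn) (pn * π) (n + 1))

lemma tree_spec {L : Loc R} (hd : L.Dig) {leaf : R → ℕ → Bool} {G : F → Prop}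
    (hl : ∀ x n w, leaf x n = true → (L.P F).ge (w - algebraMap R F x) n → G w) :
    ∀ (f : ℕ) (x : R) (n : ℕ), tree L.pi leaf f x (L.pi ^ n) n = true →
      ∀ w, (L.P F).ge (w - algebraMap R F x) n → G w := by
  intro f
  induction f with
  | zero => intro x n h; simp [tree] at h
  | succ f ih =>
    intro x n h w hw
    rw [tree, Bool.or_eq_true, Bool.and_eq_true, ← pow_succ] at h
    rcases h with h | ⟨h1, h2⟩
    · exact hl _ _ _ h hw
    · rcases digit L.U hd hw with h3 | h3
      · exact ih _ _ h1 _ h3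
      · exact ih _ _ h2 _ h3

lemma tree_root {L : Loc R} (hd : L.Dig) {leaf : R → ℕ → Bool} {G : F → Prop}
    (hl : ∀ x n w, leaf x n = true → (L.P F).ge (w - algebraMap R F x) n → G w) {f : ℕ}
    (h : tree L.pi leaf f 0 1 0 = true) (w : F) (hw : (L.P F).ge w 0) : G w :=
  tree_spec hd hl f 0 0 (by simpa using h) w (by simpa using hw)

/-- code of the ball if determined -/
def bcode (L : Loc R) (r : R) (n : ℕ) : Option ℕ := match strip L.D.dv (n + 1 - L.t) r with
  | none => none
  | some (k, u) => some ((k % 2) ^^^ L.U.uc u)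

lemma bcode_spec {L : Loc R} {r : R} {n c : ℕ} (h : bcode L r n = some c) {w : F}
    (hw : (L.P F).ge (w - algebraMap R F r) n) : (L.P F).cd w = c := by
  unfold bcode at h
  split at h
  · simp at h
  · rename_i k u hs
    simp only [Option.some.injEq] at h
    have h1 := strip_lt L.D _ _ _ _ hs
    obtain ⟨h2, h3, h4⟩ := strip_vc F hs
    rw [← h, ← h4]
    refine (Place.cd_close h2 (Place.ge_mono hw ?_)).2
    rw [h3, L.P_t]; omega

/-- all functionals vanish -/
def okμ (μs : List ℕ) (a b : ℕ) : Bool := μs.all fun μ => !(lin μ a b)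

/-- leaf of the local tree -/
def selLeaf (L : Loc R) (A B : R) (μs : List ℕ) (x : R) (n : ℕ) : Bool :=
  match bcode L x n, bcode L (x - A) n, bcode L (x - B) n with
  | some a, some b, some c => !(a ^^^ b ^^^ c == 0) || okμ μs a b
  | some a, some b, none => okμ μs a b
  | some a, none, some c => okμ μs a (a ^^^ c)
  | none, some b, some c => okμ μs (b ^^^ c) b
  | _, _, _ => false

lemma selLeaf_spec {L : Loc R} {A B : R} {μs : List ℕ} {x : R} {n : ℕ} (h : selLeaf L A B μs x n = true) {w1 w2 w3 : F}
    (T : Tw (algebraMap R F A) (algebraMap R F B) w1 w2 w3) (hw : (L.P F).ge (w1 - algebraMap R F x) n) :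
    okμ μs ((L.P F).cd w1) ((L.P F).cd w2) = true := by
  have hx := T.cd (L.P F)
  have g2 : (L.P F).ge (w2 - algebraMap R F (x - A)) n := by
    have : w2 - algebraMap R F (x - A) = w1 - algebraMap R F x := by rw [map_sub, ← T.hA]; ring
    rwa [this]
  have g3 : (L.P F).ge (w3 - algebraMap R F (x - B)) n := by
    have : w3 - algebraMap R F (x - B) = w1 - algebraMap R F x := by rw [map_sub, ← T.hB]; ring
    rwa [this]
  unfold selLeaf at h
  split at h
  · rename_i a b c ha hb hc
    rw [bcode_spec ha hw, bcode_spec hb g2] at *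
    rw [bcode_spec hc g3] at hx
    simpa [hx] using h
  · rename_i a b ha hb hc
    rw [bcode_spec ha hw, bcode_spec hb g2] at *
    exact h
  · rename_i a c ha hb hc
    rw [bcode_spec ha hw, bcode_spec hc g3] at *
    rwa [xor3_eq (xor3_swap hx)]
  · rename_i b c ha hb hc
    rw [bcode_spec hb g2, bcode_spec hc g3] at *
    rwa [xor3_eq (xor3_rot hx)]
  · simp at h

lemma Tw.scale {A B w1 w2 w3 s : F} (T : Tw A B w1 w2 w3) (hs : s ≠ 0) :
    Tw (s ^ 2 * A) (s ^ 2 * B) (s ^ 2 * w1) (s ^ 2 * w2) (s ^ 2 * w3) := by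
  have h := pow_ne_zero 2 hs
  obtain ⟨y, hy⟩ := T.sq
  exact ⟨mul_ne_zero h T.h1, mul_ne_zero h T.h2, mul_ne_zero h T.h3, by rw [← T.hA]; ring, by rw [← T.hB]; ring,
    s ^ 3 * y, by rw [mul_pow, hy]; ring⟩

/-- row check at places over 2 -/
def rowTwo (L : Loc R) (A B : R) (μs : List ℕ) (κ : ℕ) : Bool :=
  decide (L.t ≤ 2 * κ + 1) && tree L.pi (selLeaf L ((L.pi ^ κ) ^ 2 * A) ((L.pi ^ κ) ^ 2 * B) μs) 64 0 1 0

lemma rowTwo_spec {L : Loc R} (hd : L.Dig) {A B : R} {μs : List ℕ} {κ : ℕ} (h : rowTwo L A B μs κ = true) :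
    RowFact F L A B μs := by
  intro w1 w2 w3 T μ hμ
  unfold rowTwo at h
  rw [Bool.and_eq_true, decide_eq_true_iff] at h
  obtain ⟨ht, h⟩ := h
  have hp : algebraMap R F (L.pi ^ κ) ≠ 0 := am_ne (pow_ne_zero _ L.U.prime.ne_zero)
  have T' := T.scale hp
  rw [← map_pow, ← map_mul, ← map_mul] at T'
  set s := algebraMap R F ((L.pi ^ κ) ^ 2) with hs
  have hs0 : s ≠ 0 := am_ne (pow_ne_zero _ (pow_ne_zero _ L.U.prime.ne_zero))
  have hsc : (L.P F).cd s = 0 := by rw [hs, map_pow]; exact Place.cd_sq hp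
  have hvs : (L.P F).v s = 2 * κ := by
    have hpi : algebraMap R F L.pi ≠ 0 := am_ne L.U.prime.ne_zero
    rw [hs, ← pow_mul, map_pow, Place.v_pow _ _ hpi]
    have : (L.P F).v (algebraMap R F L.pi) = 1 := v_pi L.U
    rw [this]; push_cast; ring
  have e1 : (L.P F).cd (s * w1) = (L.P F).cd w1 := by rw [(L.P F).cd_mul _ _ hs0 T.h1, hsc, Nat.zero_xor]
  have e2 : (L.P F).cd (s * w2) = (L.P F).cd w2 := by rw [(L.P F).cd_mul _ _ hs0 T.h2, hsc, Nat.zero_xor]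
  have e3 : (L.P F).cd (s * w3) = (L.P F).cd w3 := by rw [(L.P F).cd_mul _ _ hs0 T.h3, hsc, Nat.zero_xor]
  rw [← e1, ← e2]
  by_cases hv : 0 ≤ (L.P F).v (s * w1)
  · have : okμ μs ((L.P F).cd (s * w1)) ((L.P F).cd (s * w2)) = true := by
      refine tree_root (F := F) hd (G := fun w => ∀ w2 w3, Tw _ _ w w2 w3 → okμ μs ((L.P F).cd w) ((L.P F).cd w2) = true) ?_ h
        (s * w1) (Or.inr hv) _ _ T'
      intro x n w hl hw w2 w3 T
      exact selLeaf_spec hl T hw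
    simp [okμ] at this
    exact this μ hμ
  · have hz : ∀ a : R, (L.P F).ge (s * algebraMap R F a) ((L.P F).v (s * w1) + (L.P F).t) := by
      intro a
      have := Place.ge_mul (P := L.P F) (Or.inr hvs.ge : (L.P F).ge s (2 * κ)) (ge_algebraMap L.U a : (L.P F).ge _ 0)
      refine Place.ge_mono this ?_
      rw [L.P_t]; omega
    have q2 : (L.P F).cd (s * w2) = (L.P F).cd (s * w1) := by
      refine (Place.cd_close T'.h1 ?_).2
      have : s * w2 - s * w1 = - (s * algebraMap R F A) := by rw [← T.hA]; ring
      rw [this]; exact Place.ge_neg (hz A)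
    have q3 : (L.P F).cd (s * w3) = (L.P F).cd (s * w1) := by
      refine (Place.cd_close T'.h1 ?_).2
      have : s * w3 - s * w1 = - (s * algebraMap R F B) := by rw [← T.hB]; ring
      rw [this]; exact Place.ge_neg (hz B)
    have hx := T'.cd (L.P F)
    rw [q2, q3] at hx
    simp at hx
    rw [q2, hx, lin0]

/-! ### bounds for `s` -/

/-- truncated valuation -/
def vt (L : Loc R) (n : ℕ) (r : R) : ℕ := match strip L.D.dv n r with
  | none => n
  | some (k, _) => k

lemma ge_of_dvd {L : Loc R} {n : ℕ} {r : R} (h : L.pi ^ n ∣ r) : (L.P F).ge (algebraMap R F r) n := by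
  obtain ⟨b, rfl⟩ := h
  rw [map_mul]
  have hpi : algebraMap R F L.pi ≠ 0 := am_ne L.U.prime.ne_zero
  have h1 : (L.P F).v (algebraMap R F (L.pi ^ n)) = n := by
    rw [map_pow, Place.v_pow _ _ hpi]
    have : (L.P F).v (algebraMap R F L.pi) = 1 := v_pi L.U
    rw [this]; ring
  simpa using Place.ge_mul (P := L.P F) (Or.inr h1.ge : (L.P F).ge (algebraMap R F (L.pi ^ n)) n)
    (ge_algebraMap L.U b : (L.P F).ge _ 0)

lemma vt_spec {L : Loc R} {n : ℕ} {r : R} : vt L n r ≤ n ∧ (L.P F).ge (algebraMap R F r) (vt L n r) := by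
  unfold vt
  split
  · rename_i h
    exact ⟨le_rfl, ge_of_dvd (strip_none L.D _ _ h)⟩
  · rename_i k u h
    exact ⟨(strip_lt L.D _ _ _ _ h).le, Or.inr (strip_vc F h).2.1.ge⟩

lemma vt_ball {L : Loc R} {n : ℕ} {r : R} {w : F} (hw0 : w ≠ 0) (hw : (L.P F).ge (w - algebraMap R F r) n) :
    (vt L n r : ℤ) ≤ (L.P F).v w := by
  have h := vt_spec (F := F) (L := L) (n := n) (r := r)
  refine Place.v_of_ge ?_ hw0
  have := Place.ge_add (Place.ge_mono hw (by exact_mod_cast h.1)) h.2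
  simpa using this

lemma vt_ball_eq {L : Loc R} {n : ℕ} {r : R} {w : F} (hw0 : w ≠ 0) (hw : (L.P F).ge (w - algebraMap R F r) n)
    (hlt : vt L n r < n) : (L.P F).v w = (vt L n r : ℤ) := by
  unfold vt at *
  split at hlt
  · omega
  · rename_i k u h
    obtain ⟨h1, h2, h3⟩ := strip_vc F h
    rw [← h2]
    exact (Place.v_eq_of_close h1 (Place.ge_mono hw (by rw [h2]; omega))).2

/-- leaf: target code contradiction -/
def tgLeaf (L : Loc R) (r : R) (n : ℕ) (tg : ℕ) : Bool := match bcode L r n with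
  | none => false
  | some c => !(c == tg)

/-- leaf for the size of `s` -/
def endLeaf (L : Loc R) (A B AB : R) (v2 t1 t2 t3 : ℕ) (ex : Bool) (x : R) (n : ℕ) : Bool :=
  tgLeaf L x n t1 || tgLeaf L (x - A) n t2 || tgLeaf L (x - B) n t3 ||
  match strip L.D.dv (2 * n) (x * x - AB) with
  | none => false
  | some (num, _) => decide (num < n + v2 + vt L n x) &&
    (if ex then decide (vt L n x < n) && decide (vt L n (x - A) < n) && decide (vt L n (x - B) < n) &&
        decide (2 * num + 2 = 2 * v2 + vt L n x + vt L n (x - A) + vt L n (x - B))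
     else decide (2 * num < 2 * v2 + vt L n x + vt L n (x - A) + vt L n (x - B)))

/-- conclusion -/
def EndG (P : Place F) (w1 AB : F) (v2 : ℕ) (ex : Bool) (S : ℤ) : Prop :=
  w1 ^ 2 - AB ≠ 0 ∧ (if ex then 2 * P.v (w1 ^ 2 - AB) + 2 = 2 * v2 + S else 2 * P.v (w1 ^ 2 - AB) < 2 * v2 + S)

lemma endLeaf_spec {L : Loc R} {A B : R} {v2 t1 t2 t3 : ℕ} {ex : Bool} {x : R} {n : ℕ} (hv2 : (L.P F).v 2 = v2)
    (h20 : (2 : F) ≠ 0)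
    (h : endLeaf L A B (A * B) v2 t1 t2 t3 ex x n = true) {w1 w2 w3 : F}
    (T : Tw (algebraMap R F A) (algebraMap R F B) w1 w2 w3) (hw : (L.P F).ge (w1 - algebraMap R F x) n)
    (h1 : (L.P F).cd w1 = t1) (h2 : (L.P F).cd w2 = t2) (h3 : (L.P F).cd w3 = t3) :
    EndG (L.P F) w1 (algebraMap R F (A * B)) v2 ex ((L.P F).v w1 + (L.P F).v w2 + (L.P F).v w3) := by
  have g2 : (L.P F).ge (w2 - algebraMap R F (x - A)) n := by
    have : w2 - algebraMap R F (x - A) = w1 - algebraMap R F x := by rw [map_sub, ← T.hA]; ring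
    rwa [this]
  have g3 : (L.P F).ge (w3 - algebraMap R F (x - B)) n := by
    have : w3 - algebraMap R F (x - B) = w1 - algebraMap R F x := by rw [map_sub, ← T.hB]; ring
    rwa [this]
  have tgs : ∀ {r : R} {w : F} {tg : ℕ}, tgLeaf L r n tg = true → (L.P F).ge (w - algebraMap R F r) n →
      (L.P F).cd w = tg → False := by
    intro r w tg hl hg hc
    unfold tgLeaf at hl
    split at hl
    · simp at hl
    · rename_i c hc'
      rw [bcode_spec hc' hg] at hc
      simp [hc] at hl
  unfold endLeaf at h
  simp only [Bool.or_eq_true] at h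
  rcases h with ((h | h) | h) | h
  · exact (tgs h hw h1).elim
  · exact (tgs h g2 h2).elim
  · exact (tgs h g3 h3).elim
  split at h
  · simp at h
  rename_i num u hs
  obtain ⟨s1, s2, s3⟩ := strip_vc F hs
  have s4 := strip_lt L.D _ _ _ _ hs
  rw [Bool.and_eq_true, decide_eq_true_iff] at h
  obtain ⟨hn, h⟩ := h
  have gx := (vt_spec (F := F) (L := L) (n := n) (r := x)).2
  have key : w1 ^ 2 - algebraMap R F (A * B) ≠ 0 ∧ (L.P F).v (w1 ^ 2 - algebraMap R F (A * B)) = num := by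
    rw [← s2]
    apply Place.v_eq_of_close s1
    have e : w1 ^ 2 - algebraMap R F (A * B) - algebraMap R F (x * x - A * B) =
      (w1 - algebraMap R F x) * (2 * algebraMap R F x) + (w1 - algebraMap R F x) * (w1 - algebraMap R F x) := by
      simp only [map_sub, map_mul]; ring
    rw [e, s2]
    apply Place.ge_add
    · have := Place.ge_mul hw (Place.ge_mul (Or.inr hv2.ge : (L.P F).ge 2 v2) gx)
      exact Place.ge_mono this (by omega)
    · exact Place.ge_mono (Place.ge_mul hw hw) (by omega)
  refine ⟨key.1, ?_⟩
  rw [key.2]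
  cases ex
  · simp only [Bool.false_eq_true, if_false, decide_eq_true_iff] at h ⊢
    have b1 := vt_ball T.h1 hw
    have b2 := vt_ball T.h2 g2
    have b3 := vt_ball T.h3 g3
    omega
  · simp only [if_true, decide_eq_true_iff, Bool.and_eq_true] at h ⊢
    obtain ⟨⟨⟨l1, l2⟩, l3⟩, h⟩ := h
    have b1 := vt_ball_eq T.h1 hw l1
    have b2 := vt_ball_eq T.h2 g2 l2
    have b3 := vt_ball_eq T.h3 g3 l3
    omega

/-- end check -/
def endChk (L : Loc R) (A B : R) (v2 t1 t2 t3 : ℕ) (ex : Bool) : Bool :=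
  (match L.vc 2 with
  | none => false
  | some (k, _) => k == v2) && tree L.pi (endLeaf L A B (A * B) v2 t1 t2 t3 ex) 64 0 1 0

lemma endChk_v2 {L : Loc R} {A B : R} {v2 t1 t2 t3 : ℕ} {ex : Bool} (h : endChk L A B v2 t1 t2 t3 ex = true) :
    (2 : F) ≠ 0 ∧ (L.P F).v 2 = v2 := by
  unfold endChk at h
  rw [Bool.and_eq_true] at h
  obtain ⟨h0, h⟩ := h
  split at h0
  · simp at h0
  rename_i k c hk
  have := L.vc_spec (F := F) hk
  simp only [beq_iff_eq] at h0
  rw [map_ofNat, h0] at this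
  exact ⟨this.1, this.2.1⟩

lemma endChk_spec {L : Loc R} (hd : L.Dig) {A B : R} {v2 t1 t2 t3 : ℕ} {ex : Bool}
    (h : endChk L A B v2 t1 t2 t3 ex = true) {w1 w2 w3 : F}
    (T : Tw (algebraMap R F A) (algebraMap R F B) w1 w2 w3) (hw : 0 ≤ (L.P F).v w1)
    (h1 : (L.P F).cd w1 = t1) (h2 : (L.P F).cd w2 = t2) (h3 : (L.P F).cd w3 = t3) :
    EndG (L.P F) w1 (algebraMap R F (A * B)) v2 ex ((L.P F).v w1 + (L.P F).v w2 + (L.P F).v w3) := by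
  obtain ⟨h20, hv2⟩ := endChk_v2 (F := F) h
  unfold endChk at h
  rw [Bool.and_eq_true] at h
  refine tree_root (F := F) hd (G := fun w => ∀ w2 w3, Tw (algebraMap R F A) (algebraMap R F B) w w2 w3 → (L.P F).cd w = t1 →
    (L.P F).cd w2 = t2 → (L.P F).cd w3 = t3 →
    EndG (L.P F) w (algebraMap R F (A * B)) v2 ex ((L.P F).v w + (L.P F).v w2 + (L.P F).v w3)) ?_ h.2 w1 (Or.inr hw)
    _ _ T h1 h2 h3
  intro x n w hl hw w2 w3 T a b c
  exact endLeaf_spec hv2 h20 hl T hw a b c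

end tree
end KZB

set_option linter.unusedSectionVars false
set_option linter.unusedVariables false
set_option linter.unusedSimpArgs false
namespace KZB
section desc
variable {R F : Type} [CommRing R] [IsDomain R] [IsPrincipalIdealRing R] [Field F] [Algebra R F] [IsFractionRing R F]

/-- halved points -/
structure Ts (A B s1 s2 s3 : F) : Prop where
  hA : s1 ^ 2 - s2 ^ 2 = A
  hB : s1 ^ 2 - s3 ^ 2 = B

/-- the point attached to a triple -/
lemma Ts.tw {A B s1 s2 s3 : F} (h : Ts A B s1 s2 s3) (hA : A ≠ 0) (hB : B ≠ 0) (hD : B - A ≠ 0) :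
    Tw A B ((s1 + s2) * (s1 + s3)) ((s1 + s2) * (s2 + s3)) ((s1 + s3) * (s2 + s3)) := by
  have a1 : s1 + s2 ≠ 0 := by
    intro h0; apply hA; rw [← h.hA]; linear_combination (s1 - s2) * h0
  have a2 : s1 + s3 ≠ 0 := by
    intro h0; apply hB; rw [← h.hB]; linear_combination (s1 - s3) * h0
  have a3 : s2 + s3 ≠ 0 := by
    intro h0; apply hD; rw [← h.hB, ← h.hA]; linear_combination (s2 - s3) * h0
  refine ⟨mul_ne_zero a1 a2, mul_ne_zero a1 a3, mul_ne_zero a2 a3, ?_, ?_, (s1 + s2) * (s1 + s3) * (s2 + s3), by ring⟩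
  · rw [← h.hA]; ring
  · rw [← h.hB]; ring

/-- codes of a triple -/
noncomputable def lt3 (P : Place F) (μ : ℕ) (s1 s2 s3 : F) : Bool :=
  lin μ (P.cd ((s1 + s2) * (s1 + s3))) (P.cd ((s1 + s2) * (s2 + s3)))

lemma xor_of_eq {a b c : ℕ} (h : a ^^^ b = c) : a = b ^^^ c := by
  rw [← h, Nat.xor_comm a b, ← Nat.xor_assoc, Nat.xor_self, Nat.zero_xor]

lemma lt3_flip1 {P : Place F} {A B s1 s2 s3 : F} (h : Ts A B s1 s2 s3) (hA : A ≠ 0) (hB : B ≠ 0) (hD : B - A ≠ 0)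
    (μ : ℕ) : Ts A B s1 (-s2) (-s3) ∧
      lt3 P μ s1 (-s2) (-s3) = (lt3 P μ s1 s2 s3 ^^ lin μ (P.cd (A * B)) (P.cd (-A))) := by
  have h' : Ts A B s1 (-s2) (-s3) := ⟨by rw [← h.hA]; ring, by rw [← h.hB]; ring⟩
  refine ⟨h', ?_⟩
  have T := h.tw hA hB hD
  have T' := h'.tw hA hB hD
  have a3 : s2 + s3 ≠ 0 := right_ne_zero_of_mul T.h3
  unfold lt3
  rw [← lin_xor]
  congr 1
  · apply xor_of_eq
    rw [← P.cd_mul _ _ T'.h1 T.h1, ← h.hA, ← h.hB]; congr 1; ring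
  · apply xor_of_eq
    rw [← P.cd_mul _ _ T'.h2 T.h2, ← Place.cd_mul_sq (neg_ne_zero.2 hA) a3, ← h.hA]; congr 1; ring

lemma lt3_flip2 {P : Place F} {A B s1 s2 s3 : F} (h : Ts A B s1 s2 s3) (hA : A ≠ 0) (hB : B ≠ 0) (hD : B - A ≠ 0)
    (μ : ℕ) : Ts A B (-s1) s2 (-s3) ∧
      lt3 P μ (-s1) s2 (-s3) = (lt3 P μ s1 s2 s3 ^^ lin μ (P.cd A) (P.cd (A * (A - B)))) := by
  have h' : Ts A B (-s1) s2 (-s3) := ⟨by rw [← h.hA]; ring, by rw [← h.hB]; ring⟩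
  refine ⟨h', ?_⟩
  have T := h.tw hA hB hD
  have T' := h'.tw hA hB hD
  have a3 : s1 + s3 ≠ 0 := right_ne_zero_of_mul T.h1
  unfold lt3
  rw [← lin_xor]
  congr 1
  · apply xor_of_eq
    rw [← P.cd_mul _ _ T'.h1 T.h1, ← Place.cd_mul_sq hA a3, ← h.hA]; congr 1; ring
  · apply xor_of_eq
    rw [← P.cd_mul _ _ T'.h2 T.h2, ← h.hA, ← h.hB]; congr 1; ring

/-- all codes computable -/
def allSome (L : Loc R) (G : List R) : Bool := G.all fun g => (L.vc g).isSome

/-- check of the two functionals detecting the flips -/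
def flipChk (A B : R) (L1 : Loc R) (μ1 : ℕ) (L2 : Loc R) (μ2 : ℕ) : Bool :=
  allSome L1 [A * B, -A, A, A * (A - B)] && allSome L2 [A * B, -A, A, A * (A - B)] &&
  lin μ1 (L1.c (A * B)) (L1.c (-A)) && !(lin μ2 (L2.c (A * B)) (L2.c (-A))) &&
  !(lin μ1 (L1.c A) (L1.c (A * (A - B)))) && lin μ2 (L2.c A) (L2.c (A * (A - B)))

lemma flip_exists {A B : R} {L1 L2 : Loc R} {μ1 μ2 : ℕ} (hc : flipChk A B L1 μ1 L2 μ2 = true)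
    (hA : algebraMap R F A ≠ 0) (hB : algebraMap R F B ≠ 0) (hD : algebraMap R F B - algebraMap R F A ≠ 0)
    {s1 s2 s3 : F} (h : Ts (algebraMap R F A) (algebraMap R F B) s1 s2 s3) :
    ∃ s1' s2' s3', Ts (algebraMap R F A) (algebraMap R F B) s1' s2' s3' ∧ (s1' = s1 ∨ s1' = -s1) ∧
      lt3 (L1.P F) μ1 s1' s2' s3' = false ∧ lt3 (L2.P F) μ2 s1' s2' s3' = false := by
  simp only [flipChk, Bool.and_eq_true, allSome, List.all_cons, List.all_nil, Bool.and_true, Bool.not_eq_true'] at hc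
  obtain ⟨⟨⟨⟨⟨⟨p1, p2, p3, p4⟩, q1, q2, q3, q4⟩, e1⟩, e2⟩, e3⟩, e4⟩ := hc
  have p1 := (L1.c_spec (F := F) p1).2
  have p2 := (L1.c_spec (F := F) p2).2
  have p3 := (L1.c_spec (F := F) p3).2
  have p4 := (L1.c_spec (F := F) p4).2
  have q1 := (L2.c_spec (F := F) q1).2
  have q2 := (L2.c_spec (F := F) q2).2
  have q3 := (L2.c_spec (F := F) q3).2
  have q4 := (L2.c_spec (F := F) q4).2
  rw [← p1, ← p2] at e1
  rw [← q1, ← q2] at e2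
  rw [← p3, ← p4] at e3
  rw [← q3, ← q4] at e4
  simp only [map_mul, map_neg, map_sub] at e1 e2 e3 e4
  obtain ⟨t1, t2, t3, h', h1', h2'⟩ : ∃ t1 t2 t3, Ts (algebraMap R F A) (algebraMap R F B) t1 t2 t3 ∧
      (t1 = s1 ∨ t1 = -s1) ∧ lt3 (L1.P F) μ1 t1 t2 t3 = false := by
    cases hl : lt3 (L1.P F) μ1 s1 s2 s3
    · exact ⟨s1, s2, s3, h, Or.inl rfl, hl⟩
    · refine ⟨s1, -s2, -s3, (lt3_flip1 (P := L1.P F) h hA hB hD μ1).1, Or.inl rfl, ?_⟩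
      rw [(lt3_flip1 h hA hB hD μ1).2, hl, e1]; rfl
  cases hl : lt3 (L2.P F) μ2 t1 t2 t3
  · exact ⟨t1, t2, t3, h', h1', h2', hl⟩
  · refine ⟨-t1, t2, -t3, (lt3_flip2 (P := L1.P F) h' hA hB hD μ1).1, ?_, ?_, ?_⟩
    · rcases h1' with rfl | rfl
      · exact Or.inr rfl
      · left; simp
    · rw [(lt3_flip2 h' hA hB hD μ1).2, h2', e3]; rfl
    · rw [(lt3_flip2 h' hA hB hD μ2).2, hl, e4]; rfl

/-- all rows -/
def rowList (G : List R) (pls : List (Loc R × List ℕ)) (L1 : Loc R) (μ1 : ℕ) (L2 : Loc R) (μ2 : ℕ) : List ℕ :=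
  mask L1 G μ1 :: mask L2 G μ2 :: pls.flatMap fun p => p.2.map (mask p.1 G)

/-- Selmer certificate -/
def selChk (G : List R) (pls : List (Loc R × List ℕ)) (L1 : Loc R) (μ1 : ℕ) (L2 : Loc R) (μ2 : ℕ) (Xs j0 : ℕ)
    (cs : List ℕ) : Bool :=
  allSome L1 G && allSome L2 G && (pls.all fun p => allSome p.1 G) && decide (j0 < 2 * G.length) &&
  (cs.length == 2 * G.length) && certOK (rowList G pls L1 μ1 L2 μ2) Xs j0 0 cs

lemma allSome_spec {L : Loc R} {G : List R} (h : allSome L G = true) : ∀ g ∈ G, (L.vc g).isSome = true := by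
  simpa [allSome] using h

lemma selChk_spec {A B : R} {Us : List R} (hU : UnitGen Us) {Ls : List (Loc R)} {u1 : R}
    (hs : stripAll Ls (A * B * (B - A)) = some u1) (hu : IsUnit u1)
    {pls : List (Loc R × List ℕ)} (hp : ∀ p ∈ pls, RowFact F p.1 A B p.2) {L1 L2 : Loc R} {μ1 μ2 Xs j0 : ℕ} {cs : List ℕ}
    (hc : selChk (Us ++ Ls.map Loc.pi) pls L1 μ1 L2 μ2 Xs j0 cs = true)
    {w1 w2 w3 : F} (T : Tw (algebraMap R F A) (algebraMap R F B) w1 w2 w3)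
    (h1 : lin μ1 ((L1.P F).cd w1) ((L1.P F).cd w2) = false) (h2 : lin μ2 ((L2.P F).cd w1) ((L2.P F).cd w2) = false) :
    ∃ (b : Bool) (b1 b2 : F), b1 ≠ 0 ∧ b2 ≠ 0 ∧
      w1 = algebraMap R F (gp (Us ++ Ls.map Loc.pi) 0 fun i => Xs.testBit i && b) * b1 ^ 2 ∧
      w2 = algebraMap R F (gp (Us ++ Ls.map Loc.pi) (Us ++ Ls.map Loc.pi).length fun i => Xs.testBit i && b) * b2 ^ 2 := by
  obtain ⟨X, b1, b2, hb1, hb2, e1, e2⟩ := sel_exists hU hs hu T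
  set G := Us ++ Ls.map Loc.pi with hGdef
  simp only [selChk, Bool.and_eq_true, decide_eq_true_iff, beq_iff_eq, List.all_eq_true] at hc
  obtain ⟨⟨⟨⟨⟨c1, c2⟩, c3⟩, c4⟩, c5⟩, c6⟩ := hc
  have hr : ∀ r ∈ rowList G pls L1 μ1 L2 μ2, dot (2 * G.length) r X = false := by
    intro r hr
    simp only [rowList, List.mem_cons, List.mem_flatMap, List.mem_map] at hr
    rcases hr with rfl | rfl | ⟨p, hpp, μ, hμ, rfl⟩
    · rw [dot_mask μ1 (allSome_spec c1) X hb1 hb2 e1 e2, h1]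
    · rw [dot_mask μ2 (allSome_spec c2) X hb1 hb2 e1 e2, h2]
    · rw [dot_mask μ (allSome_spec (c3 p hpp)) X hb1 hb2 e1 e2]
      exact hp p hpp _ _ _ T μ hμ
  have hX := certOK_spec hr c4 cs 0 c6 (by omega)
  refine ⟨X j0, b1, b2, hb1, hb2, ?_, ?_⟩
  · rw [e1]; congr 2
    apply gp_congr
    intro k hk
    exact hX _ (by omega) (by omega)
  · rw [e2]; congr 2
    apply gp_congr
    intro k hk
    exact hX _ (by omega) (by omega)

/-- valuation of `s1` from `w1` -/
lemma v_s1 {P : Place F} {A B s1 s2 s3 : F} (h : Ts A B s1 s2 s3)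
    (T : Tw A B ((s1 + s2) * (s1 + s3)) ((s1 + s2) * (s2 + s3)) ((s1 + s3) * (s2 + s3))) (h2 : (2 : F) ≠ 0)
    (hn : ((s1 + s2) * (s1 + s3)) ^ 2 - A * B ≠ 0) : s1 ≠ 0 ∧
    2 * P.v s1 = 2 * P.v (((s1 + s2) * (s1 + s3)) ^ 2 - A * B) - 2 * P.v 2 -
      (P.v ((s1 + s2) * (s1 + s3)) + P.v ((s1 + s2) * (s2 + s3)) + P.v ((s1 + s3) * (s2 + s3))) := by
  have e : ((s1 + s2) * (s1 + s3)) ^ 2 - A * B = 2 * s1 * ((s1 + s2) * (s1 + s3) * (s2 + s3)) := by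
    rw [← h.hA, ← h.hB]; ring
  have a1 : s1 + s2 ≠ 0 := left_ne_zero_of_mul T.h1
  have a2 : s1 + s3 ≠ 0 := right_ne_zero_of_mul T.h1
  have a3 : s2 + s3 ≠ 0 := right_ne_zero_of_mul T.h3
  have h1 : s1 ≠ 0 := by
    rintro rfl
    apply hn; rw [e]; simp
  refine ⟨h1, ?_⟩
  rw [e]
  rw [P.v_mul _ _ (mul_ne_zero h2 h1) (mul_ne_zero (mul_ne_zero a1 a2) a3), P.v_mul _ _ h2 h1,
    P.v_mul _ _ (mul_ne_zero a1 a2) a3, P.v_mul _ _ a1 a2, P.v_mul _ _ a1 a3, P.v_mul _ _ a2 a3]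
  ring

/-- negative valuation of `w1` -/
lemma v_s1_neg {L : Loc R} {A B : R} {s1 s2 s3 : F} (h : Ts (algebraMap R F A) (algebraMap R F B) s1 s2 s3)
    (T : Tw (algebraMap R F A) (algebraMap R F B) ((s1 + s2) * (s1 + s3)) ((s1 + s2) * (s2 + s3)) ((s1 + s3) * (s2 + s3)))
    (h2 : (2 : F) ≠ 0) (hv : (L.P F).v ((s1 + s2) * (s1 + s3)) < 0) : s1 ≠ 0 ∧
    2 * (L.P F).v s1 = (L.P F).v ((s1 + s2) * (s1 + s3)) - 2 * (L.P F).v 2 ∧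
      (L.P F).v ((s1 + s2) * (s2 + s3)) = (L.P F).v ((s1 + s2) * (s1 + s3)) ∧
      (L.P F).v ((s1 + s3) * (s2 + s3)) = (L.P F).v ((s1 + s2) * (s1 + s3)) := by
  have hz : ∀ a : R, (L.P F).ge (algebraMap R F a) 0 := fun a => ge_algebraMap L.U a
  have hv2 : (L.P F).v ((s1 + s2) * (s2 + s3)) = (L.P F).v ((s1 + s2) * (s1 + s3)) := by
    refine (Place.v_eq_of_close T.h1 ?_).2
    rw [← neg_sub, T.hA]
    exact Place.ge_neg (Place.ge_mono (hz A) (by omega))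
  have hv3 : (L.P F).v ((s1 + s3) * (s2 + s3)) = (L.P F).v ((s1 + s2) * (s1 + s3)) := by
    refine (Place.v_eq_of_close T.h1 ?_).2
    rw [← neg_sub, T.hB]
    exact Place.ge_neg (Place.ge_mono (hz B) (by omega))
  have hn : ((s1 + s2) * (s1 + s3)) ^ 2 - algebraMap R F A * algebraMap R F B ≠ 0 ∧
      (L.P F).v (((s1 + s2) * (s1 + s3)) ^ 2 - algebraMap R F A * algebraMap R F B) =
      (L.P F).v (((s1 + s2) * (s1 + s3)) ^ 2) := by
    apply Place.v_eq_of_close (pow_ne_zero _ T.h1)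
    rw [sub_sub_cancel_left, ← map_mul, Place.v_pow _ _ T.h1]
    exact Place.ge_neg (Place.ge_mono (hz _) (by push_cast; omega))
  have := v_s1 (P := L.P F) h T h2 hn.1
  rw [hn.2, hv2, hv3, Place.v_pow _ _ T.h1] at this
  refine ⟨this.1, ?_, hv2, hv3⟩
  have := this.2
  push_cast at this
  omega

/-- everything for one curve -/
structure CurveOK (F : Type) [Field F] [Algebra R F] [IsFractionRing R F] (A B : R) (Us : List R) (Ls : List (Loc R))
    (Xs : ℕ) (L1 L2 : Loc R) (μ1 μ2 : ℕ) : Prop where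
  nz : A ≠ 0 ∧ B ≠ 0 ∧ B - A ≠ 0
  flip : flipChk A B L1 μ1 L2 μ2 = true
  sel : ∀ {w1 w2 w3 : F}, Tw (algebraMap R F A) (algebraMap R F B) w1 w2 w3 →
    lin μ1 ((L1.P F).cd w1) ((L1.P F).cd w2) = false → lin μ2 ((L2.P F).cd w1) ((L2.P F).cd w2) = false →
    ∃ (b : Bool) (b1 b2 : F), b1 ≠ 0 ∧ b2 ≠ 0 ∧
      w1 = algebraMap R F (gp (Us ++ Ls.map Loc.pi) 0 fun i => Xs.testBit i && b) * b1 ^ 2 ∧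
      w2 = algebraMap R F (gp (Us ++ Ls.map Loc.pi) (Us ++ Ls.map Loc.pi).length fun i => Xs.testBit i && b) * b2 ^ 2

variable {A B : R} {Us : List R} {Ls : List (Loc R)} {Xs : ℕ} {L1 L2 : Loc R} {μ1 μ2 : ℕ}

lemma CurveOK.nz' (C : CurveOK F A B Us Ls Xs L1 L2 μ1 μ2) :
    algebraMap R F A ≠ 0 ∧ algebraMap R F B ≠ 0 ∧ algebraMap R F B - algebraMap R F A ≠ 0 := by
  refine ⟨am_ne C.nz.1, am_ne C.nz.2.1, ?_⟩
  rw [← map_sub]; exact am_ne C.nz.2.2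

/-- third coordinate of a split point -/
lemma third_sq {A B w1 w2 w3 b1 b2 : F} (T : Tw A B w1 w2 w3) (h1 : w1 = b1 ^ 2) (h2 : w2 = b2 ^ 2) :
    ∃ b3, w3 = b3 ^ 2 := by
  obtain ⟨y, hy⟩ := T.sq
  have := T.h1
  have := T.h2
  refine ⟨y / (b1 * b2), ?_⟩
  rw [div_pow, hy, h1, h2]
  have : b1 ≠ 0 := by rintro rfl; simp_all
  have : b2 ≠ 0 := by rintro rfl; simp_all
  field_simp

/-- one descent step, split part -/
lemma CurveOK.step (C : CurveOK F A B Us Ls Xs L1 L2 μ1 μ2) {L : Loc R} (hd : L.Dig) {v2 : ℕ} {ex : Bool}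
    (hend : endChk L A B v2 0 0 0 ex = true) {s1 s2 s3 : F}
    (h : Ts (algebraMap R F A) (algebraMap R F B) s1 s2 s3) {b1 b2 : F} (hb1 : b1 ≠ 0) (hb2 : b2 ≠ 0)
    (e1 : (s1 + s2) * (s1 + s3) = b1 ^ 2) (e2 : (s1 + s2) * (s2 + s3) = b2 ^ 2) :
    s1 ≠ 0 ∧ ((if ex then (L.P F).v s1 = -1 else (L.P F).v s1 < 0) ∨
      ∃ σ1 σ2 σ3 : F, Ts (algebraMap R F A) (algebraMap R F B) σ1 σ2 σ3 ∧ (L.P F).v σ1 < 0 ∧ (L.P F).v s1 = (L.P F).v σ1 - v2) := by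
  obtain ⟨hA, hB, hD⟩ := C.nz'
  have T := h.tw hA hB hD
  obtain ⟨h20, hv2⟩ := endChk_v2 (F := F) hend
  obtain ⟨b3, e3⟩ := third_sq T e1 e2
  have hb3 : b3 ≠ 0 := by rintro rfl; exact T.h3 (by simpa using e3)
  by_cases hv : 0 ≤ (L.P F).v ((s1 + s2) * (s1 + s3))
  · obtain ⟨g1, g2⟩ := endChk_spec (F := F) hd hend T hv (by rw [e1, Place.cd_sq hb1]) (by rw [e2, Place.cd_sq hb2])
      (by rw [e3, Place.cd_sq hb3])
    rw [map_mul] at g1 g2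
    obtain ⟨k1, k2⟩ := v_s1 (P := L.P F) h T h20 g1
    refine ⟨k1, Or.inl ?_⟩
    cases ex
    · simp only [Bool.false_eq_true, if_false] at g2 ⊢
      omega
    · simp only [if_true] at g2 ⊢
      omega
  · obtain ⟨k1, k2, _, _⟩ := v_s1_neg (L := L) h T h20 (by omega)
    refine ⟨k1, Or.inr ⟨b1, b2, b3, ⟨?_, ?_⟩, ?_, ?_⟩⟩
    · rw [← e1, ← e2, T.hA]
    · rw [← e1, ← e3, T.hB]
    · rw [e1, Place.v_pow _ _ hb1] at hv
      push_cast at hv; omega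
    · rw [e1, Place.v_pow _ _ hb1] at k2
      push_cast at k2; omega

lemma CurveOK.flipped (C : CurveOK F A B Us Ls Xs L1 L2 μ1 μ2) {s1 s2 s3 : F}
    (h : Ts (algebraMap R F A) (algebraMap R F B) s1 s2 s3) : ∃ s1' s2' s3',
    Ts (algebraMap R F A) (algebraMap R F B) s1' s2' s3' ∧ (s1' = s1 ∨ s1' = -s1) ∧
    ∃ (b : Bool) (b1 b2 : F), b1 ≠ 0 ∧ b2 ≠ 0 ∧
      (s1' + s2') * (s1' + s3') = algebraMap R F (gp (Us ++ Ls.map Loc.pi) 0 fun i => Xs.testBit i && b) * b1 ^ 2 ∧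
      (s1' + s2') * (s2' + s3') = algebraMap R F (gp (Us ++ Ls.map Loc.pi) (Us ++ Ls.map Loc.pi).length fun i => Xs.testBit i && b) * b2 ^ 2 := by
  obtain ⟨hA, hB, hD⟩ := C.nz'
  obtain ⟨t1, t2, t3, h', hs, l1, l2⟩ := flip_exists C.flip hA hB hD h
  exact ⟨t1, t2, t3, h', hs, C.sel (h'.tw hA hB hD) l1 l2⟩

theorem CurveOK.none (C : CurveOK F A B Us Ls 0 L1 L2 μ1 μ2) {L : Loc R} (hd : L.Dig) {v2 : ℕ} (hv2 : 0 < v2)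
    (hend : endChk L A B v2 0 0 0 false = true) (s1 s2 s3 : F) : ¬ Ts (algebraMap R F A) (algebraMap R F B) s1 s2 s3 := by
  have step : ∀ s1 s2 s3 : F, Ts (algebraMap R F A) (algebraMap R F B) s1 s2 s3 → (L.P F).v s1 < 0 ∧
      (∃ σ1 σ2 σ3 : F, Ts (algebraMap R F A) (algebraMap R F B) σ1 σ2 σ3 ∧ ((L.P F).v σ1 < 0 → (L.P F).v s1 < (L.P F).v σ1)) := by
    intro s1 s2 s3 h
    obtain ⟨hA, hB, hD⟩ := C.nz'
    obtain ⟨t1, t2, t3, h', hs, b, b1, b2, hb1, hb2, e1, e2⟩ := C.flipped h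
    rw [gp_false _ _ _ (by simp), map_one, one_mul] at e1 e2
    have hvs : (L.P F).v t1 = (L.P F).v s1 := by
      rcases hs with rfl | rfl
      · rfl
      · rw [Place.v_neg]
    obtain ⟨h20, hv2'⟩ := endChk_v2 (F := F) hend
    obtain ⟨_, k | ⟨σ1, σ2, σ3, hσ, k1, k2⟩⟩ := C.step hd hend h' hb1 hb2 e1 e2
    · simp only [Bool.false_eq_true, if_false] at k
      refine ⟨by omega, ?_⟩
      have T := h'.tw hA hB hD
      obtain ⟨b3, e3⟩ := third_sq T e1 e2
      refine ⟨b1, b2, b3, ⟨by rw [← e1, ← e2, T.hA], by rw [← e1, ← e3, T.hB]⟩, ?_⟩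
      intro hn
      obtain ⟨k1, k2, _, _⟩ := v_s1_neg (L := L) h' T h20 (by rw [e1, Place.v_pow _ _ hb1]; push_cast; omega)
      rw [e1, Place.v_pow _ _ hb1] at k2
      push_cast at k2; omega
    · exact ⟨by omega, σ1, σ2, σ3, hσ, fun _ => by omega⟩
  have : ∀ n : ℕ, ∀ s1 s2 s3 : F, Ts (algebraMap R F A) (algebraMap R F B) s1 s2 s3 → (-(L.P F).v s1).toNat = n → False := by
    intro n
    induction n using Nat.strong_induction_on with
    | _ n ih =>
      intro s1 s2 s3 h hn
      obtain ⟨h1, σ1, σ2, σ3, hσ, hlt⟩ := step s1 s2 s3 h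
      have h2 := (step σ1 σ2 σ3 hσ).1
      have h3 := hlt h2
      exact ih _ (by omega) σ1 σ2 σ3 hσ rfl
  exact fun h => this _ s1 s2 s3 h rfl

/-- the curve with a point: odd valuations -/
theorem CurveOK.odd (C : CurveOK F A B Us Ls Xs L1 L2 μ1 μ2) {L : Loc R} (hd : L.Dig)
    {c1 c2 : ℕ} (hend : endChk L A B 2 0 0 0 true = true) (hend' : endChk L A B 2 c1 c2 (c1 ^^^ c2) true = true)
    (hodd : c1 % 2 = 1 ∧ c2 % 2 = 1)
    (hG : allSome L (Us ++ Ls.map Loc.pi) = true)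
    (hc1 : (L.vc (gp (Us ++ Ls.map Loc.pi) 0 fun i => Xs.testBit i)).map Prod.snd = some c1)
    (hc2 : (L.vc (gp (Us ++ Ls.map Loc.pi) (Us ++ Ls.map Loc.pi).length fun i => Xs.testBit i)).map Prod.snd = some c2)
    (s1 s2 s3 : F) (h : Ts (algebraMap R F A) (algebraMap R F B) s1 s2 s3) :
    s1 ≠ 0 ∧ (L.P F).v s1 < 0 ∧ (L.P F).v s1 % 2 = 1 := by
  have hg0 : ∀ g ∈ Us ++ Ls.map Loc.pi, g ≠ 0 := by
    intro g hg h0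
    have := (L.c_spec (F := F) (allSome_spec hG g hg)).1
    rw [h0] at this; simp at this
  have : ∀ n : ℕ, ∀ s1 s2 s3 : F, Ts (algebraMap R F A) (algebraMap R F B) s1 s2 s3 → (-(L.P F).v s1).toNat = n →
      s1 ≠ 0 ∧ (L.P F).v s1 < 0 ∧ (L.P F).v s1 % 2 = 1 := by
    intro n
    induction n using Nat.strong_induction_on with
    | _ n ih =>
      intro s1 s2 s3 h hn
      obtain ⟨hA, hB, hD⟩ := C.nz'
      obtain ⟨t1, t2, t3, h', hs, b, b1, b2, hb1, hb2, e1, e2⟩ := C.flipped h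
      have hvs : (L.P F).v t1 = (L.P F).v s1 := by
        rcases hs with rfl | rfl
        · rfl
        · rw [Place.v_neg]
      have hne : t1 ≠ 0 → s1 ≠ 0 := by
        rcases hs with rfl | rfl
        · exact id
        · intro h0 h1; apply h0; simp [h1]
      cases b
      · rw [gp_false _ _ _ (by simp), map_one, one_mul] at e1 e2
        obtain ⟨k0, k | ⟨σ1, σ2, σ3, hσ, k1, k2⟩⟩ := C.step hd hend h' hb1 hb2 e1 e2
        · simp only [if_true] at k
          exact ⟨hne k0, by omega, by omega⟩
        · have := ih _ (by omega) σ1 σ2 σ3 hσ rfl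
          exact ⟨hne k0, by omega, by omega⟩
      · simp only [Bool.and_true] at e1 e2
        have T := h'.tw hA hB hD
        have gc : ∀ {i c : ℕ}, (L.vc (gp (Us ++ Ls.map Loc.pi) i fun i => Xs.testBit i)).map Prod.snd = some c →
            (L.P F).cd (algebraMap R F (gp (Us ++ Ls.map Loc.pi) i fun i => Xs.testBit i)) = c := by
          intro i c hc
          obtain ⟨⟨k, c'⟩, hk, hk'⟩ := Option.map_eq_some_iff.1 hc
          simp only at hk'
          subst hk'
          exact (L.vc_spec (F := F) hk).2.2
        have q1 : (L.P F).cd ((t1 + t2) * (t1 + t3)) = c1 := by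
          rw [e1, Place.cd_mul_sq (am_ne (gp_ne_zero hg0 _ _)) hb1, gc hc1]
        have q2 : (L.P F).cd ((t1 + t2) * (t2 + t3)) = c2 := by
          rw [e2, Place.cd_mul_sq (am_ne (gp_ne_zero hg0 _ _)) hb2, gc hc2]
        have q3 : (L.P F).cd ((t1 + t3) * (t2 + t3)) = c1 ^^^ c2 := by
          rw [xor3_eq (T.cd (L.P F)), q1, q2]
        obtain ⟨h20, hv2'⟩ := endChk_v2 (F := F) hend
        by_cases hv : 0 ≤ (L.P F).v ((t1 + t2) * (t1 + t3))
        · obtain ⟨g1, g2⟩ := endChk_spec (F := F) hd hend' T hv q1 q2 q3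
          rw [map_mul] at g1 g2
          obtain ⟨k1, k2⟩ := v_s1 (P := L.P F) h' T h20 g1
          simp only [if_true] at g2
          exact ⟨hne k1, by omega, by omega⟩
        · exfalso
          obtain ⟨_, _, k3, k4⟩ := v_s1_neg (L := L) h' T h20 (by omega)
          have p1 := cd_par (P := L.P F) T.h1
          have p3 := cd_par (P := L.P F) T.h3
          have p4 := xor_par c1 c2
          rw [q1] at p1
          rw [q3, k4] at p3
          omega
  exact this _ s1 s2 s3 h rfl

end desc
end KZB

set_option linter.unusedSectionVars false
set_option linter.unusedVariables false
set_option linter.unusedSimpArgs false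
namespace KZB

/-! ### concrete places -/

/-- odd prime of `ℤ` -/
def lz (p : ℕ) (hp : p.Prime) (hp2 : p ≠ 2) : Loc ℤ := ⟨p, 1, ucZ p hp hp2, DVZ p⟩
/-- the prime two of `ℤ` -/
def lz2 : Loc ℤ := ⟨2, 3, ucZ2, DVZ 2⟩
lemma ok1_ne {p : ℕ} {r : ℤ} {π : C3 ℤ} (h : ok1 p r π = true) : π ≠ 0 := by
  simp [ok1] at h; exact h.2
lemma ok2_ne {p : ℕ} {e k : ℤ} {π : C3 ℤ} (h : ok2 p e k π = true) : π ≠ 0 := by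
  simp [ok2] at h; exact h.1.1.2
/-- degree one prime -/
def lk1 (p : ℕ) (r : ℤ) (π : C3 ℤ) (hp : p.Prime) (hp2 : p ≠ 2) (h : ok1 p r π = true) : Loc (C3 ℤ) :=
  ⟨π, 1, ucK1 p r π hp hp2 h, DVK π (ok1_ne h)⟩
/-- degree two prime -/
def lk2 (p : ℕ) (e k : ℤ) (π : C3 ℤ) (hp : p.Prime) (hp2 : p ≠ 2) (h : ok2 p e k π = true) : Loc (C3 ℤ) :=
  ⟨π, 1, ucK2 p e k π hp hp2 h, DVK π (ok2_ne h)⟩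
/-- inert prime -/
def lk3 (p : ℕ) (hp : p.Prime) (hp2 : p ≠ 2) (h : ok3 p = true) : Loc (C3 ℤ) :=
  ⟨⟨p, 0, 0⟩, 1, ucK3 p hp hp2 h, DVK _ (ucK3 p hp hp2 h).prime.ne_zero⟩
/-- first prime over two -/
def la : Loc (C3 ℤ) := ⟨pi1, 3, ucK2a, DVK _ ucK2a.prime.ne_zero⟩
/-- second prime over two -/
def lb : Loc (C3 ℤ) := ⟨pi2, 5, ucK2b, DVK _ ucK2b.prime.ne_zero⟩

lemma dig_lz2 : lz2.Dig := digitsZ2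
lemma dig_la : la.Dig := digitsK2a
lemma dig_lb : lb.Dig := digitsK2b

/-- place -/
abbrev z3 := lz 3 (by norm_num) (by norm_num)
/-- place -/
abbrev z7 := lz 7 (by norm_num) (by norm_num)
/-- place -/
abbrev z11 := lz 11 (by norm_num) (by norm_num)
/-- place -/
abbrev z19 := lz 19 (by norm_num) (by norm_num)
/-- place -/
abbrev z29 := lz 29 (by norm_num) (by norm_num)
/-- place -/
abbrev z41 := lz 41 (by norm_num) (by norm_num)
/-- place -/
abbrev z47 := lz 47 (by norm_num) (by norm_num)
/-- place -/
abbrev z173 := lz 173 (by norm_num) (by norm_num)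
/-- place -/
abbrev z947 := lz 947 (by norm_num) (by norm_num)
/-- place -/
def k3 := lk3 3 (by norm_num) (by norm_num) (by decide +kernel)
/-- place -/
def k11 := lk3 11 (by norm_num) (by norm_num) (by decide +kernel)
/-- place -/
def k19 := lk3 19 (by norm_num) (by norm_num) (by decide +kernel)
/-- place -/
def k41 := lk3 41 (by norm_num) (by norm_num) (by decide +kernel)
/-- place -/
def k5 := lk1 5 1 ⟨3, 1, 1⟩ (by norm_num) (by norm_num) (by decide +kernel)
/-- place -/
def k7 := lk1 7 4 ⟨1, 1, 1⟩ (by norm_num) (by norm_num) (by decide +kernel)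
/-- place -/
def k29 := lk1 29 3 ⟨5, 2, 2⟩ (by norm_num) (by norm_num) (by decide +kernel)
/-- place -/
def k47 := lk1 47 17 ⟨1, -2, -2⟩ (by norm_num) (by norm_num) (by decide +kernel)
/-- place -/
def k59a := lk1 59 17 ⟨3, 4, 2⟩ (by norm_num) (by norm_num) (by decide +kernel)
/-- place -/
def k59b := lk1 59 49 ⟨3, -2, -2⟩ (by norm_num) (by norm_num) (by decide +kernel)
/-- place -/
def k59c := lk1 59 50 ⟨5, 3, 1⟩ (by norm_num) (by norm_num) (by decide +kernel)
/-- place -/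
def k173 := lk1 173 25 ⟨3, 1, 3⟩ (by norm_num) (by norm_num) (by decide +kernel)
/-- place -/
def k461 := lk1 461 9 ⟨11, 5, 5⟩ (by norm_num) (by norm_num) (by decide +kernel)
/-- place -/
def k947 := lk1 947 934 ⟨11, 6, 6⟩ (by norm_num) (by norm_num) (by decide +kernel)
/-- place -/
def k1103 := lk1 1103 50 ⟨15, 10, 2⟩ (by norm_num) (by norm_num) (by decide +kernel)
/-- place -/
def q7 := lk2 7 6 27 ⟨-1, -1, 1⟩ (by norm_num) (by norm_num) (by decide +kernel)
/-- place -/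
def q29 := lk2 29 5 18 ⟨-7, -10, -2⟩ (by norm_num) (by norm_num) (by decide +kernel)
/-- place -/
def q47 := lk2 47 19 326 ⟨-17, -2, -10⟩ (by norm_num) (by norm_num) (by decide +kernel)
/-- place -/
def q173 := lk2 173 27 678 ⟨-9, 5, 13⟩ (by norm_num) (by norm_num) (by decide +kernel)
/-- place -/
def q461 := lk2 461 11 102 ⟨-49, -55, -5⟩ (by norm_num) (by norm_num) (by decide +kernel)
/-- place -/
def q1103 := lk2 1103 52 2603 ⟨129, -22, 42⟩ (by norm_num) (by norm_num) (by decide +kernel)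

lemma unitZ : UnitGen ([-1] : List ℤ) := by
  intro u
  rcases Int.units_eq_one_or u with rfl | rfl
  · exact ⟨fun _ => false, 1, by simp, by simp [gp]⟩
  · exact ⟨fun _ => true, 1, by simp, by simp [gp]⟩

/-- fundamental unit -/
def ep : C3 ℤ := ⟨1, -1, -1⟩

lemma unitK : UnitGen ([-1, ep] : List (C3 ℤ)) := by
  intro u
  have key : ∀ n : ℤ, ∃ (c : Bool) (β : C3 ℤ), β ≠ 0 ∧ ((C3.eps ^ n : (C3 ℤ)ˣ) : C3 ℤ) = (if c then ep else 1) * β ^ 2 := by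
    intro n
    obtain ⟨k, rfl | rfl⟩ := Int.even_or_odd' n
    · refine ⟨false, ((C3.eps ^ k : (C3 ℤ)ˣ) : C3 ℤ), Units.ne_zero _, ?_⟩
      simp only [Bool.false_eq_true, if_false, one_mul]
      rw [← Units.val_pow_eq_pow_val, ← zpow_natCast, ← zpow_mul, mul_comm]; rfl
    · refine ⟨true, ((C3.eps ^ k : (C3 ℤ)ˣ) : C3 ℤ), Units.ne_zero _, ?_⟩
      simp only [if_true]
      have : ep = ((C3.eps : (C3 ℤ)ˣ) : C3 ℤ) := rfl
      rw [this, ← Units.val_pow_eq_pow_val, ← zpow_natCast, ← zpow_mul, ← Units.val_mul, zpow_add_one, mul_comm, mul_comm k]; rfl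
  obtain ⟨n, h | h⟩ := C3.units_eq u
  · obtain ⟨c, β, hβ, e⟩ := key n
    refine ⟨fun i => if i = 1 then c else false, β, hβ, ?_⟩
    rw [h, e]; simp [gp]
  · obtain ⟨c, β, hβ, e⟩ := key n
    refine ⟨fun i => if i = 1 then c else true, β, hβ, ?_⟩
    rw [h, Units.val_neg, e]; cases c <;> simp [gp]

lemma isUnit_of_nm {u : C3 ℤ} (h : C3.nm u = 1 ∨ C3.nm u = -1) : IsUnit u := by
  have h1 := C3.mul_adj u
  rcases h with h | h
  · rw [h] at h1
    exact IsUnit.of_mul_eq_one (C3.adj u) (h1.trans rfl)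
  · rw [h] at h1
    exact IsUnit.of_mul_eq_one (-C3.adj u) (by rw [mul_neg, h1]; rfl)

end KZB

set_option linter.unusedSectionVars false
set_option linter.unusedVariables false
set_option linter.unusedSimpArgs false
namespace KZB
section
variable {R F : Type} [CommRing R] [IsDomain R] [IsPrincipalIdealRing R] [Field F] [Algebra R F] [IsFractionRing R F]
lemma rows_cons {A B : R} {L : Loc R} {μ : List ℕ} {l : List (Loc R × List ℕ)} (h : RowFact F L A B μ)
    (hl : ∀ p ∈ l, RowFact F p.1 A B p.2) : ∀ p ∈ (L, μ) :: l, RowFact F p.1 A B p.2 := by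
  intro p hp
  rcases List.mem_cons.1 hp with rfl | hp
  · exact h
  · exact hl p hp
lemma rows_odd {A B : R} {l : List (Loc R × List ℕ)} (h : (l.all fun p => rowOdd p.1 A B p.2) = true) :
    ∀ p ∈ l, RowFact F p.1 A B p.2 := by
  intro p hp
  exact rowOdd_spec (List.all_eq_true.1 h p hp)
/-- assembly of all certificates -/
lemma CurveOK.mk' {A B : R} {Us : List R} (hU : UnitGen Us) {Ls : List (Loc R)} {u1 : R}
    (hs : stripAll Ls (A * B * (B - A)) = some u1) (hu : IsUnit u1)
    {pls : List (Loc R × List ℕ)} (hp : ∀ p ∈ pls, RowFact F p.1 A B p.2) {L1 L2 : Loc R} {μ1 μ2 Xs j0 : ℕ} {cs : List ℕ}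
    (hf : flipChk A B L1 μ1 L2 μ2 = true)
    (hc : selChk (Us ++ Ls.map Loc.pi) pls L1 μ1 L2 μ2 Xs j0 cs = true)
    (nz : A ≠ 0 ∧ B ≠ 0 ∧ B - A ≠ 0) : CurveOK F A B Us Ls Xs L1 L2 μ1 μ2 :=
  ⟨nz, hf, fun T h1 h2 => selChk_spec hU hs hu hp hc T h1 h2⟩
end
lemma isUnitK_of {Ls : List (Loc (C3 ℤ))} {a : C3 ℤ}
    (h : ((stripAll Ls a).map fun u => (C3.nm u == 1 || C3.nm u == -1)) = some true) :
    ∃ u, stripAll Ls a = some u ∧ IsUnit u := by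
  obtain ⟨u, hu, h⟩ := Option.map_eq_some_iff.1 h
  refine ⟨u, hu, isUnit_of_nm ?_⟩
  simpa using h
lemma isUnitZ_of {Ls : List (Loc ℤ)} {a : ℤ}
    (h : ((stripAll Ls a).map fun u => (u == 1 || u == -1)) = some true) :
    ∃ u, stripAll Ls a = some u ∧ IsUnit u := by
  obtain ⟨u, hu, h⟩ := Option.map_eq_some_iff.1 h
  refine ⟨u, hu, Int.isUnit_iff.2 ?_⟩
  simpa using h
/-- curve -/
def AI : ℤ := 108471
/-- curve -/
def BI : ℤ := 397727
/-- places -/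
def LI : List (Loc ℤ) := [lz2, z3, z11, z19, z173]
/-- rows -/
def OI : List (Loc ℤ × List ℕ) := [(z3, [17, 34]), (z11, [48, 2]), (z19, [49, 18]), (z173, [48])]
lemma oddI : (OI.all fun p => rowOdd p.1 AI BI p.2) = true := by decide +kernel
lemma twoIlz2 : rowTwo lz2 AI BI [1, 22, 36] 1 = true := by decide +kernel
lemma stripI : ((stripAll LI (AI * BI * (BI - AI))).map fun u => (u == 1 || u == -1)) = some true := by decide +kernel
lemma flipI : flipChk AI BI z3 32 lz2 2 = true := by decide +kernel
lemma selI : selChk (([-1] : List ℤ) ++ LI.map Loc.pi) ((lz2, [1, 22, 36]) :: OI) z3 32 lz2 2 0 0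
    [2804, 4, 2999, 3959, 3638, 1478, 791, 3898, 2967, 1825, 129, 2829] = true := by decide +kernel
lemma curveI : CurveOK ℚ AI BI ([-1] : List ℤ) LI 0 z3 lz2 32 2 := by
  obtain ⟨u, hs, hu⟩ := isUnitZ_of stripI
  exact CurveOK.mk' unitZ hs hu (rows_cons (rowTwo_spec dig_lz2 twoIlz2) (rows_odd oddI)) flipI selI (by decide +kernel)
lemma endI : endChk lz2 AI BI 1 0 0 0 false = true := by decide +kernel
theorem noneI (s1 s2 s3 : ℚ) : ¬ Ts (algebraMap ℤ ℚ AI) (algebraMap ℤ ℚ BI) s1 s2 s3 :=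
  curveI.none dig_lz2 (by norm_num) endI s1 s2 s3
/-- curve -/
def AT : ℤ := (-42990673)
/-- curve -/
def BT : ℤ := 6291318
/-- places -/
def LT : List (Loc ℤ) := [lz2, z3, z11, z19, z29, z41, z47, z173]
/-- rows -/
def OT : List (Loc ℤ × List ℕ) := [(z3, [16, 32]), (z11, [33, 50]), (z19, [49, 2]), (z29, [48, 19]), (z41, [17, 34]), (z47, [1, 18]), (z173, [32])]
lemma oddT : (OT.all fun p => rowOdd p.1 AT BT p.2) = true := by decide +kernel
lemma twoTlz2 : rowTwo lz2 AT BT [16, 34, 64] 1 = true := by decide +kernel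
lemma stripT : ((stripAll LT (AT * BT * (BT - AT))).map fun u => (u == 1 || u == -1)) = some true := by decide +kernel
lemma flipT : flipChk AT BT lz2 1 lz2 2 = true := by decide +kernel
lemma selT : selChk (([-1] : List ℤ) ++ LT.map Loc.pi) ((lz2, [16, 34, 64]) :: OT) lz2 1 lz2 2 0 0
    [237439, 1, 204253, 223810, 223458, 52698, 211619, 32768, 225754, 223912, 4, 32, 203517, 72409, 30725, 203427, 92838, 161809] = true := by decide +kernel
lemma curveT : CurveOK ℚ AT BT ([-1] : List ℤ) LT 0 lz2 lz2 1 2 := by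
  obtain ⟨u, hs, hu⟩ := isUnitZ_of stripT
  exact CurveOK.mk' unitZ hs hu (rows_cons (rowTwo_spec dig_lz2 twoTlz2) (rows_odd oddT)) flipT selT (by decide +kernel)
lemma endT : endChk lz2 AT BT 1 0 0 0 false = true := by decide +kernel
theorem noneT (s1 s2 s3 : ℚ) : ¬ Ts (algebraMap ℤ ℚ AT) (algebraMap ℤ ℚ BT) s1 s2 s3 :=
  curveT.none dig_lz2 (by norm_num) endT s1 s2 s3
/-- curve -/
def AM : ℤ := (-1403867839)
/-- curve -/
def BM : ℤ := 753294938
/-- places -/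
def LM : List (Loc ℤ) := [lz2, z3, z7, z11, z19, z41, z173, z947]
/-- rows -/
def OM : List (Loc ℤ × List ℕ) := [(z3, [16, 1]), (z7, [1, 2]), (z11, [48, 18]), (z19, [33, 50]), (z41, [17, 50]), (z173, [49, 50]), (z947, [49])]
lemma oddM : (OM.all fun p => rowOdd p.1 AM BM p.2) = true := by decide +kernel
lemma twoMlz2 : rowTwo lz2 AM BM [2, 16, 64] 1 = true := by decide +kernel
lemma stripM : ((stripAll LM (AM * BM * (BM - AM))).map fun u => (u == 1 || u == -1)) = some true := by decide +kernel
lemma flipM : flipChk AM BM lz2 1 lz2 33 = true := by decide +kernel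
lemma selM : selChk (([-1] : List ℤ) ++ LM.map Loc.pi) ((lz2, [2, 16, 64]) :: OM) lz2 1 lz2 33 0 0
    [43363, 1, 64, 128, 21531, 114590, 16091, 76134, 82466, 191332, 8, 32, 108926, 1473, 6401, 7899, 213513, 220921] = true := by decide +kernel
lemma curveM : CurveOK ℚ AM BM ([-1] : List ℤ) LM 0 lz2 lz2 1 33 := by
  obtain ⟨u, hs, hu⟩ := isUnitZ_of stripM
  exact CurveOK.mk' unitZ hs hu (rows_cons (rowTwo_spec dig_lz2 twoMlz2) (rows_odd oddM)) flipM selM (by decide +kernel)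
lemma endM : endChk lz2 AM BM 1 0 0 0 false = true := by decide +kernel
theorem noneM (s1 s2 s3 : ℚ) : ¬ Ts (algebraMap ℤ ℚ AM) (algebraMap ℤ ℚ BM) s1 s2 s3 :=
  curveM.none dig_lz2 (by norm_num) endM s1 s2 s3
/-- curve -/
def AN : C3 ℤ := ⟨-6300646506, 0, -3150323253⟩
/-- curve -/
def BN : C3 ℤ := ⟨-10418856492, 440283789, -5160507825⟩
/-- places -/
def LN : List (Loc (C3 ℤ)) := [la, lb, k3, k7, q7, k11, k19, k41, k59c, k173, q173, k461, q461, k947, k1103]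
/-- rows -/
def ON : List (Loc (C3 ℤ) × List ℕ) := [(k3, [32, 19]), (k7, [17, 50]), (q7, [17, 50]), (k11, [48, 18]), (k19, [48, 2]), (k41, [1, 2]), (k59c, [16, 33]), (k173, [49, 34]), (q173, [48, 19]), (k461, [17, 34]), (q461, [48, 3]), (k947, [1, 2]), (k1103, [16])]
lemma oddN : (ON.all fun p => rowOdd p.1 AN BN p.2) = true := by decide +kernel
lemma twoNla : rowTwo la AN BN [5, 32, 81] 1 = true := by decide +kernel
lemma twoNlb : rowTwo lb AN BN [2, 4, 16, 224] 2 = true := by decide +kernel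
lemma stripN : ((stripAll LN (AN * BN * (BN - AN))).map fun u => (C3.nm u == 1 || C3.nm u == -1)) = some true := by decide +kernel
lemma flipN : flipChk AN BN la 3 la 1 = true := by decide +kernel
lemma selN : selChk (([-1, ep] : List (C3 ℤ)) ++ LN.map Loc.pi) ((la, [5, 32, 81]) :: (lb, [2, 4, 16, 224]) :: ON) la 3 la 1 0 0
    [2979492903, 15554089008, 2, 12379306805, 10366400306, 12364824663, 12589113143, 12540266839, 10259775026, 524288, 13451213589, 10311723058, 11125857302, 7644915811, 6571173922, 2147483648, 2405359393, 12948903110, 6410514876, 2231509733, 128, 13480737301, 12364826711, 12589121335, 218978849, 12366957517, 3962376566, 2097152, 16481937201, 16560722001, 7779133539, 8068980377, 8589935002, 8589934592] = true := by decide +kernel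
lemma curveN : CurveOK (C3 ℚ) AN BN ([-1, ep] : List (C3 ℤ)) LN 0 la la 3 1 := by
  obtain ⟨u, hs, hu⟩ := isUnitK_of stripN
  exact CurveOK.mk' unitK hs hu (rows_cons (rowTwo_spec dig_la twoNla) (rows_cons (rowTwo_spec dig_lb twoNlb) (rows_odd oddN))) flipN selN (by decide +kernel)
lemma endN : endChk la AN BN 1 0 0 0 false = true := by decide +kernel
theorem noneN (s1 s2 s3 : C3 ℚ) : ¬ Ts (algebraMap (C3 ℤ) (C3 ℚ) AN) (algebraMap (C3 ℤ) (C3 ℚ) BN) s1 s2 s3 :=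
  curveN.none dig_la (by norm_num) endN s1 s2 s3
/-- curve -/
def AF : C3 ℤ := ⟨-29195888616312, -4865981436052, -12164953590130⟩
/-- curve -/
def BF : C3 ℤ := ⟨-17263566416250, -2842145101719, -7155841957803⟩
/-- places -/
def LF : List (Loc (C3 ℤ)) := [la, lb, k3, k7, q7, k11, k19, k41, k47, q47, k59a, k59b, k59c, k173, q173, k461, k947, k1103, q1103]
/-- rows -/
def OF : List (Loc (C3 ℤ) × List ℕ) := [(k3, [16, 1]), (k7, [16, 32]), (q7, [16, 32]), (k11, [33, 34]), (k19, [49, 2]), (k41, [1, 2]), (k47, [48, 18]), (q47, [33, 2]), (k59a, [32, 19]), (k59b, [32, 3]), (k59c, [17, 34]), (k173, [48, 19]), (q173, [49, 34]), (k461, [16, 33]), (k947, [1, 18]), (k1103, [17, 34]), (q1103, [32])]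
lemma oddF : (OF.all fun p => rowOdd p.1 AF BF p.2) = true := by decide +kernel
lemma twoFla : rowTwo la AF BF [22, 37, 66] 1 = true := by decide +kernel
lemma twoFlb : rowTwo lb AF BF [25, 43, 69, 140] 2 = true := by decide +kernel
lemma stripF : ((stripAll LF (AF * BF * (BF - AF))).map fun u => (C3.nm u == 1 || C3.nm u == -1)) = some true := by decide +kernel
lemma flipF : flipChk AF BF la 3 la 1 = true := by decide +kernel
lemma selF : selChk (([-1, ep] : List (C3 ℤ)) ++ LF.map Loc.pi) ((la, [22, 37, 66]) :: (lb, [25, 43, 69, 140]) :: OF) la 3 la 1 0 0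
    [2089171561189, 1331614372274, 2, 3268954401401, 1024, 3637202681105, 2122948967377, 487715798173, 2605417392246, 524288, 1519527554554, 3285900839250, 510005811762, 1195057052114, 4097147930795, 1743008247990, 1738418739198, 4091958494897, 137438953472, 2349660342935, 1729234212650, 3038523489187, 2716978798393, 3937751259641, 2897058554174, 512, 2048, 8192, 601302981730, 1630908850433, 2660456380058, 3714284683441, 2969677516073, 3101480933305, 3628702089721, 4096611059883, 1742696436733, 1549656847121, 34359738368, 2042928827430, 2899416156823, 2205978362793] = true := by decide +kernel
lemma curveF : CurveOK (C3 ℚ) AF BF ([-1, ep] : List (C3 ℤ)) LF 0 la la 3 1 := by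
  obtain ⟨u, hs, hu⟩ := isUnitK_of stripF
  exact CurveOK.mk' unitK hs hu (rows_cons (rowTwo_spec dig_la twoFla) (rows_cons (rowTwo_spec dig_lb twoFlb) (rows_odd oddF))) flipF selF (by decide +kernel)
lemma endF : endChk la AF BF 1 0 0 0 false = true := by decide +kernel
theorem noneF (s1 s2 s3 : C3 ℚ) : ¬ Ts (algebraMap (C3 ℤ) (C3 ℚ) AF) (algebraMap (C3 ℤ) (C3 ℚ) BF) s1 s2 s3 :=
  curveF.none dig_la (by norm_num) endF s1 s2 s3
/-- curve -/
def AW : C3 ℤ := ⟨-1203840, 81928, -436392⟩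
/-- curve -/
def BW : C3 ℤ := ⟨-408177, 13167, -171171⟩
/-- places -/
def LW : List (Loc (C3 ℤ)) := [la, lb, k3, k7, q7, k11, k19, k29, k47, q47, k59c, k173, k947, k1103]
/-- rows -/
def OW : List (Loc (C3 ℤ) × List ℕ) := [(k3, [16, 32]), (k7, [16, 32]), (q7, [16, 33]), (k11, [32, 3]), (k19, [33, 34]), (k29, [16, 33]), (k47, [1, 2]), (q47, [1, 2]), (k59c, [17, 34]), (k173, [48, 19]), (k947, [1, 2])]
lemma oddW : (OW.all fun p => rowOdd p.1 AW BW p.2) = true := by decide +kernel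
lemma twoWla : rowTwo la AW BW [17, 34, 69] 1 = true := by decide +kernel
lemma twoWlb : rowTwo lb AW BW [4, 17, 98, 136] 2 = true := by decide +kernel
lemma stripW : ((stripAll LW (AW * BW * (BW - AW))).map fun u => (C3.nm u == 1 || C3.nm u == -1)) = some true := by decide +kernel
lemma flipW : flipChk AW BW la 5 la 4 = true := by decide +kernel
lemma selW : selChk (([-1, ep] : List (C3 ℤ)) ++ LW.map Loc.pi) ((la, [17, 34, 69]) :: (lb, [4, 17, 98, 136]) :: OW) la 5 la 4 3163140457 0
    [0, 2016188880, 3, 1236925066, 2024643056, 327172236, 687085400, 1209145178, 327855455, 164894585, 2097152, 8388608, 590925350, 960590883, 536870912, 1645858342, 499787314, 1671008248, 7, 1236925130, 512, 2048, 8192, 1955537312, 850454905, 524288, 1081997747, 744641119, 557370918, 552887128, 1813485562, 1265493174] = true := by decide +kernel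
lemma curveW : CurveOK (C3 ℚ) AW BW ([-1, ep] : List (C3 ℤ)) LW 3163140457 la la 5 4 := by
  obtain ⟨u, hs, hu⟩ := isUnitK_of stripW
  exact CurveOK.mk' unitK hs hu (rows_cons (rowTwo_spec dig_la twoWla) (rows_cons (rowTwo_spec dig_lb twoWlb) (rows_odd oddW))) flipW selW (by decide +kernel)
lemma endW : endChk lb AW BW 2 0 0 0 true = true := by decide +kernel
lemma endWx : endChk lb AW BW 2 9 9 0 true = true := by decide +kernel
theorem oddsW (s1 s2 s3 : C3 ℚ) (h : Ts (algebraMap (C3 ℤ) (C3 ℚ) AW) (algebraMap (C3 ℤ) (C3 ℚ) BW) s1 s2 s3) :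
    s1 ≠ 0 ∧ (lb.P (C3 ℚ)).v s1 < 0 ∧ (lb.P (C3 ℚ)).v s1 % 2 = 1 :=
  curveW.odd dig_lb endW endWx (by norm_num) (by decide +kernel) (by decide +kernel) (by decide +kernel) s1 s2 s3 h
end KZB

set_option linter.unusedSectionVars false
set_option linter.unusedVariables false
set_option linter.unusedSimpArgs false
namespace KZB

/-! ### the first descent: search -/

/-- tuple of five numbers with a tag -/
structure T5 where
  a0 : ℕ
  a1 : ℕ
  a2 : ℕ
  a3 : ℕ
  a4 : ℕ
  tag : ℕ

/-- table -/
def cSG : List T5 := [⟨1, 1, 1, 1, 1, 0⟩,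
  ⟨1, 0, 0, 0, 0, 0⟩,
  ⟨1, 1, 1, 0, 0, 0⟩]
/-- table -/
def c2 : List T5 := [⟨0, 5, 1, 6, 5, 0⟩,
  ⟨0, 5, 2, 5, 5, 0⟩,
  ⟨0, 5, 4, 3, 5, 0⟩,
  ⟨0, 5, 7, 0, 5, 0⟩,
  ⟨1, 6, 0, 0, 0, 0⟩,
  ⟨2, 0, 2, 2, 5, 2⟩,
  ⟨2, 0, 7, 7, 5, 1⟩,
  ⟨4, 4, 6, 6, 7, 0⟩,
  ⟨5, 3, 7, 7, 1, 0⟩,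
  ⟨6, 0, 5, 5, 1, 0⟩,
  ⟨7, 2, 4, 4, 2, 0⟩,
  ⟨7, 7, 7, 7, 7, 0⟩]
/-- table -/
def c11 : List T5 := [⟨0, 0, 2, 3, 0, 0⟩,
  ⟨0, 1, 2, 2, 0, 0⟩,
  ⟨0, 2, 2, 1, 0, 0⟩,
  ⟨0, 3, 2, 0, 0, 0⟩,
  ⟨1, 1, 1, 1, 1, 0⟩,
  ⟨2, 0, 3, 0, 0, 0⟩,
  ⟨3, 2, 0, 2, 2, 0⟩]
/-- table -/
def c19 : List T5 := [⟨0, 3, 0, 2, 2, 0⟩,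
  ⟨1, 2, 0, 0, 0, 0⟩,
  ⟨2, 0, 2, 3, 0, 0⟩,
  ⟨2, 2, 3, 0, 0, 0⟩,
  ⟨3, 3, 3, 3, 3, 0⟩]
/-- table -/
def c173 : List T5 := [⟨0, 0, 0, 0, 3, 0⟩,
  ⟨0, 0, 1, 0, 2, 0⟩,
  ⟨0, 3, 0, 0, 0, 0⟩,
  ⟨2, 0, 0, 1, 0, 0⟩,
  ⟨3, 0, 0, 2, 2, 0⟩,
  ⟨3, 3, 3, 3, 3, 0⟩]
/-- table -/
def eSG : List T5 := [⟨594, 594, 594, 594, 594, 0⟩,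
  ⟨594, 0, 0, 0, 0, 0⟩,
  ⟨594, 594, 594, 0, 0, 0⟩]
/-- table -/
def e2 : List T5 := [⟨0, 1364, 1360, 6, 1364, 0⟩,
  ⟨0, 1364, 2, 1364, 1364, 0⟩,
  ⟨0, 1364, 4, 1362, 1364, 0⟩,
  ⟨0, 1364, 1366, 0, 1364, 0⟩,
  ⟨1360, 6, 0, 0, 0, 0⟩,
  ⟨2, 0, 2, 2, 1364, 2⟩,
  ⟨2, 0, 1366, 1366, 1364, 1⟩,
  ⟨4, 4, 6, 6, 1366, 0⟩,
  ⟨1364, 1362, 1366, 1366, 1360, 0⟩,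
  ⟨6, 0, 1364, 1364, 1360, 0⟩,
  ⟨1366, 2, 4, 4, 2, 0⟩,
  ⟨1366, 1366, 1366, 1366, 1366, 0⟩]
/-- table -/
def e11 : List T5 := [⟨0, 0, 16, 8470, 0, 0⟩,
  ⟨0, 8454, 16, 16, 0, 0⟩,
  ⟨0, 16, 16, 8454, 0, 0⟩,
  ⟨0, 8470, 16, 0, 0, 0⟩,
  ⟨8454, 8454, 8454, 8454, 8454, 0⟩,
  ⟨16, 0, 8470, 0, 0, 0⟩,
  ⟨8470, 16, 0, 16, 16, 0⟩]
/-- table -/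
def e19 : List T5 := [⟨0, 16726, 0, 64, 64, 0⟩,
  ⟨16662, 64, 0, 0, 0, 0⟩,
  ⟨64, 0, 64, 16726, 0, 0⟩,
  ⟨64, 64, 16726, 0, 0, 0⟩,
  ⟨16726, 16726, 16726, 16726, 16726, 0⟩]
/-- table -/
def e173 : List T5 := [⟨0, 0, 0, 0, 524628, 0⟩,
  ⟨0, 0, 524372, 0, 256, 0⟩,
  ⟨0, 524628, 0, 0, 0, 0⟩,
  ⟨256, 0, 0, 524372, 0, 0⟩,
  ⟨524628, 0, 0, 256, 256, 0⟩,
  ⟨524628, 524628, 524628, 524628, 524628, 0⟩]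
/-- table -/
def c3 : List T5 := [⟨0, 0, 0, 0, 0, 0⟩,
  ⟨0, 1, 1, 0, 0, 0⟩,
  ⟨1, 0, 0, 1, 0, 0⟩]
/-- table -/
def e3 : List T5 := [⟨0, 0, 0, 0, 0, 0⟩,
  ⟨0, 2374, 2374, 0, 0, 0⟩,
  ⟨2374, 0, 0, 2374, 0, 0⟩]
/-- table -/
def e7 : List T5 := [⟨0, 0, 0, 0, 0, 0⟩,
  ⟨4370, 0, 0, 4370, 0, 1⟩]
/-- table -/
def e29 : List T5 := [⟨0, 0, 0, 0, 0, 0⟩,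
  ⟨0, 0, 32852, 0, 32852, 1⟩]
/-- table -/
def e41 : List T5 := [⟨0, 0, 0, 0, 0, 0⟩,
  ⟨65616, 65616, 0, 0, 0, 1⟩]
/-- table -/
def e47 : List T5 := [⟨0, 0, 0, 0, 0, 0⟩,
  ⟨131074, 0, 131074, 0, 0, 1⟩]
/-- table -/
def e59 : List T5 := [⟨0, 0, 0, 0, 0, 0⟩,
  ⟨262470, 0, 0, 0, 262470, 1⟩]
/-- table -/
def e461 : List T5 := [⟨0, 0, 0, 0, 0, 0⟩,
  ⟨0, 1048852, 0, 0, 1048852, 1⟩]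
/-- table -/
def e947 : List T5 := [⟨0, 0, 0, 0, 0, 0⟩,
  ⟨0, 0, 0, 2097414, 2097414, 1⟩]
/-- table -/
def e1103 : List T5 := [⟨0, 0, 0, 0, 0, 0⟩,
  ⟨4194562, 0, 0, 0, 4194562, 1⟩]
/-- table -/
def six : List T5 := [⟨1, 0, 18, 34, 1026, 1⟩,
  ⟨10169, 128, 256, 8, 8706, 2⟩,
  ⟨129, 3236, 6, 18, 2050, 1⟩,
  ⟨1075, 1075, 1075, 1075, 1075, 0⟩,
  ⟨257, 7, 1399, 0, 66, 0⟩,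
  ⟨9, 19, 1, 5163, 4099, 0⟩]
/-- codes -/
def g29 : List ℕ := [0, 2, 2, 0, 2, 2, 1, 2, 2, 0, 0, 2, 2, 0]
/-- codes -/
def g47 : List ℕ := [2, 0, 0, 0, 2, 2, 2, 2, 1, 0, 0, 2, 0, 2]
/-- codes -/
def g59 : List ℕ := [2, 2, 0, 0, 2, 0, 0, 0, 2, 1, 2, 0, 0, 0]

/-- information at 29 -/
def k29f (w0 w1 w3 : ℕ) : Bool := Nat.beq (xorsel g29 w0) 2 && Nat.beq (xorsel g29 w1) 0 && Nat.beq (xorsel g29 w3) 0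
/-- information at 47 -/
def k47f (w1 w3 w4 : ℕ) : Bool := Nat.beq (xorsel g47 w1) 2 && Nat.beq (xorsel g47 w3) 0 && Nat.beq (xorsel g47 w4) 2
/-- information at 59 -/
def k59f (w1 w2 w3 : ℕ) : Bool := Nat.beq (xorsel g59 w1) 0 && Nat.beq (xorsel g59 w2) 2 && Nat.beq (xorsel g59 w3) 0
/-- final test -/
def fin (tg u v w n0 n1 n2 n3 n4 : ℕ) : Bool :=
  (Nat.beq u 1 && !(k29f n0 n1 n3)) || (Nat.beq v 1 && !(k47f n1 n3 n4)) || (Nat.beq w 1 && !(k59f n1 n2 n3)) ||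
  six.any fun s => Nat.beq n0 s.a0 && Nat.beq n1 s.a1 && Nat.beq n2 s.a2 && Nat.beq n3 s.a3 && Nat.beq n4 s.a4
    && Nat.beq tg s.tag
/-- residues in the span -/
def m3 : ℕ := 2799819766879590122503937060812391877757791540921878080350481430759199949991861512331091428134859571265
/-- vanishing modulo 512 -/
def nz (n : ℕ) : Bool := Bool.not (Nat.beq (n % 512) 0)

/-- search -/
def srch : Bool :=
  e2.all fun a => e11.all fun b => e19.all fun c => e173.all fun d =>
   Bool.not (Nat.beq (m3 >>> ((a.a3 ^^^ b.a3 ^^^ c.a3 ^^^ d.a3) % 512) % 2) 1) ||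
   eSG.all fun s => e3.all fun e => e7.all fun f => e947.all fun g =>
   nz ((a.a3 ^^^ b.a3 ^^^ c.a3 ^^^ d.a3) ^^^ (s.a3 ^^^ e.a3 ^^^ f.a3 ^^^ g.a3)) ||
   e29.all fun h => e47.all fun i =>
   nz ((a.a2 ^^^ b.a2 ^^^ c.a2 ^^^ d.a2) ^^^ (s.a2 ^^^ e.a2 ^^^ h.a2 ^^^ i.a2)) ||
   e41.all fun j => e461.all fun k =>
   nz ((a.a1 ^^^ b.a1 ^^^ c.a1 ^^^ d.a1) ^^^ (s.a1 ^^^ e.a1 ^^^ j.a1 ^^^ k.a1)) ||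
   e59.all fun l => e1103.all fun m =>
   nz ((a.a0 ^^^ b.a0 ^^^ c.a0 ^^^ d.a0) ^^^ (s.a0 ^^^ e.a0 ^^^ f.a0 ^^^ i.a0 ^^^ j.a0 ^^^ l.a0 ^^^ m.a0)) ||
   nz ((a.a4 ^^^ b.a4 ^^^ c.a4 ^^^ d.a4) ^^^ (s.a4 ^^^ e.a4 ^^^ h.a4 ^^^ k.a4 ^^^ g.a4 ^^^ l.a4 ^^^ m.a4)) ||
   fin a.tag h.tag i.tag l.tag
    (((a.a0 ^^^ b.a0 ^^^ c.a0 ^^^ d.a0) ^^^ (s.a0 ^^^ e.a0 ^^^ f.a0 ^^^ i.a0 ^^^ j.a0 ^^^ l.a0 ^^^ m.a0)) / 512)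
    (((a.a1 ^^^ b.a1 ^^^ c.a1 ^^^ d.a1) ^^^ (s.a1 ^^^ e.a1 ^^^ j.a1 ^^^ k.a1)) / 512)
    (((a.a2 ^^^ b.a2 ^^^ c.a2 ^^^ d.a2) ^^^ (s.a2 ^^^ e.a2 ^^^ h.a2 ^^^ i.a2)) / 512)
    (((a.a3 ^^^ b.a3 ^^^ c.a3 ^^^ d.a3) ^^^ (s.a3 ^^^ e.a3 ^^^ f.a3 ^^^ g.a3)) / 512)
    (((a.a4 ^^^ b.a4 ^^^ c.a4 ^^^ d.a4) ^^^ (s.a4 ^^^ e.a4 ^^^ h.a4 ^^^ k.a4 ^^^ g.a4 ^^^ l.a4 ^^^ m.a4)) / 512)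

set_option maxRecDepth 100000 in
lemma srch_true : srch = true := by decide +kernel

lemma nz_eq {n W : ℕ} (h : n = 512 * W) : nz n = false := by
  simp [nz, h]

lemma m3_ok : (eSG.all fun s => e3.all fun e => e7.all fun f => e947.all fun g =>
    Nat.beq (m3 >>> ((s.a3 ^^^ e.a3 ^^^ f.a3 ^^^ g.a3) % 512) % 2) 1) = true := by decide +kernel

lemma xor_mod_eq {n m W : ℕ} (h : n ^^^ m = 512 * W) : n % 512 = m % 512 := by
  have h1 : (n ^^^ m) % 2 ^ 9 = 0 := by rw [h]; norm_num
  rw [Nat.xor_mod_two_pow] at h1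
  exact Nat.xor_eq_zero_iff.1 h1

lemma srch_spec {a b c d s e f g h i j k l m : T5} (ha : a ∈ e2) (hb : b ∈ e11) (hc : c ∈ e19) (hd : d ∈ e173)
    (hs : s ∈ eSG) (he : e ∈ e3) (hf : f ∈ e7) (hg : g ∈ e947) (hh : h ∈ e29) (hi : i ∈ e47) (hj : j ∈ e41)
    (hk : k ∈ e461) (hl : l ∈ e59) (hm : m ∈ e1103) {w0 w1 w2 w3 w4 : ℕ}
    (h0 : (a.a0 ^^^ b.a0 ^^^ c.a0 ^^^ d.a0) ^^^ (s.a0 ^^^ e.a0 ^^^ f.a0 ^^^ i.a0 ^^^ j.a0 ^^^ l.a0 ^^^ m.a0) = 512 * w0)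
    (h1 : (a.a1 ^^^ b.a1 ^^^ c.a1 ^^^ d.a1) ^^^ (s.a1 ^^^ e.a1 ^^^ j.a1 ^^^ k.a1) = 512 * w1)
    (h2 : (a.a2 ^^^ b.a2 ^^^ c.a2 ^^^ d.a2) ^^^ (s.a2 ^^^ e.a2 ^^^ h.a2 ^^^ i.a2) = 512 * w2)
    (h3 : (a.a3 ^^^ b.a3 ^^^ c.a3 ^^^ d.a3) ^^^ (s.a3 ^^^ e.a3 ^^^ f.a3 ^^^ g.a3) = 512 * w3)
    (h4 : (a.a4 ^^^ b.a4 ^^^ c.a4 ^^^ d.a4) ^^^ (s.a4 ^^^ e.a4 ^^^ h.a4 ^^^ k.a4 ^^^ g.a4 ^^^ l.a4 ^^^ m.a4) = 512 * w4)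
    (k1 : h.tag = 1 → k29f w0 w1 w3 = true) (k2 : i.tag = 1 → k47f w1 w3 w4 = true)
    (k3 : l.tag = 1 → k59f w1 w2 w3 = true) :
    ∃ z ∈ six, w0 = z.a0 ∧ w1 = z.a1 ∧ w2 = z.a2 ∧ w3 = z.a3 ∧ w4 = z.a4 ∧ a.tag = z.tag := by
  have H := srch_true
  unfold srch at H
  have H1 := List.all_eq_true.1 (List.all_eq_true.1 (List.all_eq_true.1 (List.all_eq_true.1 H a ha) b hb) c hc) d hd
  have M := List.all_eq_true.1 (List.all_eq_true.1 (List.all_eq_true.1 (List.all_eq_true.1 m3_ok s hs) e he) f hf) g hg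
  rw [← xor_mod_eq h3] at M
  rw [M, Bool.not_true, Bool.false_or] at H1
  have H2 := List.all_eq_true.1 (List.all_eq_true.1 (List.all_eq_true.1 (List.all_eq_true.1 H1 s hs) e he) f hf) g hg
  rw [nz_eq h3, Bool.false_or] at H2
  have H3 := List.all_eq_true.1 (List.all_eq_true.1 H2 h hh) i hi
  rw [nz_eq h2, Bool.false_or] at H3
  have H4 := List.all_eq_true.1 (List.all_eq_true.1 H3 j hj) k hk
  rw [nz_eq h1, Bool.false_or] at H4
  have H5 := List.all_eq_true.1 (List.all_eq_true.1 H4 l hl) m hm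
  rw [nz_eq h0, nz_eq h4, Bool.false_or, Bool.false_or, h0, h1, h2, h3, h4] at H5
  simp only [Nat.mul_div_cancel_left _ (show 0 < 512 by norm_num)] at H5
  unfold fin at H5
  have B : ∀ x y : ℕ, Nat.beq x y = true ↔ x = y := fun x y => Nat.beq_eq.to_iff
  have q1 : (Nat.beq h.tag 1 && !(k29f w0 w1 w3)) = false := by
    by_cases t : h.tag = 1
    · rw [k1 t]; simp
    · rw [show Nat.beq h.tag 1 = false from by rw [Bool.eq_false_iff, ne_eq, B]; exact t]; rfl
  have q2 : (Nat.beq i.tag 1 && !(k47f w1 w3 w4)) = false := by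
    by_cases t : i.tag = 1
    · rw [k2 t]; simp
    · rw [show Nat.beq i.tag 1 = false from by rw [Bool.eq_false_iff, ne_eq, B]; exact t]; rfl
  have q3 : (Nat.beq l.tag 1 && !(k59f w1 w2 w3)) = false := by
    by_cases t : l.tag = 1
    · rw [k3 t]; simp
    · rw [show Nat.beq l.tag 1 = false from by rw [Bool.eq_false_iff, ne_eq, B]; exact t]; rfl
  rw [q1, q2, q3, Bool.false_or, Bool.false_or, Bool.false_or, List.any_eq_true] at H5
  obtain ⟨z, hz, H6⟩ := H5
  simp only [Bool.and_eq_true, B] at H6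
  obtain ⟨⟨⟨⟨⟨p0, p1⟩, p2⟩, p3⟩, p4⟩, p5⟩ := H6
  exact ⟨z, hz, p0, p1, p2, p3, p4, p5⟩

/-! ### linear functions -/

/-- additive functions for exclusive or -/
def XLin (f : ℕ → ℕ) : Prop := ∀ a b, f (a ^^^ b) = f a ^^^ f b

lemma xlin_ext {f g : ℕ → ℕ} (hf : XLin f) (hg : XLin g) : ∀ n, (∀ k < n, f (2 ^ k) = g (2 ^ k)) → ∀ w < 2 ^ n, f w = g w := by
  intro n
  induction n with
  | zero =>
    intro _ w hw
    have : w = 0 := by simpa using hw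
    subst this
    have h1 := hf 0 0
    have h2 := hg 0 0
    simp only [Nat.xor_self] at h1 h2
    rw [h1, h2]
  | succ n ih =>
    intro h w hw
    by_cases hwn : w < 2 ^ n
    · exact ih (fun k hk => h k (by omega)) w hwn
    · have h1 : 2 ^ n ^^^ w < 2 ^ n := by
        apply Nat.lt_pow_two_of_testBit
        intro i hi
        rw [Nat.testBit_xor, Nat.testBit_two_pow]
        by_cases hin : n = i
        · subst hin
          rw [Nat.testBit_eq_decide_div_mod_eq]
          have : w / 2 ^ n = 1 := by
            apply Nat.div_eq_of_lt_le <;> rw [pow_succ] at * <;> omega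
          simp [this]
        · have : w < 2 ^ i := lt_of_lt_of_le hw (Nat.pow_le_pow_right (by norm_num) (by omega))
          simp [hin, Nat.testBit_lt_two_pow this]
      have h2 := ih (fun k hk => h k (by omega)) _ h1
      rw [hf, hg, h n (by omega)] at h2
      exact Nat.xor_right_injective h2

lemma xlin_xorsel (l : List ℕ) : XLin (xorsel l) := by
  intro a b
  induction l generalizing a b with
  | nil => simp [xorsel]
  | cons r l ih =>
    simp only [xorsel]
    have h1 : (a ^^^ b) / 2 = (a / 2) ^^^ (b / 2) := Nat.xor_div_two
    have h2 : (a ^^^ b) % 2 = (a % 2 + b % 2) % 2 := by rw [Nat.xor_mod_two_eq, Nat.add_mod]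
    rw [h1, ih, h2]
    rcases Nat.mod_two_eq_zero_or_one a with h | h <;> rcases Nat.mod_two_eq_zero_or_one b with h' | h' <;> simp [h, h']
    · rw [← Nat.xor_assoc, ← Nat.xor_assoc, Nat.xor_comm _ r]
    · rw [← Nat.xor_assoc]
    · rw [xor4]; simp

/-- entry for a code -/
def ent (off g c : ℕ) : ℕ := (c <<< off) ^^^ (if c % 2 = 1 then g else 0)
/-- entry for a parity -/
def par (g c : ℕ) : ℕ := if c % 2 = 1 then g else 0

lemma xlin_par (g : ℕ) : XLin (par g) := by
  intro a b
  simp only [par]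
  have h2 : (a ^^^ b) % 2 = (a % 2 + b % 2) % 2 := by rw [Nat.xor_mod_two_eq, Nat.add_mod]
  rw [h2]
  rcases Nat.mod_two_eq_zero_or_one a with h | h <;> rcases Nat.mod_two_eq_zero_or_one b with h' | h' <;> simp [h, h']
lemma xlin_xor {f g : ℕ → ℕ} (hf : XLin f) (hg : XLin g) : XLin (fun w => f w ^^^ g w) := by
  intro a b
  simp only [hf a b, hg a b]; exact xor4 _ _ _ _
lemma xlin_comp {f g : ℕ → ℕ} (hf : XLin f) (hg : XLin g) : XLin (fun w => f (g w)) := by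
  intro a b
  simp only [hg a b, hf _ _]
lemma xlin_ent (o g : ℕ) : XLin (ent o g) :=
  xlin_xor (f := fun c => c <<< o) (fun a b => Nat.shiftLeft_xor_distrib) (xlin_par g)
lemma xlin_mul : XLin (fun w => 512 * w) := by
  intro a b
  have : ∀ w, 512 * w = w <<< 9 := fun w => by rw [Nat.shiftLeft_eq]; ring
  simp only [this]; exact Nat.shiftLeft_xor_distrib

end KZB

set_option linter.unusedSectionVars false
set_option linter.unusedVariables false
set_option linter.unusedSimpArgs false
namespace KZB

/-! ### the first descent: local analysis -/

/-- the five factors -/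
def fd {R : Type} [CommRing R] (k : ℕ) (z : R) : R := match k with
  | 0 => z - 50
  | 1 => z - 9
  | 2 => z - 3
  | 3 => z + 13
  | _ => z ^ 3 + 2 * z ^ 2 + 3 * z + 4

/-- points with nonzero ordinate -/
structure Pt (x : ℚ) : Prop where
  ne : ∀ k, fd k x ≠ 0
  sq : ∃ y : ℚ, y ^ 2 = ((-72314 : ℤ) : ℚ) * (fd 0 x * fd 1 x * fd 2 x * fd 3 x * fd 4 x)

/-- the leading coefficient -/
abbrev c0 : ℚ := algebraMap ℤ ℚ (-72314)

lemma am_int (n : ℤ) : algebraMap ℤ ℚ n = (n : ℚ) := rfl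
lemma c0_ne : c0 ≠ 0 := by rw [c0, am_int]; norm_num

lemma Pt.y {x : ℚ} (h : Pt x) : ∃ y : ℚ, y ≠ 0 ∧ y ^ 2 = c0 * (fd 0 x * fd 1 x * fd 2 x * fd 3 x * fd 4 x) := by
  obtain ⟨y, hy⟩ := h.sq
  refine ⟨y, ?_, hy⟩
  rintro rfl
  have := mul_ne_zero c0_ne (mul_ne_zero (mul_ne_zero (mul_ne_zero (mul_ne_zero (h.ne 0) (h.ne 1)) (h.ne 2)) (h.ne 3)) (h.ne 4))
  apply this
  rw [c0, am_int, ← hy]; norm_num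

lemma Pt.cd {x : ℚ} (h : Pt x) (P : Place ℚ) :
    P.cd (fd 0 x) ^^^ P.cd (fd 1 x) ^^^ P.cd (fd 2 x) ^^^ P.cd (fd 3 x) ^^^ P.cd (fd 4 x) = P.cd c0 := by
  obtain ⟨y, hy, e⟩ := h.y
  have h1 := P.cd_sq hy
  have n1 := mul_ne_zero (h.ne 0) (h.ne 1)
  have n2 := mul_ne_zero n1 (h.ne 2)
  have n3 := mul_ne_zero n2 (h.ne 3)
  have n4 := mul_ne_zero n3 (h.ne 4)
  rw [e, P.cd_mul _ _ c0_ne n4, P.cd_mul _ _ n3 (h.ne 4), P.cd_mul _ _ n2 (h.ne 3), P.cd_mul _ _ n1 (h.ne 2),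
    P.cd_mul _ _ (h.ne 0) (h.ne 1)] at h1
  exact (Nat.xor_eq_zero_iff.1 h1).symm

lemma Pt.v {x : ℚ} (h : Pt x) (P : Place ℚ) :
    (P.v c0 + (P.v (fd 0 x) + P.v (fd 1 x) + P.v (fd 2 x) + P.v (fd 3 x) + P.v (fd 4 x))) % 2 = 0 := by
  obtain ⟨y, hy, e⟩ := h.y
  have h1 := P.v_pow y hy 2
  have n1 := mul_ne_zero (h.ne 0) (h.ne 1)
  have n2 := mul_ne_zero n1 (h.ne 2)
  have n3 := mul_ne_zero n2 (h.ne 3)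
  have n4 := mul_ne_zero n3 (h.ne 4)
  rw [e, P.v_mul _ _ c0_ne n4, P.v_mul _ _ n3 (h.ne 4), P.v_mul _ _ n2 (h.ne 3), P.v_mul _ _ n1 (h.ne 2),
    P.v_mul _ _ (h.ne 0) (h.ne 1)] at h1
  rw [h1]; push_cast; omega

section
variable {π : ℤ} {t : ℕ} (U : UC π t)

lemma ge_int (n : ℤ) : (mkPlace ℚ U).ge (n : ℚ) 0 := ge_algebraMap U n

lemma fd_int (k : ℕ) (z : ℤ) : ((fd k z : ℤ) : ℚ) = fd k (z : ℚ) := by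
  rcases k with _ | _ | _ | _ | k <;> simp [fd]

lemma fd_inf {x : ℚ} (hx : x ≠ 0) (hv : (mkPlace ℚ U).v x + t ≤ 0) (k : ℕ) :
    (mkPlace ℚ U).cd (fd k x) = (mkPlace ℚ U).cd x := by
  have ht : (mkPlace ℚ U).t = t := rfl
  have lin : ∀ n : ℤ, (mkPlace ℚ U).cd (x + n) = (mkPlace ℚ U).cd x := by
    intro n
    refine (Place.cd_close hx ?_).2
    rw [add_sub_cancel_left, ht]
    exact Place.ge_mono (ge_int U n) hv
  have h3 : x ^ 3 ≠ 0 := pow_ne_zero _ hx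
  have g1 := Place.ge_self (P := mkPlace ℚ U) x
  have U1 := U.t_pos
  have cub : (mkPlace ℚ U).cd (x ^ 3 + 2 * x ^ 2 + 3 * x + 4) = (mkPlace ℚ U).cd x := by
    have e : x ^ 3 = x * x ^ 2 := by ring
    rw [← Place.cd_mul_sq (P := mkPlace ℚ U) hx hx, ← e]
    refine (Place.cd_close h3 ?_).2
    rw [ht, Place.v_pow _ _ hx]
    rw [show x ^ 3 + 2 * x ^ 2 + 3 * x + 4 - x ^ 3 = ((2 : ℤ) : ℚ) * (x * x) + (((3 : ℤ) : ℚ) * x + ((4 : ℤ) : ℚ)) by push_cast; ring]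
    refine Place.ge_add (Place.ge_mono (Place.ge_mul (ge_int U 2) (Place.ge_mul g1 g1)) ?_)
      (Place.ge_add (Place.ge_mono (Place.ge_mul (ge_int U 3) g1) ?_) (Place.ge_mono (ge_int U 4) ?_)) <;> push_cast <;> omega
  rcases k with _ | _ | _ | _ | k
  · have := lin (-50); push_cast at this; simpa [fd, sub_eq_add_neg] using this
  · have := lin (-9); push_cast at this; simpa [fd, sub_eq_add_neg] using this
  · have := lin (-3); push_cast at this; simpa [fd, sub_eq_add_neg] using this
  · have := lin 13; push_cast at this; simpa [fd, sub_eq_add_neg] using this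
  · exact cub

lemma fd_inf_c {x : ℚ} (h : Pt x) (hx : x ≠ 0) (hv : (mkPlace ℚ U).v x + t ≤ 0) (k : ℕ) :
    (mkPlace ℚ U).cd (fd k x) = (mkPlace ℚ U).cd c0 := by
  have h1 := h.cd (mkPlace ℚ U)
  simp only [fd_inf U hx hv] at h1
  rw [fd_inf U hx hv, ← h1]
  simp

lemma fd_diff {x : ℚ} {z : ℤ} {n : ℤ} (hx : (mkPlace ℚ U).ge x 0) (hz : (mkPlace ℚ U).ge (x - z) n) (k : ℕ) :
    (mkPlace ℚ U).ge (fd k x - ((fd k z : ℤ) : ℚ)) n := by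
  have e : ∃ y : ℚ, (mkPlace ℚ U).ge y 0 ∧ fd k x - ((fd k z : ℤ) : ℚ) = y * (x - z) := by
    rw [fd_int]
    have one : (mkPlace ℚ U).ge (1 : ℚ) 0 := by simpa using ge_int U 1
    rcases k with _ | _ | _ | _ | k
    · exact ⟨1, one, by simp [fd]⟩
    · exact ⟨1, one, by simp [fd]⟩
    · exact ⟨1, one, by simp [fd]⟩
    · exact ⟨1, one, by simp [fd]⟩
    · refine ⟨x * x + (((z + 2 : ℤ) : ℚ) * x + ((z ^ 2 + 2 * z + 3 : ℤ) : ℚ)), ?_, by simp [fd]; ring⟩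
      refine Place.ge_add (Place.ge_mul hx hx) (Place.ge_add (Place.ge_mul (ge_int U _) hx) (ge_int U _))
  obtain ⟨y, hy, e⟩ := e
  rw [e]
  simpa using Place.ge_mul hy hz

lemma ge_or (x : ℚ) : (mkPlace ℚ U).ge x 0 ∨ (x ≠ 0 ∧ (mkPlace ℚ U).v x < 0) := by
  by_cases hx : x = 0
  · left; left; exact hx
  · by_cases h : (mkPlace ℚ U).v x < 0
    · right; exact ⟨hx, h⟩
    · left; right; omega

lemma int_ge_one {n : ℤ} (hn : π ∣ n) : (mkPlace ℚ U).ge (n : ℚ) 1 := by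
  by_cases h : n = 0
  · left; simp [h]
  · right; exact (v_algebraMap_pos (F := ℚ) U h).2 hn

lemma dvd_of_ge {n : ℤ} (hn : (mkPlace ℚ U).ge (n : ℚ) 1) : π ∣ n := by
  rcases hn with h | h
  · have : n = 0 := by exact_mod_cast h
    simp [this]
  · by_cases h0 : n = 0
    · simp [h0]
    · exact (v_algebraMap_pos (F := ℚ) U h0).1 h

lemma exists_residue {x : ℚ} (hx : (mkPlace ℚ U).ge x 0) : ∃ z : ℤ, (mkPlace ℚ U).ge (x - z) 1 := by
  have hd0 : (x.den : ℤ) ≠ 0 := by exact_mod_cast x.den_ne_zero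
  have hdq : ((x.den : ℤ) : ℚ) ≠ 0 := by exact_mod_cast hd0
  have e : x * ((x.den : ℤ) : ℚ) = (x.num : ℚ) := by push_cast; exact Rat.mul_den_eq_num x
  have hnd : ¬ π ∣ (x.den : ℤ) := by
    intro hd
    have h1 : (mkPlace ℚ U).ge (x.num : ℚ) 1 := by
      rw [← e]; simpa using Place.ge_mul hx (int_ge_one U hd)
    have h2 := dvd_of_ge U h1
    have h3 : IsCoprime x.num (x.den : ℤ) := by
      rw [Int.isCoprime_iff_gcd_eq_one]; exact x.reduced
    exact U.prime.not_isUnit (h3.isUnit_of_dvd' h2 hd)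
  have hco : IsCoprime π (x.den : ℤ) := (Irreducible.coprime_iff_not_dvd U.prime.irreducible).2 hnd
  obtain ⟨a, b, hab⟩ := hco
  refine ⟨x.num * b, ?_⟩
  have e2 : x - ((x.num * b : ℤ) : ℚ) = x * ((π * a : ℤ) : ℚ) := by
    have : ((a * π + b * (x.den : ℤ) : ℤ) : ℚ) = 1 := by rw [hab]; norm_num
    push_cast at this e ⊢
    rw [← e]
    linear_combination (-x) * this
  rw [e2]
  simpa using Place.ge_mul hx (int_ge_one U (Dvd.intro a rfl))

lemma res_pair {i j : ℕ} (hij : i < j) (hj : j < 5) {z : ℤ} (h1 : π ∣ fd i z) (h2 : π ∣ fd j z) :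
    π ∣ 41 ∨ π ∣ 47 ∨ π ∣ 63 ∨ π ∣ 6 ∨ π ∣ 22 ∨ π ∣ 16 ∨ π ∣ 130154 ∨ π ∣ 922 ∨ π ∣ 58 ∨ π ∣ 1894 := by
  have lin : ∀ u w n : ℤ, π ∣ u → π ∣ w → w - u = n → π ∣ n := fun u w n hu hw e => e ▸ dvd_sub hw hu
  have cub : ∀ r n : ℤ, π ∣ z - r → π ∣ z ^ 3 + 2 * z ^ 2 + 3 * z + 4 → r ^ 3 + 2 * r ^ 2 + 3 * r + 4 = n → π ∣ n := by
    intro r n hr hz e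
    have : n = z ^ 3 + 2 * z ^ 2 + 3 * z + 4 - (z - r) * (z ^ 2 + z * r + r ^ 2 + 2 * (z + r) + 3) := by rw [← e]; ring
    rw [this]
    exact dvd_sub hz (Dvd.dvd.mul_right hr _)
  have hi : i < 5 := by omega
  interval_cases j <;> interval_cases i <;> simp only [fd] at h1 h2
  · exact .inl (lin _ _ _ h1 h2 (by ring))
  · exact .inr (.inl (lin _ _ _ h1 h2 (by ring)))
  · exact .inr (.inr (.inr (.inl (lin _ _ _ h1 h2 (by ring)))))
  · exact .inr (.inr (.inl (lin _ _ _ h1 h2 (by ring))))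
  · exact .inr (.inr (.inr (.inr (.inl (lin _ _ _ h1 h2 (by ring))))))
  · exact .inr (.inr (.inr (.inr (.inr (.inl (lin _ _ _ h1 h2 (by ring)))))))
  · exact .inr (.inr (.inr (.inr (.inr (.inr (.inl (cub 50 _ h1 h2 (by norm_num))))))))
  · exact .inr (.inr (.inr (.inr (.inr (.inr (.inr (.inl (cub 9 _ h1 h2 (by norm_num)))))))))
  · exact .inr (.inr (.inr (.inr (.inr (.inr (.inr (.inr (.inl (cub 3 _ h1 h2 (by norm_num))))))))))
  · refine .inr (.inr (.inr (.inr (.inr (.inr (.inr (.inr (.inr ?_))))))))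
    have := cub (-13) (-1894) (by simpa using h1) h2 (by norm_num)
    rwa [show (1894 : ℤ) = - -1894 by norm_num, dvd_neg]
end

/-- the bad primes -/
def SZ : List ℤ := [2, 3, 7, 11, 19, 29, 41, 47, 59, 173, 461, 947, 1103]

lemma SZ_prime : ∀ g ∈ SZ, Prime g := by
  intro g hg
  simp only [SZ, List.mem_cons, List.not_mem_nil, or_false] at hg
  rcases hg with rfl | rfl | rfl | rfl | rfl | rfl | rfl | rfl | rfl | rfl | rfl | rfl | rfl <;> norm_num

lemma good_even {x : ℚ} (h : Pt x) {q : ℤ} (hq : Prime q) (hS : ∀ g ∈ SZ, ¬ q ∣ g) {k : ℕ} (hk : k < 5) :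
    (mkPlace ℚ (UC.triv hq)).v (fd k x) % 2 = 0 := by
  set U := UC.triv hq
  have hm : ∀ {a b : ℤ}, q ∣ a * b → q ∣ a ∨ q ∣ b := fun h => hq.dvd_or_dvd h
  have hmul : ∀ {a b n : ℤ}, ¬ q ∣ a → ¬ q ∣ b → a * b = n → ¬ q ∣ n := by
    intro a b n ha hb e hn
    rw [← e] at hn
    rcases hq.dvd_or_dvd hn with h | h
    · exact ha h
    · exact hb h
  have d2 := hS 2 (by simp [SZ]); have d3 := hS 3 (by simp [SZ]); have d7 := hS 7 (by simp [SZ])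
  have d11 := hS 11 (by simp [SZ]); have d19 := hS 19 (by simp [SZ]); have d29 := hS 29 (by simp [SZ])
  have d41 := hS 41 (by simp [SZ]); have d47 := hS 47 (by simp [SZ]); have d59 := hS 59 (by simp [SZ])
  have d173 := hS 173 (by simp [SZ]); have d461 := hS 461 (by simp [SZ]); have d947 := hS 947 (by simp [SZ])
  have d1103 := hS 1103 (by simp [SZ])
  have hc : ¬ q ∣ (-72314 : ℤ) := by
    rw [dvd_neg]
    exact hmul (hmul (hmul d2 d11 rfl) d19 rfl) d173 (by norm_num)
  have hvc : (mkPlace ℚ U).v c0 = 0 := v_triv_zero hq hc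
  rcases ge_or U x with hx | ⟨hx, hv⟩
  · obtain ⟨z, hz⟩ := exists_residue U hx
    have hge : ∀ k, 0 ≤ (mkPlace ℚ U).v (fd k x) := by
      intro k
      refine Place.v_of_ge ?_ (h.ne k)
      have := Place.ge_add (Place.ge_mono (fd_diff U hx hz k) (by norm_num)) (ge_int U (fd k z))
      simpa using this
    have hpos : ∀ k, 1 ≤ (mkPlace ℚ U).v (fd k x) → q ∣ fd k z := by
      intro k hk
      apply dvd_of_ge U
      have := Place.ge_sub (P := mkPlace ℚ U) (Or.inr hk) (fd_diff U hx hz k)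
      simpa using this
    have hnot : ∀ i j, i < j → j < 5 → ¬ (1 ≤ (mkPlace ℚ U).v (fd i x) ∧ 1 ≤ (mkPlace ℚ U).v (fd j x)) := by
      rintro i j hij hj ⟨h1, h2⟩
      rcases res_pair hij hj (hpos i h1) (hpos j h2) with h | h | h | h | h | h | h | h | h | h
      · exact d41 h
      · exact d47 h
      · exact hmul (hmul d3 d3 rfl) d7 (by norm_num) h
      · exact hmul d2 d3 (by norm_num) h
      · exact hmul d2 d11 (by norm_num) h
      · exact hmul (hmul (hmul d2 d2 rfl) d2 rfl) d2 (by norm_num) h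
      · exact hmul (hmul d2 d59 rfl) d1103 (by norm_num) h
      · exact hmul d2 d461 (by norm_num) h
      · exact hmul d2 d29 (by norm_num) h
      · exact hmul d2 d947 (by norm_num) h
    have hs := h.v (mkPlace ℚ U)
    rw [hvc] at hs
    have p01 := hnot 0 1 (by norm_num) (by norm_num); have p02 := hnot 0 2 (by norm_num) (by norm_num)
    have p03 := hnot 0 3 (by norm_num) (by norm_num); have p04 := hnot 0 4 (by norm_num) (by norm_num)
    have p12 := hnot 1 2 (by norm_num) (by norm_num); have p13 := hnot 1 3 (by norm_num) (by norm_num)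
    have p14 := hnot 1 4 (by norm_num) (by norm_num); have p23 := hnot 2 3 (by norm_num) (by norm_num)
    have p24 := hnot 2 4 (by norm_num) (by norm_num); have p34 := hnot 3 4 (by norm_num) (by norm_num)
    have g0 := hge 0; have g1 := hge 1; have g2 := hge 2; have g3 := hge 3; have g4 := hge 4
    interval_cases k <;> omega
  · have := fd_inf_c U h hx (by push_cast; omega) k
    apply Place.even_of_cd (h.ne k)
    rw [this]
    apply Place.cd_of_even c0_ne
    rw [hvc]; rfl
end KZB

set_option linter.unusedSectionVars false
set_option linter.unusedVariables false
set_option linter.unusedSimpArgs false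
namespace KZB

/-! ### local tables -/

lemma cd_lt_of {R F : Type} [CommRing R] [IsDomain R] [IsPrincipalIdealRing R] [Field F] [Algebra R F] [IsFractionRing R F]
    {π : R} {t : ℕ} (U : UC π t) {n : ℕ} (hn : 1 ≤ n) (hu : ∀ a, U.uc a < 2 ^ n) {x : F} (hx : x ≠ 0) :
    (mkPlace F U).cd x < 2 ^ n := by
  obtain ⟨k, a, b, h⟩ := exists_rep U.prime x hx
  have e : (mkPlace F U).cd x = _ := cc_rep U h
  rw [e]
  have h1 : bp k < 2 ^ n := by
    have : 2 ^ 1 ≤ 2 ^ n := Nat.pow_le_pow_right (by norm_num) hn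
    unfold bp; split <;> omega
  exact Nat.xor_lt_two_pow h1 (Nat.xor_lt_two_pow (hu a) (hu b))

/-- equality of tuples after applying a function -/
def hitF (f : ℕ → ℕ) (z : T5) (s0 s1 s2 s3 s4 : ℕ) : Bool :=
  Nat.beq z.a0 (f s0) && Nat.beq z.a1 (f s1) && Nat.beq z.a2 (f s2) && Nat.beq z.a3 (f s3) && Nat.beq z.a4 (f s4)

/-- all choices -/
def allX (o0 o1 o2 o3 o4 : List ℕ) (cc : ℕ) (Q : ℕ → ℕ → ℕ → ℕ → ℕ → Bool) : Bool :=
  o0.all fun a => o1.all fun b => o2.all fun c => o3.all fun d => o4.all fun e =>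
    Bool.not (Nat.beq (a ^^^ b ^^^ c ^^^ d ^^^ e) cc) || Q a b c d e

lemma allX_spec {o0 o1 o2 o3 o4 : List ℕ} {cc : ℕ} {Q : ℕ → ℕ → ℕ → ℕ → ℕ → Bool} (h : allX o0 o1 o2 o3 o4 cc Q = true)
    {a b c d e : ℕ} (ha : a ∈ o0) (hb : b ∈ o1) (hc : c ∈ o2) (hd : d ∈ o3) (he : e ∈ o4)
    (hx : a ^^^ b ^^^ c ^^^ d ^^^ e = cc) : Q a b c d e = true := by
  have h1 := List.all_eq_true.1 (List.all_eq_true.1 (List.all_eq_true.1 (List.all_eq_true.1 (List.all_eq_true.1 h a ha) b hb) c hc) d hd) e he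
  rw [hx, Nat.beq_refl, Bool.not_true, Bool.false_or] at h1
  exact h1

/-- table for an odd prime -/
def optP (p : ℕ) (z : ℤ) : List ℕ := if z % p = 0 then [0, 1, 2, 3] else [chi p z]

/-- check at an odd prime -/
def okp (p cc : ℕ) (Q : ℕ → ℕ → ℕ → ℕ → ℕ → Bool) : Bool :=
  Q cc cc cc cc cc && (List.range p).all fun t =>
    allX (optP p (fd 0 (t : ℤ))) (optP p (fd 1 (t : ℤ))) (optP p (fd 2 (t : ℤ))) (optP p (fd 3 (t : ℤ))) (optP p (fd 4 (t : ℤ))) cc Q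

lemma chi_le (p : ℕ) (z : ℤ) : chi p z < 2 ^ 2 := by
  unfold chi; split <;> norm_num

lemma okp_spec {x : ℚ} (h : Pt x) {p : ℕ} (hp : p.Prime) (hp2 : p ≠ 2) {Q : ℕ → ℕ → ℕ → ℕ → ℕ → Bool}
    (hc : ((lz p hp hp2).vc (-72314)).isSome = true) (hQ : okp p ((lz p hp hp2).c (-72314)) Q = true) :
    Q (((lz p hp hp2).P ℚ).cd (fd 0 x)) (((lz p hp hp2).P ℚ).cd (fd 1 x)) (((lz p hp hp2).P ℚ).cd (fd 2 x))
      (((lz p hp hp2).P ℚ).cd (fd 3 x)) (((lz p hp hp2).P ℚ).cd (fd 4 x)) = true := by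
  have hcc := ((lz p hp hp2).c_spec (F := ℚ) hc).2
  have hsum := h.cd ((lz p hp hp2).P ℚ)
  rw [okp, Bool.and_eq_true] at hQ
  have key := fd_inf_c (ucZ p hp hp2) h
  change ((lz p hp hp2).P ℚ).cd c0 = _ at hcc
  rw [hcc] at hsum
  rcases ge_or (ucZ p hp hp2) x with hx | ⟨hx, hv⟩
  · obtain ⟨z, hz⟩ := exists_residue _ hx
    obtain ⟨t, ht, hzt⟩ := exists_res hp z
    have hxt : (mkPlace ℚ (ucZ p hp hp2)).ge (x - ((t : ℤ) : ℚ)) 1 := by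
      have := Place.ge_add hz (int_ge_one (ucZ p hp hp2) hzt)
      push_cast at this ⊢
      simpa using this
    have hmem : ∀ k, ((lz p hp hp2).P ℚ).cd (fd k x) ∈ optP p (fd k (t : ℤ)) := by
      intro k
      unfold optP
      split
      · have := cd_lt_of (ucZ p hp hp2) (n := 2) (by norm_num) (fun a => chi_le p _) (h.ne k)
        change ((lz p hp hp2).P ℚ).cd (fd k x) < _ at this
        simp only [List.mem_cons, List.not_mem_nil, or_false]
        omega
      · rename_i hnd
        rw [List.mem_singleton]
        have hb : bcode (lz p hp hp2) (fd k (t : ℤ)) 1 = some (chi p (fd k (t : ℤ))) := by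
          have : (lz p hp hp2).D.dv (fd k (t : ℤ)) = none := by
            change dvZ p _ = none
            rw [dvZ, if_neg hnd]
          have e1 : strip (lz p hp hp2).D.dv (1 + 1 - (lz p hp hp2).t) (fd k (t : ℤ)) = some (0, fd k (t : ℤ)) := by
            change strip _ 1 _ = _
            simp [strip, this]
          unfold bcode
          rw [e1]
          simp
          rfl
        exact bcode_spec hb (fd_diff (ucZ p hp hp2) hx hxt k)
    have := List.all_eq_true.1 hQ.2 t (List.mem_range.2 ht)
    exact allX_spec this (hmem 0) (hmem 1) (hmem 2) (hmem 3) (hmem 4) hsum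
  · have h1 : ∀ k, ((lz p hp hp2).P ℚ).cd (fd k x) = _ := fun k => (key hx (by push_cast; omega) k).trans hcc
    simp only [h1]
    exact hQ.1

/-- check for membership in a table -/
def Qt (e : List T5) (f : ℕ → ℕ) (K : ℕ → ℕ → ℕ → ℕ → ℕ → Bool) (s0 s1 s2 s3 s4 : ℕ) : Bool :=
  e.any fun z => hitF f z s0 s1 s2 s3 s4 && (Bool.not (Nat.beq z.tag 1) || K s0 s1 s2 s3 s4)

lemma hitF_spec {f : ℕ → ℕ} {z : T5} {s0 s1 s2 s3 s4 : ℕ} (h : hitF f z s0 s1 s2 s3 s4 = true) :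
    z.a0 = f s0 ∧ z.a1 = f s1 ∧ z.a2 = f s2 ∧ z.a3 = f s3 ∧ z.a4 = f s4 := by
  have B : ∀ x y : ℕ, Nat.beq x y = true ↔ x = y := fun x y => Nat.beq_eq.to_iff
  simp only [hitF, Bool.and_eq_true, B] at h
  tauto

lemma Qt_spec {e : List T5} {f : ℕ → ℕ} {K : ℕ → ℕ → ℕ → ℕ → ℕ → Bool} {s0 s1 s2 s3 s4 : ℕ}
    (h : Qt e f K s0 s1 s2 s3 s4 = true) : ∃ z ∈ e, (z.a0 = f s0 ∧ z.a1 = f s1 ∧ z.a2 = f s2 ∧ z.a3 = f s3 ∧ z.a4 = f s4) ∧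
      (z.tag = 1 → K s0 s1 s2 s3 s4 = true) := by
  obtain ⟨z, hz, h1⟩ := List.any_eq_true.1 h
  rw [Bool.and_eq_true] at h1
  refine ⟨z, hz, hitF_spec h1.1, fun ht => ?_⟩
  have h2 := h1.2
  rw [ht, Nat.beq_refl] at h2
  simpa using h2

/-- no condition -/
def KT (_ _ _ _ _ : ℕ) : Bool := true

/-- place -/
abbrev z59 := lz 59 (by norm_num) (by norm_num)
/-- place -/
abbrev z461 := lz 461 (by norm_num) (by norm_num)
/-- place -/
abbrev z1103 := lz 1103 (by norm_num) (by norm_num)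

/-- condition -/
def K29 (a b c d e : ℕ) : Bool := Nat.beq a 2 && Nat.beq b 0 && Nat.beq d 0
/-- condition -/
def K47 (a b c d e : ℕ) : Bool := Nat.beq b 2 && Nat.beq d 0 && Nat.beq e 2
/-- condition -/
def K59 (a b c d e : ℕ) : Bool := Nat.beq b 0 && Nat.beq c 2 && Nat.beq d 0

section
set_option maxRecDepth 100000
lemma q11 : okp 11 (z11.c (-72314)) (Qt e11 (ent 3 8462) KT) = true := by decide +kernel
lemma q19 : okp 19 (z19.c (-72314)) (Qt e19 (ent 5 16694) KT) = true := by decide +kernel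
lemma q173t : okp 173 (z173.c (-72314)) (Qt e173 (ent 7 524500) KT) = true := by decide +kernel
lemma q3 : okp 3 (z3.c (-72314)) (Qt e3 (par 2374) KT) = true := by decide +kernel
lemma q7t : okp 7 (z7.c (-72314)) (Qt e7 (par 4370) KT) = true := by decide +kernel
lemma q29t : okp 29 (z29.c (-72314)) (Qt e29 (par 32852) K29) = true := by decide +kernel
lemma q41t : okp 41 (z41.c (-72314)) (Qt e41 (par 65616) KT) = true := by decide +kernel
lemma q47t : okp 47 (z47.c (-72314)) (Qt e47 (par 131074) K47) = true := by decide +kernel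
lemma q59t : okp 59 (z59.c (-72314)) (Qt e59 (par 262470) K59) = true := by decide +kernel
lemma q461t : okp 461 (z461.c (-72314)) (Qt e461 (par 1048852) KT) = true := by decide +kernel
lemma q947t : okp 947 (z947.c (-72314)) (Qt e947 (par 2097414) KT) = true := by decide +kernel
lemma q1103t : okp 1103 (z1103.c (-72314)) (Qt e1103 (par 4194562) KT) = true := by decide +kernel
end

/-! ### the prime two -/

/-- options for a ball -/
def opt2 (r : ℤ) (n : ℕ) : List ℕ := match bcode lz2 r n with
  | some c => [c]
  | none => [0, 1, 2, 3, 4, 5, 6, 7]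

/-- table entry -/
def Q2 (x : ℤ) (n : ℕ) (s0 s1 s2 s3 s4 : ℕ) : Bool :=
  e2.any fun z => hitF (ent 0 1361) z s0 s1 s2 s3 s4 &&
    (Nat.beq z.tag 0 || (Nat.ble 5 n && ((Nat.beq z.tag 1 && x % 32 == 4) || (Nat.beq z.tag 2 && x % 32 == 8))))

/-- leaf -/
def leaf2 (x : ℤ) (n : ℕ) : Bool :=
  allX (opt2 (x - 200) n) (opt2 (x - 36) n) (opt2 (x - 12) n) (opt2 (x + 52) n) (opt2 (x ^ 3 + 8 * x ^ 2 + 48 * x + 256) n)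
    (lz2.c (-72314)) (Q2 x n)

set_option maxRecDepth 100000 in
lemma tree2_true : tree 2 leaf2 20 0 1 0 = true := by decide +kernel
lemma inf2 : Q2 0 0 (lz2.c (-72314)) (lz2.c (-72314)) (lz2.c (-72314)) (lz2.c (-72314)) (lz2.c (-72314)) = true := by decide +kernel
end KZB

set_option linter.unusedSectionVars false
set_option linter.unusedVariables false
set_option linter.unusedSimpArgs false
namespace KZB

/-! ### conclusion of the first descent -/

lemma u8_lt8 (z : ℤ) : u8 z < 2 ^ 3 := by
  unfold u8; split_ifs <;> norm_num

lemma opt2_mem {r : ℤ} {n : ℕ} {y : ℚ} (hy : y ≠ 0) (h : (lz2.P ℚ).ge (y - algebraMap ℤ ℚ r) n) :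
    (lz2.P ℚ).cd y ∈ opt2 r n := by
  unfold opt2
  split
  · rename_i c hc
    rw [List.mem_singleton]
    exact bcode_spec hc h
  · have h1 : (lz2.P ℚ).cd y < 2 ^ 3 := cd_lt_of ucZ2 (n := 3) (by norm_num) (fun a => u8_lt8 a) hy
    simp only [List.mem_cons, List.not_mem_nil, or_false]
    omega

/-- the conclusion at two -/
def G2 (x : ℚ) : Prop := ∃ z ∈ e2, (z.a0 = ent 0 1361 ((lz2.P ℚ).cd (fd 0 x)) ∧ z.a1 = ent 0 1361 ((lz2.P ℚ).cd (fd 1 x)) ∧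
    z.a2 = ent 0 1361 ((lz2.P ℚ).cd (fd 2 x)) ∧ z.a3 = ent 0 1361 ((lz2.P ℚ).cd (fd 3 x)) ∧
    z.a4 = ent 0 1361 ((lz2.P ℚ).cd (fd 4 x))) ∧ (z.tag = 1 → (lz2.P ℚ).ge (x - 1) 3) ∧ (z.tag = 2 → (lz2.P ℚ).ge (x - 2) 3)

lemma cd_four {y z : ℚ} (m : ℚ) (hm : m ≠ 0) (hy : y ≠ 0) (e : z = y * m ^ 2) : (lz2.P ℚ).cd z = (lz2.P ℚ).cd y := by
  rw [e]; exact Place.cd_mul_sq hy hm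

lemma v_four : (lz2.P ℚ).v 4 = 2 := by
  have h2 : (lz2.P ℚ).v 2 = 1 := by
    have := v_pi (F := ℚ) ucZ2
    exact this
  rw [show (4 : ℚ) = 2 ^ 2 by norm_num, Place.v_pow _ _ (by norm_num), h2]; norm_num

lemma ge_div4 {y : ℚ} {n : ℤ} (h : (lz2.P ℚ).ge (4 * y) (n + 2)) : (lz2.P ℚ).ge y n := by
  rcases h with h | h
  · left; simpa using h
  · by_cases hy : y = 0
    · left; exact hy
    · right
      rw [Place.v_mul _ _ _ (by norm_num) hy, v_four] at h
      omega

lemma Q2_spec {x : ℤ} {n s0 s1 s2 s3 s4 : ℕ} (h : Q2 x n s0 s1 s2 s3 s4 = true) :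
    ∃ z ∈ e2, (z.a0 = ent 0 1361 s0 ∧ z.a1 = ent 0 1361 s1 ∧ z.a2 = ent 0 1361 s2 ∧ z.a3 = ent 0 1361 s3 ∧ z.a4 = ent 0 1361 s4) ∧
      (z.tag = 1 → 5 ≤ n ∧ x % 32 = 4) ∧ (z.tag = 2 → 5 ≤ n ∧ x % 32 = 8) := by
  obtain ⟨z, hz, h1⟩ := List.any_eq_true.1 h
  rw [Bool.and_eq_true] at h1
  have B : ∀ x y : ℕ, Nat.beq x y = true ↔ x = y := fun x y => Nat.beq_eq.to_iff
  refine ⟨z, hz, hitF_spec h1.1, ?_⟩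
  have h2 := h1.2
  simp only [Bool.or_eq_true, Bool.and_eq_true, B, Nat.ble_eq, beq_iff_eq] at h2
  omega

lemma two_spec {x : ℚ} (h : Pt x) : G2 x := by
  have hcc := (lz2.c_spec (F := ℚ) (a := -72314) (by decide +kernel)).2
  have hsum := h.cd (lz2.P ℚ)
  change (lz2.P ℚ).cd c0 = _ at hcc
  by_cases hX : (lz2.P ℚ).ge (4 * x) 0
  · rw [hcc] at hsum
    have key := tree_root (F := ℚ) (L := lz2) dig_lz2 (leaf := leaf2) (G := fun w => w = 4 * x → G2 x) ?_ (f := 20) tree2_true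
      (4 * x) hX rfl
    · exact key
    · rintro X n w hl hw rfl
      have lin : ∀ r : ℤ, ((lz2.P ℚ).ge (4 * x + (r : ℚ) - algebraMap ℤ ℚ (X + r)) n) := by
        intro r
        rw [am_int]; push_cast
        rw [am_int] at hw
        convert hw using 1; ring
      have c1 := cd_four (z := 4 * x + ((-200 : ℤ) : ℚ)) 2 (by norm_num) (h.ne 0) (by simp [fd]; ring)
      have c2 := cd_four (z := 4 * x + ((-36 : ℤ) : ℚ)) 2 (by norm_num) (h.ne 1) (by simp [fd]; ring)
      have c3 := cd_four (z := 4 * x + ((-12 : ℤ) : ℚ)) 2 (by norm_num) (h.ne 2) (by simp [fd]; ring)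
      have c4 := cd_four (z := 4 * x + ((52 : ℤ) : ℚ)) 2 (by norm_num) (h.ne 3) (by simp [fd]; ring)
      have c5 := cd_four (z := (4 * x) ^ 3 + 8 * (4 * x) ^ 2 + 48 * (4 * x) + 256) 8 (by norm_num) (h.ne 4) (by simp [fd]; ring)
      have n1 : 4 * x + ((-200 : ℤ) : ℚ) ≠ 0 := by
        have := h.ne 0; simp only [fd] at this; push_cast; contrapose! this; linarith
      have n2 : 4 * x + ((-36 : ℤ) : ℚ) ≠ 0 := by
        have := h.ne 1; simp only [fd] at this; push_cast; contrapose! this; linarith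
      have n3 : 4 * x + ((-12 : ℤ) : ℚ) ≠ 0 := by
        have := h.ne 2; simp only [fd] at this; push_cast; contrapose! this; linarith
      have n4 : 4 * x + ((52 : ℤ) : ℚ) ≠ 0 := by
        have := h.ne 3; simp only [fd] at this; push_cast; contrapose! this; linarith
      have n5 : (4 * x) ^ 3 + 8 * (4 * x) ^ 2 + 48 * (4 * x) + 256 ≠ 0 := by
        have := h.ne 4; simp only [fd] at this; contrapose! this; linarith
      have hcub : (lz2.P ℚ).ge ((4 * x) ^ 3 + 8 * (4 * x) ^ 2 + 48 * (4 * x) + 256 - algebraMap ℤ ℚ (X ^ 3 + 8 * X ^ 2 + 48 * X + 256)) n := by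
        rw [am_int] at hw ⊢
        have gx : (lz2.P ℚ).ge (X : ℚ) 0 := ge_int ucZ2 X
        have g8 : (lz2.P ℚ).ge ((8 : ℤ) : ℚ) 0 := ge_int ucZ2 8
        have g48 : (lz2.P ℚ).ge ((48 : ℤ) : ℚ) 0 := ge_int ucZ2 48
        have e : (4 * x) ^ 3 + 8 * (4 * x) ^ 2 + 48 * (4 * x) + 256 - ((X ^ 3 + 8 * X ^ 2 + 48 * X + 256 : ℤ) : ℚ)
            = ((4 * x) * (4 * x) + ((4 * x) * X + (X * X + (((8 : ℤ) : ℚ) * (4 * x) + (((8 : ℤ) : ℚ) * X + ((48 : ℤ) : ℚ)))))) * (4 * x - X) := by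
          push_cast; ring
        rw [e]
        have := Place.ge_mul (Place.ge_add (Place.ge_mul hX hX) (Place.ge_add (Place.ge_mul hX gx) (Place.ge_add (Place.ge_mul gx gx)
          (Place.ge_add (Place.ge_mul g8 hX) (Place.ge_add (Place.ge_mul g8 gx) (by simpa using g48)))))) hw
        simpa using this
      have m := allX_spec hl (opt2_mem n1 (by simpa [sub_eq_add_neg] using lin (-200))) (opt2_mem n2 (by simpa [sub_eq_add_neg] using lin (-36)))
        (opt2_mem n3 (by simpa [sub_eq_add_neg] using lin (-12))) (opt2_mem n4 (lin 52)) (opt2_mem n5 hcub)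
        (by rw [c1, c2, c3, c4, c5]; exact hsum)
      rw [c1, c2, c3, c4, c5] at m
      obtain ⟨z, hz, h1, h2, h3⟩ := Q2_spec m
      have g32 : ∀ r : ℤ, (32 : ℤ) ∣ X - r → (lz2.P ℚ).ge ((X - r : ℤ) : ℚ) 5 := by
        rintro r ⟨k, hk⟩
        have g2 : (lz2.P ℚ).ge ((2 : ℤ) : ℚ) 1 := int_ge_one ucZ2 (dvd_refl 2)
        rw [hk]
        have := Place.ge_mul (Place.ge_mul (Place.ge_mul (Place.ge_mul (Place.ge_mul g2 g2) g2) g2) g2) (show (lz2.P ℚ).ge (k : ℚ) 0 from ge_int ucZ2 k)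
        norm_num at this
        simpa using this
      rw [am_int] at hw
      refine ⟨z, hz, h1, ?_, ?_⟩
      · intro ht
        obtain ⟨h5, h6⟩ := h2 ht
        refine ge_div4 (n := 3) (show (lz2.P ℚ).ge _ 5 from ?_)
        have := Place.ge_add (Place.ge_mono hw (show (5 : ℤ) ≤ n by exact_mod_cast h5)) (g32 4 (by omega))
        push_cast at this
        convert this using 1
        ring
      · intro ht
        obtain ⟨h5, h6⟩ := h3 ht
        refine ge_div4 (n := 3) (show (lz2.P ℚ).ge _ 5 from ?_)
        have := Place.ge_add (Place.ge_mono hw (show (5 : ℤ) ≤ n by exact_mod_cast h5)) (g32 8 (by omega))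
        push_cast at this
        convert this using 1; ring
  · have hx : x ≠ 0 := by
      rintro rfl; apply hX; left; simp
    have hv : (lz2.P ℚ).v x ≤ -3 := by
      by_contra hc
      apply hX; right
      rw [Place.v_mul _ _ _ (by norm_num) hx, v_four]; omega
    have h1 : ∀ k, (lz2.P ℚ).cd (fd k x) = _ := fun k => (fd_inf_c ucZ2 h hx (by change (lz2.P ℚ).v x + _ ≤ 0; push_cast; omega) k).trans hcc
    obtain ⟨z, hz, h2, h3, h4⟩ := Q2_spec inf2
    refine ⟨z, hz, by simpa only [h1] using h2, fun ht => ?_, fun ht => ?_⟩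
    · have := (h3 ht).1; omega
    · have := (h4 ht).1; omega

/-! words -/

/-- product of generators selected by the bits of a number -/
def gw : List ℤ → ℕ → ℤ
  | [], _ => 1
  | g :: G, w => (if w % 2 = 1 then g else 1) * gw G (w / 2)

lemma gp_gw (G : List ℤ) (i : ℕ) (X : ℕ → Bool) : ∃ w < 2 ^ G.length, gp G i X = gw G w := by
  induction G generalizing i with
  | nil => exact ⟨0, by simp, rfl⟩
  | cons g G ih =>
    obtain ⟨w, hw, e⟩ := ih (i + 1)
    cases hX : X i
    · refine ⟨2 * w, by rw [List.length_cons, pow_succ]; omega, ?_⟩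
      simp [gp, gw, hX, e]
    · refine ⟨2 * w + 1, by rw [List.length_cons, pow_succ]; omega, ?_⟩
      have h1 : (2 * w + 1) / 2 = w := by omega
      have h2 : (2 * w + 1) % 2 = 1 := by omega
      simp [gp, gw, hX, e, h1, h2]

lemma gw_cd (L : Loc ℤ) (G : List ℤ) (h : (G.all fun g => (L.vc g).isSome) = true) (w : ℕ) :
    algebraMap ℤ ℚ (gw G w) ≠ 0 ∧ (L.P ℚ).cd (algebraMap ℤ ℚ (gw G w)) = xorsel (G.map L.c) w := by
  induction G generalizing w with
  | nil => simp [gw, xorsel, Place.cd_one]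
  | cons g G ih =>
    rw [List.all_cons, Bool.and_eq_true] at h
    obtain ⟨i1, i2⟩ := ih h.2 (w / 2)
    obtain ⟨g1, g2⟩ := L.c_spec (F := ℚ) h.1
    rw [gw, List.map_cons, xorsel, map_mul]
    by_cases hw : w % 2 = 1
    · rw [if_pos hw, if_pos hw]
      exact ⟨mul_ne_zero g1 i1, by rw [(L.P ℚ).cd_mul _ _ g1 i1, g2, i2]⟩
    · rw [if_neg hw, if_neg hw, map_one, one_mul, Nat.zero_xor]
      exact ⟨i1, i2⟩

lemma gw_pos (G : List ℤ) (h : ∀ g ∈ G, 0 < g) (w : ℕ) : 0 < gw G w := by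
  induction G generalizing w with
  | nil => simp [gw]
  | cons g G ih =>
    rw [gw]
    apply mul_pos
    · split
      · exact h g (by simp)
      · norm_num
    · exact ih (fun g hg => h g (by simp [hg])) _

/-- the generators -/
def GZ : List ℤ := [-1] ++ SZ

/-- codes of words -/
def xs (L : Loc ℤ) (w : ℕ) : ℕ := xorsel (GZ.map L.c) w
lemma xlin_xs (L : Loc ℤ) : XLin (xs L) := xlin_xorsel _

/-- reconstruction of the word -/
def Nw (w : ℕ) : ℕ := (ent 0 1361 (xs lz2 w) ^^^ ent 3 8462 (xs z11 w) ^^^ ent 5 16694 (xs z19 w) ^^^ ent 7 524500 (xs z173 w)) ^^^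
  (par 594 w ^^^ par 2374 (xs z3 w) ^^^ par 4370 (xs z7 w) ^^^ par 32852 (xs z29 w) ^^^ par 131074 (xs z47 w) ^^^ par 65616 (xs z41 w)
   ^^^ par 1048852 (xs z461 w) ^^^ par 2097414 (xs z947 w) ^^^ par 262470 (xs z59 w) ^^^ par 4194562 (xs z1103 w))

lemma Nw_basis : ((List.range 14).all fun k => Nw (2 ^ k) == 512 * 2 ^ k) = true := by decide +kernel

lemma Nw_eq {w : ℕ} (hw : w < 2 ^ 14) : Nw w = 512 * w := by
  have hl : XLin Nw := by
    have e : ∀ o g L, XLin (fun w => ent o g (xs L w)) := fun o g L => xlin_comp (xlin_ent o g) (xlin_xs L)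
    have p : ∀ g L, XLin (fun w => par g (xs L w)) := fun g L => xlin_comp (xlin_par g) (xlin_xs L)
    exact xlin_xor (xlin_xor (xlin_xor (xlin_xor (e _ _ _) (e _ _ _)) (e _ _ _)) (e _ _ _))
      (xlin_xor (xlin_xor (xlin_xor (xlin_xor (xlin_xor (xlin_xor (xlin_xor (xlin_xor (xlin_xor (xlin_par 594) (p _ _)) (p _ _)) (p _ _))
        (p _ _)) (p _ _)) (p _ _)) (p _ _)) (p _ _)) (p _ _))
  refine xlin_ext hl xlin_mul 14 (fun k hk => ?_) w hw
  simpa using List.all_eq_true.1 Nw_basis k (List.mem_range.2 hk)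

lemma g29_eq : GZ.map z29.c = g29 := by decide +kernel
lemma g47_eq : GZ.map z47.c = g47 := by decide +kernel
lemma g59_eq : GZ.map z59.c = g59 := by decide +kernel

lemma word_exists {x : ℚ} (h : Pt x) {k : ℕ} (hk : k < 5) :
    ∃ w < 2 ^ 14, ∃ β : ℚ, β ≠ 0 ∧ fd k x = algebraMap ℤ ℚ (gw GZ w) * β ^ 2 := by
  obtain ⟨X, β, hβ, e⟩ := sunit_F unitZ SZ_prime (fd k x) (h.ne k) (fun q hq hS => good_even h hq hS hk) 0
  obtain ⟨w, hw, e2⟩ := gp_gw GZ 0 X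
  exact ⟨w, hw, β, hβ, by rw [e, ← e2]; rfl⟩

lemma word_cd {y : ℚ} {w : ℕ} {β : ℚ} (hβ : β ≠ 0) (e : y = algebraMap ℤ ℚ (gw GZ w) * β ^ 2) (L : Loc ℤ)
    (hL : (GZ.all fun g => (L.vc g).isSome) = true) : (L.P ℚ).cd y = xs L w := by
  obtain ⟨h1, h2⟩ := gw_cd L GZ hL w
  rw [e, Place.cd_mul_sq h1 hβ, h2]; rfl

lemma word_neg {y : ℚ} {w : ℕ} {β : ℚ} (hβ : β ≠ 0) (e : y = algebraMap ℤ ℚ (gw GZ w) * β ^ 2) : w % 2 = 1 ↔ y < 0 := by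
  have hp : (0 : ℚ) < (gw SZ (w / 2) : ℤ) := by
    exact_mod_cast gw_pos SZ (by decide) (w / 2)
  have hb : 0 < β ^ 2 := by positivity
  have e1 : gw GZ w = (if w % 2 = 1 then -1 else 1) * gw SZ (w / 2) := rfl
  rw [e, am_int, e1]
  have hm := mul_pos hp hb
  by_cases hw : w % 2 = 1
  · simp only [hw, if_true, true_iff]; push_cast; linarith
  · simp only [hw, if_false, false_iff]; push_cast; linarith

lemma sign_spec {x : ℚ} (h : Pt x) {w0 w1 w2 w3 w4 : ℕ} (h0 : w0 % 2 = 1 ↔ fd 0 x < 0) (h1 : w1 % 2 = 1 ↔ fd 1 x < 0)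
    (h2 : w2 % 2 = 1 ↔ fd 2 x < 0) (h3 : w3 % 2 = 1 ↔ fd 3 x < 0) (h4 : w4 % 2 = 1 ↔ fd 4 x < 0) :
    ∃ s ∈ eSG, s.a0 = par 594 w0 ∧ s.a1 = par 594 w1 ∧ s.a2 = par 594 w2 ∧ s.a3 = par 594 w3 ∧ s.a4 = par 594 w4 := by
  obtain ⟨y, hy, e⟩ := h.y
  have hy2 : 0 < y ^ 2 := by positivity
  have n0 := h.ne 0; have n1 := h.ne 1; have n2 := h.ne 2; have n3 := h.ne 3; have n4 := h.ne 4
  rw [e, c0, am_int] at hy2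
  have cub1 : -1 < x → 0 < fd 4 x := by
    intro hx; simp only [fd]; nlinarith [mul_pos (show 0 < x + 1 by linarith) (show 0 < x ^ 2 + x + 2 by nlinarith [sq_nonneg (x + 1)])]
  have cub2 : x < -2 → fd 4 x < 0 := by
    intro hx; simp only [fd]; nlinarith [mul_pos (show 0 < -2 - x by linarith) (show 0 < x ^ 2 + 3 by positivity)]
  have hprod : fd 0 x * fd 1 x * fd 2 x * fd 3 x * fd 4 x < 0 := by push_cast at hy2; linarith
  have f0 : fd 0 x = x - 50 := rfl
  have f1 : fd 1 x = x - 9 := rfl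
  have f2 : fd 2 x = x - 3 := rfl
  have f3 : fd 3 x = x + 13 := rfl
  have mk : ∀ a b : ℚ, (a < 0 ∨ 0 < a) → (b < 0 ∨ 0 < b) → (a * b < 0 ↔ ¬ ((a < 0) ↔ (b < 0))) := by
    intro a b ha hb
    rcases ha with ha | ha <;> rcases hb with hb | hb
    · exact iff_of_false (mul_pos_of_neg_of_neg ha hb).not_gt (fun h => h (iff_of_true ha hb))
    · exact iff_of_true (mul_neg_of_neg_of_pos ha hb) (fun h => hb.not_gt (h.1 ha))
    · exact iff_of_true (mul_neg_of_pos_of_neg ha hb) (fun h => ha.not_gt (h.2 hb))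
    · exact iff_of_false (mul_pos ha hb).not_gt (fun h => h (iff_of_false ha.not_gt hb.not_gt))
  have l := fun k => lt_or_gt_of_ne (h.ne k)
  have m1 := mk _ _ (l 0) (l 1)
  have m2 := mk _ _ (lt_or_gt_of_ne (mul_ne_zero n0 n1)) (l 2)
  have m3 := mk _ _ (lt_or_gt_of_ne (mul_ne_zero (mul_ne_zero n0 n1) n2)) (l 3)
  have m4 := mk _ _ (lt_or_gt_of_ne (mul_ne_zero (mul_ne_zero (mul_ne_zero n0 n1) n2) n3)) (l 4)
  have o1 : fd 1 x < 0 → fd 0 x < 0 := by rw [f0, f1]; intro; linarith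
  have o2 : fd 2 x < 0 → fd 1 x < 0 := by rw [f1, f2]; intro; linarith
  have o3 : fd 3 x < 0 → fd 2 x < 0 := by rw [f2, f3]; intro; linarith
  have o4 : fd 4 x < 0 → fd 2 x < 0 := by
    intro hc; rw [f2]; by_contra hh; have := cub1 (by linarith); linarith
  have o5 : fd 3 x < 0 → fd 4 x < 0 := by
    intro hc; rw [f3] at hc; exact cub2 (by linarith)
  have key : (fd 0 x < 0 ∧ fd 1 x < 0 ∧ fd 2 x < 0 ∧ fd 3 x < 0 ∧ fd 4 x < 0) ∨
      (fd 0 x < 0 ∧ ¬ fd 1 x < 0 ∧ ¬ fd 2 x < 0 ∧ ¬ fd 3 x < 0 ∧ ¬ fd 4 x < 0) ∨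
      (fd 0 x < 0 ∧ fd 1 x < 0 ∧ fd 2 x < 0 ∧ ¬ fd 3 x < 0 ∧ ¬ fd 4 x < 0) := by
    rw [m4, m3, m2, m1] at hprod
    clear m1 m2 m3 m4 mk l cub1 cub2 f0 f1 f2 f3 n0 n1 n2 n3 n4 h0 h1 h2 h3 h4 hy2 e
    generalize (fd 0 x < 0) = A0 at *
    generalize (fd 1 x < 0) = A1 at *
    generalize (fd 2 x < 0) = A2 at *
    generalize (fd 3 x < 0) = A3 at *
    generalize (fd 4 x < 0) = A4 at *
    grind
  have P1 : ∀ {w : ℕ} {q : Prop}, (w % 2 = 1 ↔ q) → q → 594 = par 594 w := fun hw hq => by rw [par, if_pos (hw.2 hq)]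
  have P2 : ∀ {w : ℕ} {q : Prop}, (w % 2 = 1 ↔ q) → ¬ q → 0 = par 594 w := fun hw hq => by rw [par, if_neg (fun h => hq (hw.1 h))]
  rcases key with ⟨t0, t1, t2, t3, t4⟩ | ⟨t0, t1, t2, t3, t4⟩ | ⟨t0, t1, t2, t3, t4⟩
  · exact ⟨_, List.mem_cons_self, P1 h0 t0, P1 h1 t1, P1 h2 t2, P1 h3 t3, P1 h4 t4⟩
  · exact ⟨_, List.mem_cons_of_mem _ List.mem_cons_self, P1 h0 t0, P2 h1 t1, P2 h2 t2, P2 h3 t3, P2 h4 t4⟩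
  · exact ⟨_, List.mem_cons_of_mem _ (List.mem_cons_of_mem _ List.mem_cons_self), P1 h0 t0, P1 h1 t1, P1 h2 t2, P2 h3 t3, P2 h4 t4⟩

/-- all entries vanish at the indicated coordinates -/
lemma e7_z : (e7.all fun z => z.a1 == 0 && z.a2 == 0 && z.a4 == 0) = true := by decide
lemma e29_z : (e29.all fun z => z.a0 == 0 && z.a1 == 0 && z.a3 == 0) = true := by decide
lemma e47_z : (e47.all fun z => z.a1 == 0 && z.a3 == 0 && z.a4 == 0) = true := by decide
lemma e41_z : (e41.all fun z => z.a2 == 0 && z.a3 == 0 && z.a4 == 0) = true := by decide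
lemma e461_z : (e461.all fun z => z.a0 == 0 && z.a2 == 0 && z.a3 == 0) = true := by decide
lemma e947_z : (e947.all fun z => z.a0 == 0 && z.a1 == 0 && z.a2 == 0) = true := by decide
lemma e59_z : (e59.all fun z => z.a1 == 0 && z.a2 == 0 && z.a3 == 0) = true := by decide
lemma e1103_z : (e1103.all fun z => z.a1 == 0 && z.a2 == 0 && z.a3 == 0) = true := by decide

lemma zz {e : List T5} {f g h : T5 → ℕ} (H : (e.all fun z => f z == 0 && g z == 0 && h z == 0) = true) {z : T5} (hz : z ∈ e) :
    f z = 0 ∧ g z = 0 ∧ h z = 0 := by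
  have := List.all_eq_true.1 H z hz
  simpa [and_assoc] using this

lemma stage1 {x : ℚ} (h : Pt x) : ∃ z ∈ six, (∃ β : ℚ, β ≠ 0 ∧ fd 0 x = algebraMap ℤ ℚ (gw GZ z.a0) * β ^ 2) ∧
    (∃ β : ℚ, β ≠ 0 ∧ fd 1 x = algebraMap ℤ ℚ (gw GZ z.a1) * β ^ 2) ∧ (∃ β : ℚ, β ≠ 0 ∧ fd 2 x = algebraMap ℤ ℚ (gw GZ z.a2) * β ^ 2) ∧
    (∃ β : ℚ, β ≠ 0 ∧ fd 3 x = algebraMap ℤ ℚ (gw GZ z.a3) * β ^ 2) ∧ (∃ β : ℚ, β ≠ 0 ∧ fd 4 x = algebraMap ℤ ℚ (gw GZ z.a4) * β ^ 2) ∧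
    (z.tag = 1 → (lz2.P ℚ).ge (x - 1) 3) ∧ (z.tag = 2 → (lz2.P ℚ).ge (x - 2) 3) := by
  obtain ⟨w0, hw0, b0, hb0, E0⟩ := word_exists h (k := 0) (by norm_num)
  obtain ⟨w1, hw1, b1, hb1, E1⟩ := word_exists h (k := 1) (by norm_num)
  obtain ⟨w2, hw2, b2, hb2, E2⟩ := word_exists h (k := 2) (by norm_num)
  obtain ⟨w3, hw3, b3, hb3, E3⟩ := word_exists h (k := 3) (by norm_num)
  obtain ⟨w4, hw4, b4, hb4, E4⟩ := word_exists h (k := 4) (by norm_num)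
  obtain ⟨s, hs, s0, s1, s2, s3, s4⟩ := sign_spec h (word_neg hb0 E0) (word_neg hb1 E1) (word_neg hb2 E2) (word_neg hb3 E3) (word_neg hb4 E4)
  obtain ⟨a, ha, ⟨a0, a1, a2, a3, a4⟩, ta, ta'⟩ := two_spec h
  obtain ⟨b, hb, ⟨c0', c1, c2, c3, c4⟩, -⟩ := Qt_spec (okp_spec h _ _ (by decide +kernel) q11)
  obtain ⟨c, hc, ⟨d0, d1, d2, d3, d4⟩, -⟩ := Qt_spec (okp_spec h _ _ (by decide +kernel) q19)
  obtain ⟨d, hd, ⟨e0, e1, e2, e3, e4⟩, -⟩ := Qt_spec (okp_spec h _ _ (by decide +kernel) q173t)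
  obtain ⟨e, he, ⟨f0, f1, f2, f3, f4⟩, -⟩ := Qt_spec (okp_spec h _ _ (by decide +kernel) q3)
  obtain ⟨f, hf, ⟨g0, g1, g2, g3, g4⟩, -⟩ := Qt_spec (okp_spec h _ _ (by decide +kernel) q7t)
  obtain ⟨g, hg, ⟨h0, h1, h2, h3, h4⟩, -⟩ := Qt_spec (okp_spec h _ _ (by decide +kernel) q947t)
  obtain ⟨p, hp, ⟨i0, i1, i2, i3, i4⟩, ti⟩ := Qt_spec (okp_spec h _ _ (by decide +kernel) q29t)
  obtain ⟨i, hi, ⟨j0, j1, j2, j3, j4⟩, tj⟩ := Qt_spec (okp_spec h _ _ (by decide +kernel) q47t)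
  obtain ⟨j, hj, ⟨k0, k1, k2, k3, k4⟩, -⟩ := Qt_spec (okp_spec h _ _ (by decide +kernel) q41t)
  obtain ⟨k, hk, ⟨l0, l1, l2, l3, l4⟩, -⟩ := Qt_spec (okp_spec h _ _ (by decide +kernel) q461t)
  obtain ⟨l, hl, ⟨m0, m1, m2, m3, m4⟩, tl⟩ := Qt_spec (okp_spec h _ _ (by decide +kernel) q59t)
  obtain ⟨m, hm, ⟨n0, n1, n2, n3, n4⟩, -⟩ := Qt_spec (okp_spec h _ _ (by decide +kernel) q1103t)
  have W : ∀ L : Loc ℤ, (GZ.all fun g => (L.vc g).isSome) = true → (L.P ℚ).cd (fd 0 x) = xs L w0 ∧ (L.P ℚ).cd (fd 1 x) = xs L w1 ∧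
      (L.P ℚ).cd (fd 2 x) = xs L w2 ∧ (L.P ℚ).cd (fd 3 x) = xs L w3 ∧ (L.P ℚ).cd (fd 4 x) = xs L w4 :=
    fun L hL => ⟨word_cd hb0 E0 L hL, word_cd hb1 E1 L hL, word_cd hb2 E2 L hL, word_cd hb3 E3 L hL, word_cd hb4 E4 L hL⟩
  obtain ⟨u0, u1, u2, u3, u4⟩ := W lz2 (by decide +kernel)
  rw [u0] at a0; rw [u1] at a1; rw [u2] at a2; rw [u3] at a3; rw [u4] at a4
  obtain ⟨u0, u1, u2, u3, u4⟩ := W z11 (by decide +kernel)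
  rw [u0] at c0'; rw [u1] at c1; rw [u2] at c2; rw [u3] at c3; rw [u4] at c4
  obtain ⟨u0, u1, u2, u3, u4⟩ := W z19 (by decide +kernel)
  rw [u0] at d0; rw [u1] at d1; rw [u2] at d2; rw [u3] at d3; rw [u4] at d4
  obtain ⟨u0, u1, u2, u3, u4⟩ := W z173 (by decide +kernel)
  rw [u0] at e0; rw [u1] at e1; rw [u2] at e2; rw [u3] at e3; rw [u4] at e4
  obtain ⟨u0, u1, u2, u3, u4⟩ := W z3 (by decide +kernel)
  rw [u0] at f0; rw [u1] at f1; rw [u2] at f2; rw [u3] at f3; rw [u4] at f4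
  obtain ⟨u0, u1, u2, u3, u4⟩ := W z7 (by decide +kernel)
  rw [u0] at g0; rw [u1] at g1; rw [u2] at g2; rw [u3] at g3; rw [u4] at g4
  obtain ⟨u0, u1, u2, u3, u4⟩ := W z947 (by decide +kernel)
  rw [u0] at h0; rw [u1] at h1; rw [u2] at h2; rw [u3] at h3; rw [u4] at h4
  obtain ⟨u0, u1, u2, u3, u4⟩ := W z29 (by decide +kernel)
  rw [u0] at i0; rw [u1] at i1; rw [u2] at i2; rw [u3] at i3; rw [u4] at i4
  rw [u0, u1, u2, u3, u4] at ti
  obtain ⟨u0, u1, u2, u3, u4⟩ := W z47 (by decide +kernel)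
  rw [u0] at j0; rw [u1] at j1; rw [u2] at j2; rw [u3] at j3; rw [u4] at j4
  rw [u0, u1, u2, u3, u4] at tj
  obtain ⟨u0, u1, u2, u3, u4⟩ := W z41 (by decide +kernel)
  rw [u0] at k0; rw [u1] at k1; rw [u2] at k2; rw [u3] at k3; rw [u4] at k4
  obtain ⟨u0, u1, u2, u3, u4⟩ := W z461 (by decide +kernel)
  rw [u0] at l0; rw [u1] at l1; rw [u2] at l2; rw [u3] at l3; rw [u4] at l4
  obtain ⟨u0, u1, u2, u3, u4⟩ := W z59 (by decide +kernel)
  rw [u0] at m0; rw [u1] at m1; rw [u2] at m2; rw [u3] at m3; rw [u4] at m4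
  rw [u0, u1, u2, u3, u4] at tl
  obtain ⟨u0, u1, u2, u3, u4⟩ := W z1103 (by decide +kernel)
  rw [u0] at n0; rw [u1] at n1; rw [u2] at n2; rw [u3] at n3; rw [u4] at n4
  have N0 := Nw_eq hw0; have N1 := Nw_eq hw1; have N2 := Nw_eq hw2; have N3 := Nw_eq hw3; have N4 := Nw_eq hw4
  unfold Nw at N0 N1 N2 N3 N4
  rw [← a0, ← c0', ← d0, ← e0, ← s0, ← f0, ← g0, ← i0, ← j0, ← k0, ← l0, ← h0, ← m0, ← n0] at N0
  rw [← a1, ← c1, ← d1, ← e1, ← s1, ← f1, ← g1, ← i1, ← j1, ← k1, ← l1, ← h1, ← m1, ← n1] at N1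
  rw [← a2, ← c2, ← d2, ← e2, ← s2, ← f2, ← g2, ← i2, ← j2, ← k2, ← l2, ← h2, ← m2, ← n2] at N2
  rw [← a3, ← c3, ← d3, ← e3, ← s3, ← f3, ← g3, ← i3, ← j3, ← k3, ← l3, ← h3, ← m3, ← n3] at N3
  rw [← a4, ← c4, ← d4, ← e4, ← s4, ← f4, ← g4, ← i4, ← j4, ← k4, ← l4, ← h4, ← m4, ← n4] at N4
  obtain ⟨y1, y2, y3⟩ := zz (f := T5.a1) (g := T5.a2) (h := T5.a4) e7_z hf
  obtain ⟨y4, y5, y6⟩ := zz (f := T5.a0) (g := T5.a1) (h := T5.a3) e29_z hp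
  obtain ⟨y7, y8, y9⟩ := zz (f := T5.a1) (g := T5.a3) (h := T5.a4) e47_z hi
  obtain ⟨y10, y11, y12⟩ := zz (f := T5.a2) (g := T5.a3) (h := T5.a4) e41_z hj
  obtain ⟨y13, y14, y15⟩ := zz (f := T5.a0) (g := T5.a2) (h := T5.a3) e461_z hk
  obtain ⟨y16, y17, y18⟩ := zz (f := T5.a0) (g := T5.a1) (h := T5.a2) e947_z hg
  obtain ⟨y19, y20, y21⟩ := zz (f := T5.a1) (g := T5.a2) (h := T5.a3) e59_z hl
  obtain ⟨y22, y23, y24⟩ := zz (f := T5.a1) (g := T5.a2) (h := T5.a3) e1103_z hm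
  simp only [y4, y13, y16, Nat.xor_zero] at N0
  simp only [y1, y5, y7, y17, y19, y22, Nat.xor_zero] at N1
  simp only [y2, y10, y14, y18, y20, y23, Nat.xor_zero] at N2
  simp only [y6, y8, y11, y15, y21, y24, Nat.xor_zero] at N3
  simp only [y3, y9, y12, Nat.xor_zero] at N4
  unfold K29 xs at ti
  unfold K47 xs at tj
  unfold K59 xs at tl
  rw [g29_eq] at ti
  rw [g47_eq] at tj
  rw [g59_eq] at tl
  obtain ⟨z, hz, r0, r1, r2, r3, r4, rt⟩ := srch_spec ha hb hc hd hs he hf hg hp hi hj hk hl hm N0 N1 N2 N3 N4 ti tj tl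
  rw [rt] at ta ta'
  subst r0 r1 r2 r3 r4
  exact ⟨z, hz, ⟨b0, hb0, E0⟩, ⟨b1, hb1, E1⟩, ⟨b2, hb2, E2⟩, ⟨b3, hb3, E3⟩, ⟨b4, hb4, E4⟩, ta, ta'⟩

/-- a square class -/
def Sq (d : ℤ) (y : ℚ) : Prop := ∃ β : ℚ, β ≠ 0 ∧ y = (d : ℚ) * β ^ 2

/-- the shape of a class -/
def Cls (x : ℚ) (d0 d1 d2 d3 d4 : ℤ) : Prop := Sq d0 (fd 0 x) ∧ Sq d1 (fd 1 x) ∧ Sq d2 (fd 2 x) ∧ Sq d3 (fd 3 x) ∧ Sq d4 (fd 4 x)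

lemma stage1' {x : ℚ} (h : Pt x) : (Cls x (-1) 1 22 38 346 ∧ (lz2.P ℚ).ge (x - 1) 3) ∨
    (Cls x (-31739469821521) 41 47 7 130154 ∧ (lz2.P ℚ).ge (x - 2) 3) ∨
    (Cls x (-41) 186382761 6 22 922 ∧ (lz2.P ℚ).ge (x - 1) 3) ∨
    Cls x (-72314) (-72314) (-72314) (-72314) (-72314) ∨ Cls x (-47) (-6) (-295691946) 1 58 ∨ Cls x (-7) (-22) (-1) (-43579046) (-1894) := by
  have E : ∀ {k w : ℕ} {d : ℤ}, gw GZ w = d → (∃ β : ℚ, β ≠ 0 ∧ fd k x = algebraMap ℤ ℚ (gw GZ w) * β ^ 2) → Sq d (fd k x) := by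
    rintro k w d rfl ⟨β, h1, h2⟩; exact ⟨β, h1, h2⟩
  obtain ⟨z, hz, p0, p1, p2, p3, p4, t1, t2⟩ := stage1 h
  simp only [six, List.mem_cons, List.not_mem_nil, or_false] at hz
  rcases hz with rfl | rfl | rfl | rfl | rfl | rfl
  · exact .inl ⟨⟨E (by decide +kernel) p0, E (by decide +kernel) p1, E (by decide +kernel) p2, E (by decide +kernel) p3, E (by decide +kernel) p4⟩, t1 rfl⟩
  · exact .inr (.inl ⟨⟨E (by decide +kernel) p0, E (by decide +kernel) p1, E (by decide +kernel) p2, E (by decide +kernel) p3, E (by decide +kernel) p4⟩, t2 rfl⟩)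
  · exact .inr (.inr (.inl ⟨⟨E (by decide +kernel) p0, E (by decide +kernel) p1, E (by decide +kernel) p2, E (by decide +kernel) p3, E (by decide +kernel) p4⟩, t1 rfl⟩))
  · exact .inr (.inr (.inr (.inl ⟨E (by decide +kernel) p0, E (by decide +kernel) p1, E (by decide +kernel) p2, E (by decide +kernel) p3, E (by decide +kernel) p4⟩)))
  · exact .inr (.inr (.inr (.inr (.inl ⟨E (by decide +kernel) p0, E (by decide +kernel) p1, E (by decide +kernel) p2, E (by decide +kernel) p3, E (by decide +kernel) p4⟩))))
  · exact .inr (.inr (.inr (.inr (.inr ⟨E (by decide +kernel) p0, E (by decide +kernel) p1, E (by decide +kernel) p2, E (by decide +kernel) p3, E (by decide +kernel) p4⟩))))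
end KZB

set_option linter.unusedSectionVars false
set_option linter.unusedVariables false
set_option linter.unusedSimpArgs false
namespace KZB

/-! ### the rational classes -/

lemma cls_inf {x : ℚ} (h : Cls x (-72314) (-72314) (-72314) (-72314) (-72314)) : False := by
  obtain ⟨-, ⟨b1, n1, h1⟩, ⟨b2, n2, h2⟩, ⟨b3, n3, h3⟩, -⟩ := h
  simp only [fd] at h1 h2 h3
  push_cast at h1 h2 h3
  refine noneI (-72314 * b1 / 2) (-72314 * b2 / 2) (-72314 * b3 / 2) ⟨?_, ?_⟩
  · simp only [AI, am_int]; push_cast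
    linear_combination (72314 / 4 : ℚ) * (h1 - h2)
  · simp only [BI, am_int]; push_cast
    linear_combination (72314 / 4 : ℚ) * (h1 - h3)

lemma cls_three {x : ℚ} (h : Cls x (-47) (-6) (-295691946) 1 58) : False := by
  obtain ⟨⟨b0, n0, h0⟩, ⟨b1, n1, h1⟩, ⟨b2, n2, h2⟩, ⟨b3, n3, h3⟩, -⟩ := h
  simp only [fd] at h0 h1 h2 h3
  push_cast at h0 h1 h2 h3
  refine noneT (b0 / b2) (b1 / b2) (1 / b2) ⟨?_, ?_⟩
  · simp only [AT, am_int]; push_cast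
    rw [div_pow, div_pow, ← sub_div, div_eq_iff (pow_ne_zero 2 n2)]
    linear_combination (1 / 47 : ℚ) * h0 - (1 / 6 : ℚ) * h1 + (1 / 6 - 1 / 47 : ℚ) * h2
  · simp only [BT, am_int]; push_cast
    rw [div_pow, div_pow, ← sub_div, div_eq_iff (pow_ne_zero 2 n2)]
    linear_combination (1 / 47 : ℚ) * h0 - (1 / 47 : ℚ) * h2

lemma cls_m13 {x : ℚ} (h : Cls x (-7) (-22) (-1) (-43579046) (-1894)) : False := by
  obtain ⟨⟨b0, n0, h0⟩, ⟨b1, n1, h1⟩, ⟨b2, n2, h2⟩, ⟨b3, n3, h3⟩, -⟩ := h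
  simp only [fd] at h0 h1 h2 h3
  push_cast at h0 h1 h2 h3
  refine noneM (11 * b0 / b3) (33 * b1 / b3) (33 / b3) ⟨?_, ?_⟩
  · simp only [AM, am_int]; push_cast
    rw [div_pow, div_pow, ← sub_div, div_eq_iff (pow_ne_zero 2 n3)]
    linear_combination (121 / 7 : ℚ) * h0 - (1089 / 22 : ℚ) * h1 + (1089 / 22 - 121 / 7 : ℚ) * h3
  · simp only [BM, am_int]; push_cast
    rw [div_pow, div_pow, ← sub_div, div_eq_iff (pow_ne_zero 2 n3)]
    linear_combination (121 / 7 : ℚ) * h0 - (121 / 7 : ℚ) * h3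

/-! ### passing to the cubic field -/

/-- the inclusion of the rationals -/
def oq : ℚ →+* C3 ℚ where
  toFun := C3.ofA
  map_one' := rfl
  map_zero' := rfl
  map_mul' x y := by ext <;> simp [C3.ofA]
  map_add' x y := by ext <;> simp [C3.ofA]

lemma oq_inj : Function.Injective oq := by
  intro x y h
  exact congrArg C3.a h

instance : CharZero (C3 ℚ) := charZero_of_injective_ringHom oq_inj

lemma oq_ne {x : ℚ} (h : x ≠ 0) : oq x ≠ 0 := fun h0 => h (oq_inj (h0.trans (map_zero oq).symm))

lemma oq_a (x : ℚ) : (oq x).a = x := rfl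
lemma oq_b (x : ℚ) : (oq x).b = 0 := rfl
lemma oq_c (x : ℚ) : (oq x).c = 0 := rfl
lemma num_oq (n : ℕ) [n.AtLeastTwo] : (OfNat.ofNat n : C3 ℚ) = oq (OfNat.ofNat n) := (map_ofNat oq n).symm

/-- the generator -/
def th : C3 ℚ := ⟨0, 1, 0⟩

/-- the inclusion of the integers -/
noncomputable abbrev ak : C3 ℤ →+* C3 ℚ := algebraMap (C3 ℤ) (C3 ℚ)

lemma ak_a (x : C3 ℤ) : (ak x).a = x.a := rfl
lemma ak_b (x : C3 ℤ) : (ak x).b = x.b := rfl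
lemma ak_c (x : C3 ℤ) : (ak x).c = x.c := rfl

lemma ak_ofA (n : ℤ) : ak (C3.ofA n) = oq n := C3.inc_ofA n

lemma ak_int (n : ℤ) : ak (C3.ofA n) = (n : C3 ℚ) := by rw [ak_ofA, map_intCast]

lemma ofA_dvd {a b : ℤ} (h : a ∣ b) : C3.ofA a ∣ C3.ofA b := by
  obtain ⟨k, rfl⟩ := h
  exact ⟨C3.ofA k, by ext <;> simp [C3.ofA]⟩

lemma nd_ofA {p a : ℤ} {q : C3 ℤ} (hp : Prime p) (hq : Prime q) (hd : q ∣ C3.ofA p) (ha : ¬ p ∣ a) : ¬ q ∣ C3.ofA a := by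
  intro h
  obtain ⟨u, v, e⟩ := (Prime.coprime_iff_not_dvd hp).2 ha
  apply hq.not_isUnit
  rw [isUnit_iff_dvd_one]
  have e2 : (1 : C3 ℤ) = C3.ofA u * C3.ofA p + C3.ofA v * C3.ofA a := by
    ext <;> simp [C3.ofA]; exact e.symm
  rw [e2]
  exact dvd_add (Dvd.dvd.mul_left hd _) (Dvd.dvd.mul_left h _)

lemma v_zero_of_nd {q g : C3 ℤ} {t : ℕ} (U : UC q t) (h : ¬ q ∣ g) :
    (mkPlace (C3 ℚ) U).v (ak g) = 0 := by
  have h1 := (v_algebraMap_pos (F := C3 ℚ) U (ne_of_nd h))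
  have h2 := v_algebraMap_nonneg (F := C3 ℚ) U (ne_of_nd h)
  have : ¬ 1 ≤ (mkPlace (C3 ℚ) U).v (ak g) := fun h3 => h (h1.1 h3)
  change 0 ≤ (mkPlace (C3 ℚ) U).v (ak g) at h2
  omega

lemma v_zpow {F : Type} [Field F] (P : Place F) (x : F) (hx : x ≠ 0) (k : ℤ) : P.v (x ^ k) = k * P.v x := by
  obtain ⟨n, rfl | rfl⟩ := Int.eq_nat_or_neg k
  · rw [zpow_natCast, P.v_pow x hx]
  · rw [zpow_neg, zpow_natCast, P.v_inv _ (pow_ne_zero _ hx), P.v_pow x hx]; ring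

/-- valuations of rational numbers in the cubic field -/
lemma v_oq {p : ℤ} {t : ℕ} (U : UC p t) {q : C3 ℤ} {s : ℕ} (V : UC q s) (hd : q ∣ C3.ofA p) {y : ℚ} (hy : y ≠ 0) :
    (mkPlace (C3 ℚ) V).v (oq y) = (mkPlace ℚ U).v y * (mkPlace (C3 ℚ) V).v (oq p) := by
  obtain ⟨k, a, b, h⟩ := exists_rep (R := ℤ) U.prime y hy
  have e : (mkPlace ℚ U).v y = k := vv_rep U.prime h
  obtain ⟨ha, hb, h⟩ := h
  have ha' := nd_ofA U.prime V.prime hd ha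
  have hb' := nd_ofA U.prime V.prime hd hb
  have h2 := congrArg oq h
  have hp : oq p ≠ 0 := oq_ne (by exact_mod_cast U.prime.ne_zero)
  have ha0 : ak (C3.ofA a) ≠ 0 := am_ne (ne_of_nd ha')
  have hb0 : ak (C3.ofA b) ≠ 0 := am_ne (ne_of_nd hb')
  rw [map_mul, map_mul, map_zpow₀, am_int, am_int, am_int, ← ak_ofA a, ← ak_ofA b] at h2
  have h3 := congrArg (mkPlace (C3 ℚ) V).v h2
  rw [Place.v_mul _ _ _ (oq_ne hy) hb0, Place.v_mul _ _ _ (zpow_ne_zero _ hp) ha0, v_zpow _ _ hp, v_zero_of_nd V ha',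
    v_zero_of_nd V hb'] at h3
  rw [e]; linarith

/-- transfer of congruences -/
lemma ge_oq {p : ℤ} {t : ℕ} (U : UC p t) {q : C3 ℤ} {s : ℕ} (V : UC q s) (hd : q ∣ C3.ofA p) {y : ℚ} {n m : ℕ}
    (hm : (m : ℤ) ≤ (mkPlace (C3 ℚ) V).v (oq p)) (h : (mkPlace ℚ U).ge y n) : (mkPlace (C3 ℚ) V).ge (oq y) (n * m) := by
  by_cases hy : y = 0
  · left; rw [hy, map_zero]
  · right
    rw [v_oq U V hd hy]
    have := h.resolve_left hy
    gcongr
    exact le_trans (by positivity) this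

lemma T_ne (x : ℚ) : oq x - th ≠ 0 := by
  intro h
  have := congrArg C3.b h
  simp only [C3.sub_b, oq_b, th, C3.zero_b] at this
  norm_num at this

lemma cub_th : th ^ 3 + 2 * th ^ 2 + 3 * th + 4 = 0 := by
  have e3 : th ^ 3 = th * th * th := by ring
  rw [e3, pow_two]
  simp only [num_oq]
  ext <;> simp only [th, C3.add_a, C3.add_b, C3.add_c, C3.mul_a, C3.mul_b, C3.mul_c, oq_a, oq_b, oq_c, C3.zero_a, C3.zero_b, C3.zero_c] <;> norm_num

lemma th_ak : th = ak ⟨0, 1, 0⟩ := by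
  ext <;> simp only [th, ak_a, ak_b, ak_c] <;> norm_num

lemma int_sub_th (r : ℤ) : oq r - th = ak ⟨r, -1, 0⟩ := by
  ext <;> simp only [th, ak_a, ak_b, ak_c, C3.sub_a, C3.sub_b, C3.sub_c, oq_a, oq_b, oq_c] <;> norm_num

/-- `T - θ` has even valuation at good primes -/
lemma evenT {x : ℚ} {d : ℤ} (hd : d ≠ 0) (h : Sq d (fd 4 x)) {q : C3 ℤ} (hq : Prime q) (hf : ¬ q ∣ ⟨3, 4, 3⟩)
    (hc : ¬ q ∣ C3.ofA d ∨ ∃ r : ℤ, (mkPlace (C3 ℚ) (UC.triv hq)).ge (oq x - oq r) 1 ∧ ¬ q ∣ ⟨r, -1, 0⟩) :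
    (mkPlace (C3 ℚ) (UC.triv hq)).v (oq x - th) % 2 = 0 := by
  set P := mkPlace (C3 ℚ) (UC.triv hq) with hP
  have gth : P.ge th 0 := by rw [th_ak]; exact ge_algebraMap (UC.triv hq) _
  have gint : ∀ n : ℤ, P.ge (n : C3 ℚ) 0 := fun n => by rw [← ak_int]; exact ge_algebraMap (UC.triv hq) _
  rcases hc with hc | ⟨r, h1, h2⟩
  · obtain ⟨β, hβ, e⟩ := h
    have h3 := congrArg oq e
    simp only [fd, map_add, map_mul, map_pow, map_ofNat] at h3
    set T := oq x with hT
    set z := T ^ 2 + (th + 2) * T + (th ^ 2 + 2 * th + 3) with hz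
    have h4 : (T - th) * z = oq d * (oq β) ^ 2 := by
      rw [← h3, hz]; linear_combination -cub_th
    have hd0 : oq d ≠ 0 := oq_ne (by exact_mod_cast hd)
    have hb0 : oq β ≠ 0 := oq_ne hβ
    have hTn : T - th ≠ 0 := T_ne x
    have hz0 : z ≠ 0 := by
      intro h0; rw [h0, mul_zero] at h4
      exact mul_ne_zero hd0 (pow_ne_zero 2 hb0) h4.symm
    have hvd : P.v (oq d) = 0 := by rw [← ak_ofA]; exact v_triv_zero hq hc
    have h5 := congrArg P.v h4
    rw [P.v_mul _ _ hTn hz0, P.v_mul _ _ hd0 (pow_ne_zero 2 hb0), P.v_pow _ hb0, hvd] at h5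
    by_cases hT0 : P.ge T 0
    · by_cases hv : 1 ≤ P.v (T - th)
      · -- z is a unit
        have ef : 3 * th ^ 2 + 4 * th + 3 = ak ⟨3, 4, 3⟩ := by
          rw [pow_two]
          simp only [num_oq]
          ext <;> simp only [th, C3.add_a, C3.add_b, C3.add_c, C3.mul_a, C3.mul_b, C3.mul_c, oq_a, oq_b, oq_c, ak_a, ak_b, ak_c] <;> norm_num
        have vf : P.v (3 * th ^ 2 + 4 * th + 3) = 0 := by rw [ef]; exact v_triv_zero hq hf
        have nf : (3 * th ^ 2 + 4 * th + 3 : C3 ℚ) ≠ 0 := by rw [ef]; exact am_ne (ne_of_nd hf)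
        have hcl : P.ge (z - (3 * th ^ 2 + 4 * th + 3)) (P.v (3 * th ^ 2 + 4 * th + 3) + 1) := by
          have e1 : z - (3 * th ^ 2 + 4 * th + 3) = (T - th) * (T + (((2 : ℤ) : C3 ℚ) * th + ((2 : ℤ) : C3 ℚ))) := by
            rw [hz]; push_cast; ring
          rw [e1, vf, show (0 + 1 : ℤ) = 1 + 0 by norm_num]
          have g2 : P.ge (((2 : ℤ) : C3 ℚ) * th) 0 := by simpa using Place.ge_mul (gint 2) gth
          exact Place.ge_mul (Or.inr hv) (Place.ge_add hT0 (Place.ge_add g2 (gint 2)))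
        have := (Place.v_eq_of_close nf hcl).2
        rw [vf] at this
        rw [this] at h5
        push_cast at h5
        omega
      · have := Place.v_of_ge (Place.ge_sub hT0 gth) hTn
        omega
    · have hT1 : T ≠ 0 := fun h0 => hT0 (Or.inl h0)
      have hv : P.v T < 0 := by
        by_contra hc; exact hT0 (Or.inr (by omega))
      have e1 : P.v (T - th) = P.v T := by
        have := Place.v_add_eq (P := P) (y := -th) hT1 (Place.ge_mono (Place.ge_neg gth) (by omega))
        rw [← sub_eq_add_neg] at this; exact this.2
      have e2 : P.v z = 2 * P.v T := by
        have g : P.ge ((th + 2) * T + (th ^ 2 + 2 * th + 3)) (P.v (T ^ 2) + 1) := by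
          rw [P.v_pow _ hT1]
          have g2 : P.ge (th + ((2 : ℤ) : C3 ℚ)) 0 := Place.ge_add gth (gint 2)
          have g3 : P.ge (th * th + (((2 : ℤ) : C3 ℚ) * th + ((3 : ℤ) : C3 ℚ))) 0 :=
            Place.ge_add (by simpa using Place.ge_mul gth gth) (Place.ge_add (by simpa using Place.ge_mul (gint 2) gth) (gint 3))
          have g4 := Place.ge_mul g2 (Place.ge_self (P := P) T)
          push_cast at g2 g3 g4
          rw [pow_two, add_assoc (th * th)]
          exact Place.ge_add (Place.ge_mono g4 (by push_cast; omega)) (Place.ge_mono g3 (by push_cast; omega))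
        have := (Place.v_add_eq (pow_ne_zero 2 hT1) g).2
        rw [hz, add_assoc, this, P.v_pow _ hT1]; rfl
      rw [e1, e2] at h5
      rw [e1]
      push_cast at h5
      omega
  · have e : oq x - th = (oq r - th) + (oq x - oq r) := by ring
    have nr : ak ⟨r, -1, 0⟩ ≠ 0 := am_ne (ne_of_nd h2)
    have vr : P.v (ak ⟨r, -1, 0⟩) = 0 := v_triv_zero hq h2
    rw [e, int_sub_th, (Place.v_add_eq (P := P) nr (by rw [vr]; exact h1)).2, vr]; rfl
end KZB

set_option linter.unusedSectionVars false
set_option linter.unusedVariables false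
set_option linter.unusedSimpArgs false
namespace KZB

/-! ### the remaining square root -/

/-- words in the cubic ring -/
def gk : List (C3 ℤ) → ℕ → C3 ℤ
  | [], _ => 1
  | g :: G, w => (if w % 2 = 1 then g else 1) * gk G (w / 2)

lemma gk_zero (G : List (C3 ℤ)) : gk G 0 = 1 := by
  induction G with
  | nil => rfl
  | cons g G ih => simp [gk, ih]

lemma gp_gk (G : List (C3 ℤ)) (i : ℕ) (X : ℕ → Bool) : ∃ w < 2 ^ G.length, gp G i X = gk G w := by
  induction G generalizing i with
  | nil => exact ⟨0, by simp, rfl⟩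
  | cons g G ih =>
    obtain ⟨w, hw, e⟩ := ih (i + 1)
    cases hX : X i
    · refine ⟨2 * w, by rw [List.length_cons, pow_succ]; omega, ?_⟩
      simp [gp, gk, hX, e]
    · refine ⟨2 * w + 1, by rw [List.length_cons, pow_succ]; omega, ?_⟩
      have h1 : (2 * w + 1) / 2 = w := by omega
      have h2 : (2 * w + 1) % 2 = 1 := by omega
      simp [gp, gk, hX, e, h1, h2]

lemma gk_cd (L : Loc (C3 ℤ)) (G : List (C3 ℤ)) (h : (G.all fun g => (L.vc g).isSome) = true) (w : ℕ) :
    ak (gk G w) ≠ 0 ∧ (L.P (C3 ℚ)).cd (ak (gk G w)) = xorsel (G.map L.c) w := by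
  induction G generalizing w with
  | nil => simp [gk, xorsel, Place.cd_one]
  | cons g G ih =>
    rw [List.all_cons, Bool.and_eq_true] at h
    obtain ⟨i1, i2⟩ := ih h.2 (w / 2)
    obtain ⟨g1, g2⟩ := L.c_spec (F := C3 ℚ) h.1
    rw [gk, List.map_cons, xorsel, map_mul]
    by_cases hw : w % 2 = 1
    · rw [if_pos hw, if_pos hw]
      exact ⟨mul_ne_zero g1 i1, by rw [(L.P (C3 ℚ)).cd_mul _ _ g1 i1, g2, i2]⟩
    · rw [if_neg hw, if_neg hw, map_one, one_mul, Nat.zero_xor]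
      exact ⟨i1, i2⟩

/-- an integer which is visibly not a square -/
def nonsq (Ms : List (Loc ℤ)) (n : ℤ) : Bool := Ms.any fun M => (M.vc n).isSome && M.c n != 0

lemma nonsq_spec {Ms : List (Loc ℤ)} {n : ℤ} (h : nonsq Ms n = true) (y : ℚ) : (n : ℚ) ≠ y ^ 2 := by
  intro e
  obtain ⟨M, -, hM⟩ := List.any_eq_true.1 h
  rw [Bool.and_eq_true] at hM
  obtain ⟨h1, h2⟩ := M.c_spec (F := ℚ) hM.1
  rw [am_int] at h1 h2
  have hy : y ≠ 0 := by rintro rfl; rw [e] at h1; simp at h1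
  rw [e, Place.cd_sq hy] at h2
  have h3 := hM.2
  rw [← h2] at h3
  simp at h3

/-- the finite check -/
def eChk (L : Loc (C3 ℤ)) (Ms : List (Loc ℤ)) (G : List (C3 ℤ)) : Bool :=
  (G.all fun g => (L.vc g).isSome) && (List.range (2 ^ G.length)).all fun w =>
    w == 0 || xorsel (G.map L.c) w != 0 || nonsq Ms (C3.nm (gk G w))

lemma eChk_spec {L : Loc (C3 ℤ)} {Ms : List (Loc ℤ)} {G : List (C3 ℤ)} (h : eChk L Ms G = true) {i : ℕ} {X : ℕ → Bool}
    {u β : C3 ℚ} (hβ : β ≠ 0) (hu : u = ak (gp G i X) * β ^ 2) (hc : (L.P (C3 ℚ)).cd u = 0) {y : ℚ} (hn : C3.nm u = y ^ 2) : u = β ^ 2 := by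
  rw [eChk, Bool.and_eq_true] at h
  obtain ⟨w, hw, e⟩ := gp_gk G i X
  rw [e] at hu
  obtain ⟨h1, h2⟩ := gk_cd L G h.1 w
  have h3 := List.all_eq_true.1 h.2 w (List.mem_range.2 hw)
  rw [hu, Place.cd_mul_sq h1 hβ, h2] at hc
  have hβn : C3.nm β ≠ 0 := fun h0 => hβ (C3.nmQ_eq_zero h0)
  have h4 : ¬ nonsq Ms (C3.nm (gk G w)) = true := by
    intro h5
    refine nonsq_spec h5 (y / C3.nm β) ?_
    rw [hu, pow_two, C3.nm_mul, C3.nm_mul, show C3.nm (ak (gk G w)) = _ from C3.nm_inc _] at hn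
    rw [div_pow, ← hn]; field_simp
  simp only [hc, Bool.or_eq_true, h4, beq_iff_eq] at h3
  simp at h3
  rw [hu, h3, gk_zero, map_one, one_mul]

lemma nm_lin (x : ℚ) : C3.nm (oq x - th) = fd 4 x := by
  simp only [C3.nm, C3.sub_a, C3.sub_b, C3.sub_c, oq_a, oq_b, oq_c, th, fd]; ring

/-- `(T - θ)(r - θ)` is a square -/
lemma partE {x : ℚ} {d r k : ℤ} (hd : d ≠ 0) (h : Sq d (fd 4 x)) (hr : fd 4 r = d * k ^ 2) {ps : List ℤ} (hps : d = 2 * ps.prod)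
    (hp : ∀ p ∈ ps, ∃ (t : ℕ) (U : UC p t), (mkPlace ℚ U).ge (x - r) 1) {Ls : List (Loc (C3 ℤ))} {L : Loc (C3 ℤ)} {Ms : List (Loc ℤ)}
    (hs : ((stripAll Ls (⟨3, 4, 3⟩ * ⟨r, -1, 0⟩ * C3.ofA 2)).map fun u => (C3.nm u == 1 || C3.nm u == -1)) = some true)
    (he : eChk L Ms ([-1, ep] ++ Ls.map Loc.pi) = true) (hc : (L.P (C3 ℚ)).cd ((oq x - th) * (oq r - th)) = 0) :
    ∃ γ : C3 ℚ, γ ≠ 0 ∧ γ ^ 2 = (oq x - th) * (oq r - th) := by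
  obtain ⟨u1, hs, hu⟩ := isUnitK_of hs
  have hS : ∀ g ∈ Ls.map Loc.pi, Prime g := by
    intro g hg
    obtain ⟨L, _, rfl⟩ := List.mem_map.1 hg
    exact L.U.prime
  have h0 : (oq x - th) * (oq r - th) ≠ 0 := mul_ne_zero (T_ne x) (T_ne _)
  have hout : ∀ (q : C3 ℤ) (hq : Prime q), (∀ g ∈ Ls.map Loc.pi, ¬ q ∣ g) →
      (mkPlace (C3 ℚ) (UC.triv hq)).v ((oq x - th) * (oq r - th)) % 2 = 0 := by
    intro q hq hg
    have hn : ¬ q ∣ ⟨3, 4, 3⟩ * ⟨r, -1, 0⟩ * C3.ofA 2 := by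
      intro hd
      rcases stripAll_spec hq _ _ _ hs hd with h | ⟨L, hL, h⟩
      · exact hq.not_isUnit (isUnit_of_dvd_unit h hu)
      · exact hg _ (List.mem_map_of_mem hL) h
    have hf : ¬ q ∣ ⟨3, 4, 3⟩ := fun h => hn ((h.mul_right _).mul_right _)
    have hr' : ¬ q ∣ ⟨r, -1, 0⟩ := fun h => hn ((h.mul_left _).mul_right _)
    have h2 : ¬ q ∣ C3.ofA 2 := fun h => hn (h.mul_left _)
    have hvr : (mkPlace (C3 ℚ) (UC.triv hq)).v (oq r - th) = 0 := by rw [int_sub_th]; exact v_triv_zero hq hr'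
    rw [Place.v_mul _ _ _ (T_ne x) (T_ne _), hvr, add_zero]
    refine evenT hd h hq hf ?_
    by_cases hqd : q ∣ C3.ofA d
    · right
      refine ⟨r, ?_, hr'⟩
      have e1 : C3.ofA d = C3.ofA 2 * C3.ofA ps.prod := by
        rw [hps]; ext <;> simp [C3.ofA]
      rw [e1] at hqd
      have h5 := (hq.dvd_or_dvd hqd).resolve_left h2
      have h6 : ∃ p ∈ ps, q ∣ C3.ofA p := by
        clear hps hp e1 hqd
        induction ps with
        | nil => exact absurd (isUnit_of_dvd_one (show q ∣ 1 from h5)) hq.not_isUnit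
        | cons p ps ih =>
          have e2 : C3.ofA (p :: ps).prod = C3.ofA p * C3.ofA ps.prod := by
            ext <;> simp [C3.ofA]
          rw [e2] at h5
          rcases hq.dvd_or_dvd h5 with h6 | h6
          · exact ⟨p, List.mem_cons_self, h6⟩
          · obtain ⟨p', h7, h8⟩ := ih h6
            exact ⟨p', List.mem_cons_of_mem _ h7, h8⟩
      obtain ⟨p, hpp, hqp⟩ := h6
      obtain ⟨t, U, hU⟩ := hp p hpp
      have h1 : ((1 : ℕ) : ℤ) ≤ (mkPlace (C3 ℚ) (UC.triv hq)).v (oq p) := by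
        rw [← ak_ofA]
        have hne : C3.ofA p ≠ 0 := by
          intro h0; exact U.prime.ne_zero (congrArg C3.a h0)
        exact (v_algebraMap_pos (F := C3 ℚ) (UC.triv hq) hne).2 hqp
      have := ge_oq U (UC.triv hq) hqp (n := 1) h1 hU
      rw [map_sub] at this
      simpa using this
    · left; exact hqd
  obtain ⟨X, β, hβ, e⟩ := sunit_F unitK hS _ h0 hout 0
  obtain ⟨b, hb, hb2⟩ := h
  refine ⟨β, hβ, (eChk_spec he hβ e hc (y := d * b * k) ?_).symm⟩
  rw [C3.nm_mul, nm_lin, nm_lin, hb2, ← fd_int, hr]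
  push_cast; ring

/-- codes of `(T-θ)(r-θ)` -/
lemma codeE {x : ℚ} {r z : ℤ} {L : Loc (C3 ℤ)} {n m : ℕ} (hd : L.pi ∣ C3.ofA 2) (hm : (m : ℤ) ≤ (L.P (C3 ℚ)).v (oq (2 : ℤ)))
    (h : (lz2.P ℚ).ge (x - z) n) (hb : bcode L (⟨z, -1, 0⟩ * ⟨r, -1, 0⟩) (n * m) = some 0) :
    (L.P (C3 ℚ)).cd ((oq x - th) * (oq r - th)) = 0 := by
  refine bcode_spec hb ?_
  rw [map_mul, ← int_sub_th, ← int_sub_th]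
  have e : (oq x - th) * (oq r - th) - (oq z - th) * (oq r - th) = oq (x - z) * (oq r - th) := by
    rw [map_sub]; ring
  rw [e]
  have g1 : (L.P (C3 ℚ)).ge (oq (x - z)) (n * m) := ge_oq ucZ2 L.U hd hm h
  have g2 : (L.P (C3 ℚ)).ge (oq r - th) 0 := by rw [int_sub_th]; exact ge_algebraMap L.U _
  simpa using Place.ge_mul g1 g2

lemma la_two : (la.P (C3 ℚ)).v (oq (2 : ℤ)) = 1 := by
  rw [← ak_ofA]; exact (la.vc_spec (F := C3 ℚ) (a := C3.ofA 2) (k := 1) (c := 1) (by decide +kernel)).2.1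
lemma lb_two : (lb.P (C3 ℚ)).v (oq (2 : ℤ)) = 2 := by
  rw [← ak_ofA]; exact (lb.vc_spec (F := C3 ℚ) (a := C3.ofA 2) (k := 2) (c := 4) (by decide +kernel)).2.1
lemma la_dvd : la.pi ∣ C3.ofA 2 := dvd_of_dvK la.U.prime.ne_zero (by decide +kernel)
lemma lb_dvd : lb.pi ∣ C3.ofA 2 := dvd_of_dvK lb.U.prime.ne_zero (by decide +kernel)

lemma Sq.cd {d : ℤ} {y : ℚ} (h : Sq d y) {L : Loc ℤ} (hd : (L.vc d).isSome = true) : (L.P ℚ).cd y = L.c d := by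
  obtain ⟨b1, b2⟩ := L.c_spec (F := ℚ) hd
  obtain ⟨β, hβ, e⟩ := h
  rw [← am_int] at e
  rw [e, Place.cd_mul_sq b1 hβ, b2]

lemma res_int {x : ℚ} (h : Pt x) {L : Loc ℤ} (ht : L.t = 1) {d : ℤ} {k : ℕ} (hd : Sq d (fd k x))
    (hc : ((L.vc (-72314)).isSome && (L.vc d).isSome && L.c (-72314) != L.c d) = true) : (L.P ℚ).ge x 0 := by
  simp only [Bool.and_eq_true, bne_iff_ne] at hc
  rcases ge_or L.U x with hx | ⟨hx, hv⟩
  · exact hx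
  · have ht' : (L.t : ℤ) = 1 := by rw [ht]; rfl
    have := fd_inf_c L.U h hx (by omega) k
    change (L.P ℚ).cd (fd k x) = (L.P ℚ).cd (algebraMap ℤ ℚ (-72314)) at this
    rw [hd.cd hc.1.2, (L.c_spec (F := ℚ) hc.1.1).2] at this
    exact absurd this.symm hc.2

lemma fd_pos {x : ℚ} (h : Pt x) {L : Loc ℤ} {d : ℤ} {k : ℕ} (hd : Sq d (fd k x)) (hx : (L.P ℚ).ge x 0)
    (hc : ((L.vc d).isSome && L.c d % 2 == 1) = true) : (L.P ℚ).ge (fd k x) 1 := by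
  simp only [Bool.and_eq_true, beq_iff_eq] at hc
  have g0 : (L.P ℚ).ge (fd k x) 0 := by
    have := fd_diff L.U (z := 0) hx (by rw [Int.cast_zero, sub_zero]; exact hx) k
    have g := Place.ge_add this (ge_int L.U (fd k 0))
    rwa [sub_add_cancel] at g
  have h1 := Place.v_of_ge g0 (h.ne k)
  right
  by_contra hcon
  have h2 := Place.cd_of_even (P := L.P ℚ) (h.ne k) (by omega)
  rw [hd.cd hc.1] at h2
  omega

lemma cub173 : ((List.range 173).all fun n => n == 25 || (n ^ 3 + 2 * n ^ 2 + 3 * n + 4) % 173 != 0) = true := by decide +kernel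

lemma root173 {z : ℤ} (h : (173 : ℤ) ∣ fd 4 z) : (173 : ℤ) ∣ z - 25 := by
  obtain ⟨r, hr, k, hk⟩ := exists_res (p := 173) (by norm_num) z
  have h1 := List.all_eq_true.1 cub173 r (List.mem_range.2 hr)
  have h2 : (r ^ 3 + 2 * r ^ 2 + 3 * r + 4) % 173 = 0 := by
    have : (173 : ℤ) ∣ ((r ^ 3 + 2 * r ^ 2 + 3 * r + 4 : ℕ) : ℤ) := by
      have e : fd 4 z - ((r ^ 3 + 2 * r ^ 2 + 3 * r + 4 : ℕ) : ℤ) = (z - r) * (z ^ 2 + z * r + r ^ 2 + 2 * z + 2 * r + 3) := by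
        simp only [fd]; push_cast; ring
      have := dvd_sub h (show (173 : ℤ) ∣ fd 4 z - ((r ^ 3 + 2 * r ^ 2 + 3 * r + 4 : ℕ) : ℤ) by
        rw [e]; exact (show (173 : ℤ) ∣ z - r from ⟨k, hk⟩).mul_right _)
      simpa using this
    omega
  simp only [h2, Bool.or_eq_true, beq_iff_eq] at h1
  simp at h1
  push_cast at hk
  omega

lemma gamma25 {x : ℚ} (h : Pt x) (hC : Cls x (-1) 1 22 38 346) (h2 : (lz2.P ℚ).ge (x - 1) 3) :
    ∃ γ : C3 ℚ, γ ≠ 0 ∧ γ ^ 2 = (oq x - th) * (oq (25 : ℤ) - th) := by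
  obtain ⟨s0, s1, s2, s3, s4⟩ := hC
  have hx : (z173.P ℚ).ge x 0 := res_int h rfl s0 (by decide +kernel)
  have hf := fd_pos h s4 hx (by decide +kernel)
  refine partE (d := 346) (r := 25) (k := 7) (by norm_num) s4 (by norm_num [fd]) (ps := [173]) (by norm_num) ?_
    (Ls := [la, lb, k5, k7, k173]) (L := la) (Ms := [z3, z7, z11, z173]) (by decide +kernel) (by decide +kernel) ?_
  · intro p hp
    rw [List.mem_singleton] at hp
    subst hp
    refine ⟨_, ucZ 173 (by norm_num) (by norm_num), ?_⟩
    obtain ⟨z, hz⟩ := exists_residue _ hx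
    have g := fd_diff z173.U hx hz 4
    have g2 := Place.ge_sub hf g
    rw [sub_sub_cancel] at g2
    have g3 := root173 (dvd_of_ge z173.U g2)
    have g4 := Place.ge_add hz (int_ge_one z173.U g3)
    have e : x - z + ((z - 25 : ℤ) : ℚ) = x - ((25 : ℤ) : ℚ) := by push_cast; ring
    rw [e] at g4
    exact g4
  · exact codeE (z := 1) (n := 3) (m := 1) la_dvd la_two.ge (by simpa using h2) (by decide +kernel)

lemma gamma50 {x : ℚ} (h : Pt x) (hC : Cls x (-31739469821521) 41 47 7 130154) (h2 : (lz2.P ℚ).ge (x - 2) 3) :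
    ∃ γ : C3 ℚ, γ ≠ 0 ∧ γ ^ 2 = (oq x - th) * (oq (50 : ℤ) - th) := by
  obtain ⟨s0, s1, s2, s3, s4⟩ := hC
  have hx : (z59.P ℚ).ge x 0 := res_int h rfl s0 (by decide +kernel)
  have hf := fd_pos h s0 hx (by decide +kernel)
  have hx' : (z1103.P ℚ).ge x 0 := res_int h rfl s0 (by decide +kernel)
  have hf' := fd_pos h s0 hx' (by decide +kernel)
  refine partE (d := 130154) (r := 50) (k := 1) (by norm_num) s4 (by norm_num [fd]) (ps := [59, 1103]) (by norm_num) ?_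
    (Ls := [la, lb, k5, k59c, k1103]) (L := lb) (Ms := [z3, z7, z11, z19, z59, z1103]) (by decide +kernel) (by decide +kernel) ?_
  · intro p hp
    simp only [List.mem_cons, List.not_mem_nil, or_false] at hp
    rcases hp with rfl | rfl
    · exact ⟨_, ucZ 59 (by norm_num) (by norm_num), hf⟩
    · exact ⟨_, ucZ 1103 (by norm_num) (by norm_num), hf'⟩
  · exact codeE (z := 2) (n := 3) (m := 2) lb_dvd lb_two.ge (by simpa using h2) (by decide +kernel)

lemma gamma9 {x : ℚ} (h : Pt x) (hC : Cls x (-41) 186382761 6 22 922) (h2 : (lz2.P ℚ).ge (x - 1) 3) :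
    ∃ γ : C3 ℚ, γ ≠ 0 ∧ γ ^ 2 = (oq x - th) * (oq (9 : ℤ) - th) := by
  obtain ⟨s0, s1, s2, s3, s4⟩ := hC
  have hx : (z461.P ℚ).ge x 0 := res_int h rfl s1 (by decide +kernel)
  have hf := fd_pos h s1 hx (by decide +kernel)
  refine partE (d := 922) (r := 9) (k := 1) (by norm_num) s4 (by norm_num [fd]) (ps := [461]) (by norm_num) ?_
    (Ls := [la, lb, k5, k461]) (L := la) (Ms := [z3, z7, z11, z19, z461]) (by decide +kernel) (by decide +kernel) ?_
  · intro p hp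
    simp only [List.mem_cons, List.not_mem_nil, or_false] at hp
    rcases hp with rfl
    exact ⟨_, ucZ 461 (by norm_num) (by norm_num), hf⟩
  · exact codeE (z := 1) (n := 3) (m := 1) la_dvd la_two.ge (by simpa using h2) (by decide +kernel)
end KZB

set_option linter.unusedSectionVars false
set_option linter.unusedVariables false
set_option linter.unusedSimpArgs false
namespace KZB

/-! ### the classes over the cubic field -/

/-- constant -/
def mN9 : C3 ℚ := ⟨22, 11, 11⟩
/-- constant -/
def mF : C3 ℚ := ⟨6, 0, 3⟩
/-- constant -/
def W : C3 ℚ := ⟨-222785640, 30323601 / 2, -161519589 / 2⟩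
/-- constant -/
def O1 : C3 ℚ := ⟨20856528 / 5, -7097013 / 25, 37802457 / 25⟩
/-- constant -/
def O2 : C3 ℚ := ⟨26875728 / 5, -9145213 / 25, 48712257 / 25⟩
/-- constant -/
def O3 : C3 ℚ := ⟨22897413 / 5, -7426188 / 25, 42081732 / 25⟩
/-- constant -/
def dl : C3 ℚ := ⟨1885251692016 / 125, 4785559317 / 5, 798153690411 / 125⟩

lemma eAN : 902 * ak AN = -(63 * 186382761 * mN9 ^ 2) := by
  try simp only [num_oq, pow_two]
  ext <;> simp only [th, AN, BN, AF, BF, AW, BW, W, O1, O2, O3, dl, mN9, mF, C3.add_a, C3.add_b, C3.add_c, C3.sub_a, C3.sub_b, C3.sub_c, C3.neg_a, C3.neg_b, C3.neg_c,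
    C3.mul_a, C3.mul_b, C3.mul_c, oq_a, oq_b, oq_c, ak_a, ak_b, ak_c] <;> norm_num
lemma eBN : 41 * ak BN * (9 - th) = -(186382761 * mN9 ^ 2 * ((9 - th) + 41)) := by
  try simp only [num_oq, pow_two]
  ext <;> simp only [th, AN, BN, AF, BF, AW, BW, W, O1, O2, O3, dl, mN9, mF, C3.add_a, C3.add_b, C3.add_c, C3.sub_a, C3.sub_b, C3.sub_c, C3.neg_a, C3.neg_b, C3.neg_c,
    C3.mul_a, C3.mul_b, C3.mul_c, oq_a, oq_b, oq_c, ak_a, ak_b, ak_c] <;> norm_num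
lemma eAF : 2583 * ak AF = -(22 * 31739469821521 * mF ^ 2) := by
  try simp only [num_oq, pow_two]
  ext <;> simp only [th, AN, BN, AF, BF, AW, BW, W, O1, O2, O3, dl, mN9, mF, C3.add_a, C3.add_b, C3.add_c, C3.sub_a, C3.sub_b, C3.sub_c, C3.neg_a, C3.neg_b, C3.neg_c,
    C3.mul_a, C3.mul_b, C3.mul_c, oq_a, oq_b, oq_c, ak_a, ak_b, ak_c] <;> norm_num
lemma eBF : 41 * ak BF * (50 - th) = -(31739469821521 * mF ^ 2 * ((50 - th) - 41)) := by
  try simp only [num_oq, pow_two]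
  ext <;> simp only [th, AN, BN, AF, BF, AW, BW, W, O1, O2, O3, dl, mN9, mF, C3.add_a, C3.add_b, C3.add_c, C3.sub_a, C3.sub_b, C3.sub_c, C3.neg_a, C3.neg_b, C3.neg_c,
    C3.mul_a, C3.mul_b, C3.mul_c, oq_a, oq_b, oq_c, ak_a, ak_b, ak_c] <;> norm_num
lemma eO1 : 1175 * O1 = -(22 * W) := by
  try simp only [num_oq, pow_two]
  ext <;> simp only [th, AN, BN, AF, BF, AW, BW, W, O1, O2, O3, dl, mN9, mF, C3.add_a, C3.add_b, C3.add_c, C3.sub_a, C3.sub_b, C3.sub_c, C3.neg_a, C3.neg_b, C3.neg_c,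
    C3.mul_a, C3.mul_b, C3.mul_c, oq_a, oq_b, oq_c, ak_a, ak_b, ak_c] <;> norm_num
lemma eO2 : 1575 * O2 = -(38 * W) := by
  try simp only [num_oq, pow_two]
  ext <;> simp only [th, AN, BN, AF, BF, AW, BW, W, O1, O2, O3, dl, mN9, mF, C3.add_a, C3.add_b, C3.add_c, C3.sub_a, C3.sub_b, C3.sub_c, C3.neg_a, C3.neg_b, C3.neg_c,
    C3.mul_a, C3.mul_b, C3.mul_c, oq_a, oq_b, oq_c, ak_a, ak_b, ak_c] <;> norm_num
lemma eO3 : 25 * (50 - th) * O3 = -(W * (25 - th)) := by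
  try simp only [num_oq, pow_two]
  ext <;> simp only [th, AN, BN, AF, BF, AW, BW, W, O1, O2, O3, dl, mN9, mF, C3.add_a, C3.add_b, C3.add_c, C3.sub_a, C3.sub_b, C3.sub_c, C3.neg_a, C3.neg_b, C3.neg_c,
    C3.mul_a, C3.mul_b, C3.mul_c, oq_a, oq_b, oq_c, ak_a, ak_b, ak_c] <;> norm_num
lemma eAW : O1 - O2 = ak AW := by
  try simp only [num_oq, pow_two]
  ext <;> simp only [th, AN, BN, AF, BF, AW, BW, W, O1, O2, O3, dl, mN9, mF, C3.add_a, C3.add_b, C3.add_c, C3.sub_a, C3.sub_b, C3.sub_c, C3.neg_a, C3.neg_b, C3.neg_c,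
    C3.mul_a, C3.mul_b, C3.mul_c, oq_a, oq_b, oq_c, ak_a, ak_b, ak_c] <;> norm_num
lemma eBW : O1 - O3 = ak BW := by
  try simp only [num_oq, pow_two]
  ext <;> simp only [th, AN, BN, AF, BF, AW, BW, W, O1, O2, O3, dl, mN9, mF, C3.add_a, C3.add_b, C3.add_c, C3.sub_a, C3.sub_b, C3.sub_c, C3.neg_a, C3.neg_b, C3.neg_c,
    C3.mul_a, C3.mul_b, C3.mul_c, oq_a, oq_b, oq_c, ak_a, ak_b, ak_c] <;> norm_num
lemma edl : dl ^ 2 = O1 * O2 * O3 := by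
  try simp only [num_oq, pow_two]
  ext <;> simp only [th, AN, BN, AF, BF, AW, BW, W, O1, O2, O3, dl, mN9, mF, C3.add_a, C3.add_b, C3.add_c, C3.sub_a, C3.sub_b, C3.sub_c, C3.neg_a, C3.neg_b, C3.neg_c,
    C3.mul_a, C3.mul_b, C3.mul_c, oq_a, oq_b, oq_c, ak_a, ak_b, ak_c] <;> norm_num
lemma eW : 2 * W = ak ⟨-445571280, 30323601, -161519589⟩ := by
  try simp only [num_oq, pow_two]
  ext <;> simp only [th, AN, BN, AF, BF, AW, BW, W, O1, O2, O3, dl, mN9, mF, C3.add_a, C3.add_b, C3.add_c, C3.sub_a, C3.sub_b, C3.sub_c, C3.neg_a, C3.neg_b, C3.neg_c,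
    C3.mul_a, C3.mul_b, C3.mul_c, oq_a, oq_b, oq_c, ak_a, ak_b, ak_c] <;> norm_num

lemma sub_th_ne (r : ℤ) : (r : C3 ℚ) - th ≠ 0 := by
  have := T_ne r
  rwa [map_intCast] at this

lemma Sq.up {d : ℤ} {y : ℚ} (h : Sq d y) : ∃ B : C3 ℚ, B ≠ 0 ∧ oq y = (d : C3 ℚ) * B ^ 2 := by
  obtain ⟨b, hb, e⟩ := h
  exact ⟨oq b, oq_ne hb, by rw [e, map_mul, map_pow, map_intCast]⟩

lemma cls_nine {x : ℚ} (h : Pt x) (hC : Cls x (-41) 186382761 6 22 922) (h2 : (lz2.P ℚ).ge (x - 1) 3) : False := by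
  obtain ⟨γ, nγ, hγ⟩ := gamma9 h hC h2
  obtain ⟨s0, s1, -, s3, -⟩ := hC
  obtain ⟨B0, n0, h0⟩ := s0.up
  obtain ⟨B1, n1, h1⟩ := s1.up
  obtain ⟨B3, n3, h3⟩ := s3.up
  simp only [fd, map_sub, map_add, map_ofNat] at h0 h1 h3
  push_cast at h0 h1 h3
  rw [map_intCast] at hγ
  have ne := sub_th_ne 9
  push_cast at hγ ne
  have hA := eAN
  have hB := eBN
  generalize oq x = T at *
  generalize mN9 = m at *
  refine noneN (m * B0 / B1) (m * B3 / B1) (m * γ / ((9 - th) * B1)) ⟨?_, ?_⟩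
  · rw [div_pow, div_pow, ← sub_div, div_eq_iff (pow_ne_zero 2 n1)]
    change _ = ak AN * _
    linear_combination m ^ 2 / 41 * h0 + m ^ 2 / 22 * h3 - 63 / 902 * m ^ 2 * h1 - 1 / 902 * B1 ^ 2 * hA
  · change _ = ak BN
    have e1 : (m * B0 / B1) ^ 2 - (m * γ / ((9 - th) * B1)) ^ 2 = (m ^ 2 * B0 ^ 2 * (9 - th) ^ 2 - m ^ 2 * γ ^ 2) / ((9 - th) ^ 2 * B1 ^ 2) := by
      field_simp
    rw [e1, div_eq_iff (mul_ne_zero (pow_ne_zero 2 ne) (pow_ne_zero 2 n1))]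
    linear_combination m ^ 2 * (9 - th) ^ 2 / 41 * h0 - m ^ 2 * hγ - (9 - th) * B1 ^ 2 / 41 * hB
      - (9 - th) * m ^ 2 * ((9 - th) + 41) / 41 * h1

lemma cls_fifty {x : ℚ} (h : Pt x) (hC : Cls x (-31739469821521) 41 47 7 130154) (h2 : (lz2.P ℚ).ge (x - 2) 3) : False := by
  obtain ⟨γ, nγ, hγ⟩ := gamma50 h hC h2
  obtain ⟨s0, s1, -, s3, -⟩ := hC
  obtain ⟨B0, n0, h0⟩ := s0.up
  obtain ⟨B1, n1, h1⟩ := s1.up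
  obtain ⟨B3, n3, h3⟩ := s3.up
  simp only [fd, map_sub, map_add, map_ofNat] at h0 h1 h3
  push_cast at h0 h1 h3
  rw [map_intCast] at hγ
  have ne := sub_th_ne 50
  push_cast at hγ ne
  have hA := eAF
  have hB := eBF
  generalize oq x = T at *
  generalize mF = m at *
  refine noneF (m * B1 / B0) (m * B3 / 3 / B0) (m * γ / ((50 - th) * B0)) ⟨?_, ?_⟩
  · rw [div_pow, div_pow _ B0, ← sub_div, div_eq_iff (pow_ne_zero 2 n0)]
    change _ = ak AF * _
    linear_combination -m ^ 2 / 41 * h1 + m ^ 2 / 63 * h3 + 22 / 2583 * m ^ 2 * h0 - 1 / 2583 * B0 ^ 2 * hA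
  · change _ = ak BF
    have e1 : (m * B1 / B0) ^ 2 - (m * γ / ((50 - th) * B0)) ^ 2 = (m ^ 2 * B1 ^ 2 * (50 - th) ^ 2 - m ^ 2 * γ ^ 2) / ((50 - th) ^ 2 * B0 ^ 2) := by
      field_simp
    rw [e1, div_eq_iff (mul_ne_zero (pow_ne_zero 2 ne) (pow_ne_zero 2 n0))]
    linear_combination -m ^ 2 * (50 - th) ^ 2 / 41 * h1 - m ^ 2 * hγ - (50 - th) * B0 ^ 2 / 41 * hB
      + (50 - th) * m ^ 2 * ((50 - th) - 41) / 41 * h0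

/-- the difference of a point and the known one -/
lemma diff_ts {F : Type} [Field F] {o1 o2 o3 d A B l1 l2 l3 D : F} (hd : d ^ 2 = o1 * o2 * o3) (hA : o1 - o2 = A) (hB : o1 - o3 = B)
    (h1 : l1 ^ 2 * o1 - o1 = D) (h2 : l2 ^ 2 * o2 - o2 = D) (h3 : l3 ^ 2 * o3 - o3 = D) (hD : D ≠ 0) :
    Ts A B (d * (l2 * l3 - l1) / D) (d * (l1 * l3 - l2) / D) (d * (l1 * l2 - l3) / D) := by
  have hD2 := pow_ne_zero 2 hD
  constructor
  · rw [div_pow, div_pow, ← sub_div, div_eq_iff hD2, ← hA]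
    linear_combination ((l2 * l3 - l1) ^ 2 - (l1 * l3 - l2) ^ 2) * hd + o1 * o2 * (l2 ^ 2 - l1 ^ 2) * h3 + D * o1 * h2 - D * o2 * h1
  · rw [div_pow, div_pow, ← sub_div, div_eq_iff hD2, ← hB]
    linear_combination ((l2 * l3 - l1) ^ 2 - (l1 * l2 - l3) ^ 2) * hd + o1 * o3 * (l3 ^ 2 - l1 ^ 2) * h2 + D * o1 * h3 - D * o3 * h1

lemma diff_prod {F : Type} [Field F] {o1 o2 o3 d A B l1 l2 l3 D : F} (hd : d ^ 2 = o1 * o2 * o3) (hA : o1 - o2 = A) (hB : o1 - o3 = B)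
    (h1 : l1 ^ 2 * o1 - o1 = D) (h2 : l2 ^ 2 * o2 - o2 = D) (h3 : l3 ^ 2 * o3 - o3 = D) (hD : D ≠ 0) :
    (d * (l2 * l3 - l1) / D) * (d * ((-l2) * (-l3) - (-l1)) / D) * D = (l1 ^ 2 * o1) * o1 - A * B := by
  have e : (d * (l2 * l3 - l1) / D) * (d * ((-l2) * (-l3) - (-l1)) / D) * D = d ^ 2 * (l2 ^ 2 * l3 ^ 2 - l1 ^ 2) / D := by
    field_simp; ring
  rw [e, div_eq_iff hD, ← hA, ← hB, hd]
  have e1 : l1 ^ 2 * o1 = D + o1 := by linear_combination h1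
  have e2 : l2 ^ 2 * o2 = D + o2 := by linear_combination h2
  have e3 : l3 ^ 2 * o3 = D + o3 := by linear_combination h3
  have e4 : o1 * o2 * o3 * (l2 ^ 2 * l3 ^ 2 - l1 ^ 2) = o1 * (l2 ^ 2 * o2) * (l3 ^ 2 * o3) - o2 * o3 * (l1 ^ 2 * o1) := by ring
  rw [e4, e1, e2, e3]; ring
end KZB

set_option linter.unusedSectionVars false
set_option linter.unusedVariables false
set_option linter.unusedSimpArgs false
namespace KZB

/-! ### the class of the known point -/

/-- the place -/
noncomputable abbrev Pb := lb.P (C3 ℚ)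

lemma vbn (n : ℤ) {k c : ℕ} (h : lb.vc (C3.ofA n) = some (k, c)) : (n : C3 ℚ) ≠ 0 ∧ Pb.v (n : C3 ℚ) = k := by
  have := lb.vc_spec (F := C3 ℚ) h
  rw [← ak_int]
  exact ⟨this.1, this.2.1⟩

lemma vW : W ≠ 0 ∧ Pb.v W = -1 := by
  have h := lb.vc_spec (F := C3 ℚ) (a := ⟨-445571280, 30323601, -161519589⟩) (k := 1) (c := (lb.vc ⟨-445571280, 30323601, -161519589⟩).get!.2) (by decide +kernel)
  have h1 := h.1
  have h2 := h.2.1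
  change ak _ ≠ 0 at h1
  change Pb.v (ak _) = _ at h2
  rw [← eW] at h1 h2
  have n2 := vbn 2 (k := 2) (c := 4) (by decide +kernel)
  push_cast at n2
  have hW : W ≠ 0 := right_ne_zero_of_mul h1
  rw [Pb.v_mul _ _ n2.1 hW, n2.2] at h2
  refine ⟨hW, ?_⟩
  push_cast at h2
  omega

lemma vO1 : O1 ≠ 0 ∧ Pb.v O1 = 1 := by
  have n1 := vbn 1175 (k := 0) (c := (lb.vc (C3.ofA 1175)).get!.2) (by decide +kernel)
  have n2 := vbn (-22) (k := 2) (c := (lb.vc (C3.ofA (-22))).get!.2) (by decide +kernel)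
  push_cast at n1 n2
  have e : 1175 * O1 = -22 * W := by rw [eO1]; ring
  have hO : O1 ≠ 0 := by
    rintro h
    rw [h, mul_zero] at e
    exact mul_ne_zero n2.1 vW.1 e.symm
  have := congrArg Pb.v e
  rw [Pb.v_mul _ _ n1.1 hO, Pb.v_mul _ _ n2.1 vW.1, n1.2, n2.2, vW.2] at this
  refine ⟨hO, ?_⟩
  omega

lemma par3 {a b k : ℤ} (ha : a % 2 = 1) (hb : b % 2 = 1) (h : a + b + (-1 + k * 2) = 2) : False := by
  omega

lemma cls_25 {x : ℚ} (h : Pt x) (hC : Cls x (-1) 1 22 38 346) (h2 : (lz2.P ℚ).ge (x - 1) 3) : x = 25 := by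
  by_contra hx
  obtain ⟨γ, nγ, hγ⟩ := gamma25 h hC h2
  obtain ⟨s0, -, s2, s3, -⟩ := hC
  obtain ⟨B0, n0, h0⟩ := s0.up
  obtain ⟨B2, n2, h2'⟩ := s2.up
  obtain ⟨B3, n3, h3⟩ := s3.up
  simp only [fd, map_sub, map_add, map_ofNat] at h0 h2' h3
  push_cast at h0 h2' h3
  rw [map_intCast] at hγ
  have ne := sub_th_ne 25
  have ne5 := sub_th_ne 50
  push_cast at hγ ne ne5
  -- valuations of the coordinate
  have g1 : Pb.ge (oq (x - 1)) (3 * 2) := by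
    have := ge_oq (p := 2) lz2.U lb.U lb_dvd (n := 3) (m := 2) lb_two.ge h2
    exact_mod_cast this
  have v25 : ∃ k : ℤ, Pb.v (oq (x - 25)) = k * 2 := by
    refine ⟨(lz2.P ℚ).v (x - 25), ?_⟩
    have := v_oq (p := 2) lz2.U lb.U lb_dvd (y := x - 25) (sub_ne_zero.2 hx)
    rw [show (mkPlace (C3 ℚ) lb.U).v (oq (2 : ℤ)) = 2 from lb_two] at this
    exact this
  have n25 : oq (x - 25) ≠ 0 := oq_ne (sub_ne_zero.2 hx)
  rw [map_sub, map_one] at g1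
  rw [map_sub, map_ofNat] at v25 n25
  generalize oq x = T at *
  obtain ⟨k, v25⟩ := v25
  have c2 := vbn (-2) (k := 2) (c := (lb.vc (C3.ofA (-2))).get!.2) (by decide +kernel)
  have c49 := vbn (-49) (k := 0) (c := (lb.vc (C3.ofA (-49))).get!.2) (by decide +kernel)
  have c25 := vbn 25 (k := 0) (c := (lb.vc (C3.ofA 25)).get!.2) (by decide +kernel)
  have c47 := vbn 47 (k := 0) (c := (lb.vc (C3.ofA 47)).get!.2) (by decide +kernel)
  push_cast at c2 c49 c25 c47
  have a3 : T - 3 ≠ 0 ∧ Pb.v (T - 3) = 2 := by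
    have := Place.v_eq_of_close (P := Pb) (x := T - 3) c2.1 (by
      rw [c2.2, show T - 3 - -2 = T - 1 by ring]; exact Place.ge_mono g1 (by norm_num))
    exact ⟨this.1, this.2.trans c2.2⟩
  have a50 : T - 50 ≠ 0 ∧ Pb.v (T - 50) = 0 := by
    have := Place.v_eq_of_close (P := Pb) (x := T - 50) c49.1 (by
      rw [c49.2, show T - 50 - -49 = T - 1 by ring]; exact Place.ge_mono g1 (by norm_num))
    exact ⟨this.1, this.2.trans c49.2⟩
  obtain ⟨D, hD⟩ : ∃ D, D = W * (T - 25) / (25 * (T - 50)) := ⟨_, rfl⟩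
  have D0 : D ≠ 0 := by
    rw [hD]; exact div_ne_zero (mul_ne_zero vW.1 n25) (mul_ne_zero c25.1 a50.1)
  have vD : Pb.v D = -1 + k * 2 := by
    rw [hD, Pb.v_div _ _ (mul_ne_zero vW.1 n25) (mul_ne_zero c25.1 a50.1), Pb.v_mul _ _ vW.1 n25, Pb.v_mul _ _ c25.1 a50.1,
      vW.2, v25, c25.2, a50.2]
    push_cast; ring
  have eB0 : B0 ^ 2 = -(T - 50) := by rw [h0]; ring
  have hl1 : (5 * B2 / B0) ^ 2 * O1 = W * (T - 3) / (47 * (T - 50)) := by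
    rw [div_pow, eB0, div_mul_eq_mul_div, div_eq_div_iff (neg_ne_zero.2 a50.1) (mul_ne_zero c47.1 a50.1)]
    linear_combination B2 ^ 2 * (T - 50) * eO1 + W * (T - 50) * h2'
  have k1 : (5 * B2 / B0) ^ 2 * O1 - O1 = D := by
    rw [hl1, hD, div_sub' (mul_ne_zero c47.1 a50.1), div_eq_div_iff (mul_ne_zero c47.1 a50.1) (mul_ne_zero c25.1 a50.1)]
    linear_combination -(T - 50) ^ 2 * eO1
  have k2 : (5 * B3 / B0) ^ 2 * O2 - O2 = D := by
    rw [hD, div_pow, eB0, div_mul_eq_mul_div, div_sub' (neg_ne_zero.2 a50.1), div_eq_div_iff (neg_ne_zero.2 a50.1) (mul_ne_zero c25.1 a50.1)]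
    linear_combination (-(625 * (T - 50) * O2 / 38)) * h3 + 1 / 38 * (T - 50) * (T - 25) * eO2
  have k3 : (5 * γ / ((25 - th) * B0)) ^ 2 * O3 - O3 = D := by
    have nn : (25 - th) ^ 2 * -(T - 50) ≠ 0 := mul_ne_zero (pow_ne_zero 2 ne) (neg_ne_zero.2 a50.1)
    rw [hD, div_pow, mul_pow (25 - th) B0, eB0, div_mul_eq_mul_div, div_sub' nn, div_eq_div_iff nn (mul_ne_zero c25.1 a50.1)]
    linear_combination 625 * (T - 50) * O3 * hγ + (T - 50) * (T - 25) * (25 - th) * eO3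
  have t1 := diff_ts edl eAW eBW k1 k2 k3 D0
  have t2 := diff_ts (l1 := -(5 * B2 / B0)) (l2 := -(5 * B3 / B0)) (l3 := -(5 * γ / ((25 - th) * B0))) edl eAW eBW
    (by rw [neg_sq]; exact k1) (by rw [neg_sq]; exact k2) (by rw [neg_sq]; exact k3) D0
  have pr := diff_prod edl eAW eBW k1 k2 k3 D0
  obtain ⟨p1, -, p3⟩ := oddsW _ _ _ t1
  obtain ⟨q1, -, q3⟩ := oddsW _ _ _ t2
  have vw : (5 * B2 / B0) ^ 2 * O1 ≠ 0 ∧ Pb.v ((5 * B2 / B0) ^ 2 * O1) = 1 := by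
    rw [hl1]
    refine ⟨div_ne_zero (mul_ne_zero vW.1 a3.1) (mul_ne_zero c47.1 a50.1), ?_⟩
    rw [Pb.v_div _ _ (mul_ne_zero vW.1 a3.1) (mul_ne_zero c47.1 a50.1), Pb.v_mul _ _ vW.1 a3.1, Pb.v_mul _ _ c47.1 a50.1,
      vW.2, a3.2, c47.2, a50.2]
    norm_num
  have vA := lb.vc_spec (F := C3 ℚ) (a := AW) (k := 7) (c := 1) (by decide +kernel)
  have vB := lb.vc_spec (F := C3 ℚ) (a := BW) (k := 0) (c := 2) (by decide +kernel)
  have vy : Pb.v ((5 * B2 / B0) ^ 2 * O1 * O1) = 2 := by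
    rw [Pb.v_mul _ _ vw.1 vO1.1, vw.2, vO1.2]; norm_num
  have fin : Pb.v ((5 * B2 / B0) ^ 2 * O1 * O1 - ak AW * ak BW) = 2 := by
    have g : Pb.ge (-(ak AW * ak BW)) (Pb.v ((5 * B2 / B0) ^ 2 * O1 * O1) + 1) := by
      apply Place.ge_neg
      right
      rw [vy, Pb.v_mul _ _ vA.1 vB.1, vA.2.1, vB.2.1]
      norm_num
    have := (Place.v_add_eq (mul_ne_zero vw.1 vO1.1) g).2
    rw [← sub_eq_add_neg, vy] at this
    exact this
  rw [← pr, Pb.v_mul _ _ (mul_ne_zero p1 q1) D0, Pb.v_mul _ _ p1 q1, vD] at fin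
  exact par3 p3 q3 fin

lemma cubic_ne (x : ℚ) : x ^ 3 + 2 * x ^ 2 + 3 * x + 4 ≠ 0 := by
  intro h
  have h1 := congrArg oq h
  simp only [map_add, map_mul, map_pow, map_ofNat, map_zero] at h1
  have e : (oq x - th) * ((oq x + th) ^ 2 - oq x * th + 2 * (oq x + th) + 3) = 0 := by
    linear_combination h1 - cub_th
  have h2 := congrArg C3.c ((mul_eq_zero.1 e).resolve_left (T_ne x))
  simp only [num_oq, pow_two, th, C3.add_c, C3.sub_c, C3.mul_c, C3.add_a, C3.add_b, oq_a, oq_b, oq_c, C3.zero_c] at h2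
  norm_num at h2

lemma only_25 {x : ℚ} (h : Pt x) : x = 25 := by
  rcases stage1' h with ⟨a, b⟩ | ⟨a, b⟩ | ⟨a, b⟩ | a | a | a
  · exact cls_25 h a b
  · exact (cls_fifty h a b).elim
  · exact (cls_nine h a b).elim
  · first | exact (cls_inf h a).elim | exact (cls_inf a).elim
  · first | exact (cls_three h a).elim | exact (cls_three a).elim
  · first | exact (cls_m13 h a).elim | exact (cls_m13 a).elim
end KZB

/-- The rational points on the affine curve
`y² = -2·11·19·173·(x-50)(x-9)(x-3)(x+13)(x³+2x²+3x+4)`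
(a rescaled model of the rank-1 genus-3 curve from Katz–Zureick-Brown)
are exactly the six listed points. -/
theorem katz_zureick_brown_example_rational_points :
    {P : ℚ × ℚ | P.2 ^ 2 =
        -2 * 11 * 19 * 173 * (P.1 - 50) * (P.1 - 9) * (P.1 - 3) * (P.1 + 13) *
          (P.1 ^ 3 + 2 * P.1 ^ 2 + 3 * P.1 + 4)} =
      ({(50, 0), (9, 0), (3, 0), (-13, 0), (25, 20247920), (25, -20247920)} :
        Set (ℚ × ℚ)) := by
  ext ⟨x, y⟩
  simp only [Set.mem_ofPred_eq, Set.mem_insert_iff, Set.mem_singleton_iff, Prod.mk.injEq]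
  constructor
  · intro e
    by_cases h0 : x = 50
    · subst h0; left; exact ⟨rfl, by simpa using e⟩
    by_cases h1 : x = 9
    · subst h1; right; left; exact ⟨rfl, by simpa using e⟩
    by_cases h2 : x = 3
    · subst h2; right; right; left; exact ⟨rfl, by simpa using e⟩
    by_cases h3 : x = -13
    · subst h3; right; right; right; left; exact ⟨rfl, by simpa using e⟩
    have hp : KZB.Pt x := by
      refine ⟨?_, y, ?_⟩
      · intro k
        match k with
        | 0 => exact sub_ne_zero.2 h0
        | 1 => exact sub_ne_zero.2 h1
        | 2 => exact sub_ne_zero.2 h2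
        | 3 => exact fun h => h3 (eq_neg_of_add_eq_zero_left h)
        | _ + 4 => exact KZB.cubic_ne x
      · simp only [KZB.fd]
        rw [e]; push_cast; ring
    have hx := KZB.only_25 hp
    subst hx
    have e2 : (y - 20247920) * (y + 20247920) = 0 := by linear_combination e
    rcases mul_eq_zero.1 e2 with h | h
    · right; right; right; right; left; exact ⟨rfl, by linear_combination h⟩
    · right; right; right; right; right; exact ⟨rfl, by linear_combination h⟩
  · rintro (⟨rfl, rfl⟩ | ⟨rfl, rfl⟩ | ⟨rfl, rfl⟩ | ⟨rfl, rfl⟩ | ⟨rfl, rfl⟩ | ⟨rfl, rfl⟩) <;> norm_num
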